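/- arXiv:1006.0780 — 2 statements merged into one kernel-verified Lean document; each statement's English description precedes it below -/
import Mathlib

section
/- Let P be an abstract simplicial complex on a finite vertex set V whose geometric realization ‖P‖ is homeomorphic to the sphere S^{d−1}, and let K be a field. Let I ⊆ V be a union of minimal non-faces of P, let Ĵ_1, …, Ĵ_m be all the minimal non-faces of P contained in I, and let Λ_I be the abstract simplicial complex on the vertex set {1, …, m} given by Λ_I = {K ⊆ {1,…,m} : ∪_{k∈K} Ĵ_k ≠ I}. Then for every integer i ≥ 1 there is an isomorphism of K-vector spaces H̃_{d−1−i}(P_{≤Î}; K) ≅ H̃_{|I|−i−2}(Λ_I; K), where Î = V∖I. -/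
open Finset

/-- An abstract simplicial complex on a vertex type `V`: a collection of finite subsets of `V`
(called faces) closed under taking subsets. -/
structure ASC (V : Type) where
  faces : Set (Finset V)
  down_closed : ∀ ⦃σ τ : Finset V⦄, σ ∈ faces → τ ⊆ σ → τ ∈ faces

namespace ASC

variable {V : Type}

/-- `Γ.restrict σ` is the subcomplex `Γ_{≤σ}` of all faces of `Γ` contained in `σ`. -/
def restrict (Γ : ASC V) (σ : Finset V) : ASC V where
  faces := {τ | τ ∈ Γ.faces ∧ τ ⊆ σ}
  down_closed := by
    intro τ τ' h hsub
    exact ⟨Γ.down_closed h.1 hsub, hsub.trans h.2⟩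

/-- The link of `σ` in `Γ`: all faces `τ` with `τ ∪ σ ∈ Γ` and `τ ∩ σ = ∅`. -/
def link [DecidableEq V] (Γ : ASC V) (σ : Finset V) : ASC V where
  faces := {τ | τ ∪ σ ∈ Γ.faces ∧ τ ∩ σ = ∅}
  down_closed := by
    intro τ τ' h hsub
    refine ⟨Γ.down_closed h.1 (Finset.union_subset_union hsub (Finset.Subset.refl σ)), ?_⟩
    rw [← Finset.subset_empty, ← h.2]
    exact Finset.inter_subset_inter hsub (Finset.Subset.refl σ)

/-- The Alexander dual `Γ* = {σ ⊆ V ∣ V∖σ ∉ Γ}`. -/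
def dual [DecidableEq V] [Fintype V] (Γ : ASC V) : ASC V where
  faces := {σ | σᶜ ∉ Γ.faces}
  down_closed := by
    intro σ τ hσ hsub hmem
    exact hσ (Γ.down_closed hmem (Finset.compl_subset_compl.mpr hsub))

/-- A maximal face (facet) of `Γ`. -/
def IsMaximalFace (Γ : ASC V) (τ : Finset V) : Prop :=
  τ ∈ Γ.faces ∧ ∀ τ' ∈ Γ.faces, τ ⊆ τ' → τ' = τ

/-- A minimal non-face of `Γ`: not a face of `Γ`, but all of its proper subsets are faces. -/
def IsMinimalNonFace (Γ : ASC V) (J : Finset V) : Prop :=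
  J ∉ Γ.faces ∧ ∀ J' ⊂ J, J' ∈ Γ.faces

/-- `I` belongs to `U_SR`: it is a union of (a nonempty finite family of)
minimal non-faces of `Γ`. -/
def memUSR [DecidableEq V] (Γ : ASC V) (I : Finset V) : Prop :=
  ∃ S : Finset (Finset V), S.Nonempty ∧ (∀ J ∈ S, Γ.IsMinimalNonFace J) ∧ I = S.sup id

section Homology

variable (K : Type) [Field K] [LinearOrder V]

/-- The `j`-dimensional faces of `Γ` (faces of cardinality `j + 1`). -/
def Cells (Γ : ASC V) (j : ℤ) : Type :=
  {σ : Finset V // σ ∈ Γ.faces ∧ (σ.card : ℤ) = j + 1}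

/-- The space of simplicial `j`-chains with coefficients in `K`, i.e. the free `K`-module on the
`j`-dimensional faces.  (This is the augmented/reduced chain complex: the empty face, if present,
spans the chains in degree `-1`.) -/
def Chains (Γ : ASC V) (j : ℤ) : Type := Cells Γ j →₀ K

noncomputable instance (Γ : ASC V) (j : ℤ) : AddCommGroup (Chains K Γ j) :=
  inferInstanceAs (AddCommGroup (Cells Γ j →₀ K))

noncomputable instance (Γ : ASC V) (j : ℤ) : Module K (Chains K Γ j) :=
  inferInstanceAs (Module K (Cells Γ j →₀ K))

/-- The simplicial boundary map from `j`-chains to `k = (j-1)`-chains, with the usual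
alternating signs determined by the linear order on the vertices. -/
noncomputable def boundary (Γ : ASC V) (j k : ℤ) (hk : k = j - 1) :
    Chains K Γ j →ₗ[K] Chains K Γ k :=
  Finsupp.lsum K fun σ : Cells Γ j =>
    LinearMap.toSpanSingleton K (Chains K Γ k)
      (∑ v ∈ σ.1.attach,
        (Finsupp.single
          (⟨σ.1.erase v.1,
            Γ.down_closed σ.2.1 (Finset.erase_subset _ _), by
              have h1 := Finset.card_erase_of_mem v.2
              have h2 : 1 ≤ σ.1.card := Finset.card_pos.mpr ⟨v.1, v.2⟩
              have h3 := σ.2.2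
              omega⟩ : Cells Γ k)
          ((-1 : K) ^ (σ.1.filter (fun w => w < v.1)).card) : Cells Γ k →₀ K))

/-- Reduced simplicial homology of `Γ` in degree `j` with coefficients in `K`:
cycles modulo (cycles that are boundaries). -/
noncomputable abbrev reducedHomology (Γ : ASC V) (j : ℤ) : Type :=
  ↥(LinearMap.ker (boundary K Γ j (j - 1) rfl)) ⧸
    Submodule.comap (LinearMap.ker (boundary K Γ j (j - 1) rfl)).subtype
      (LinearMap.range (boundary K Γ (j + 1) j (by omega)))

/-- Simplicial `j`-cochains: the `K`-linear dual of the space of `j`-chains. -/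
def Cochains (Γ : ASC V) (j : ℤ) : Type := Chains K Γ j →ₗ[K] K

noncomputable instance (Γ : ASC V) (j : ℤ) : AddCommGroup (Cochains K Γ j) :=
  inferInstanceAs (AddCommGroup (Chains K Γ j →ₗ[K] K))

noncomputable instance (Γ : ASC V) (j : ℤ) : Module K (Cochains K Γ j) :=
  inferInstanceAs (Module K (Chains K Γ j →ₗ[K] K))

/-- The simplicial coboundary map, the dual of the boundary map. -/
noncomputable def coboundary (Γ : ASC V) (j k : ℤ) (hk : k = j + 1) :
    Cochains K Γ j →ₗ[K] Cochains K Γ k :=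
  (boundary K Γ k j (by omega)).dualMap

/-- Reduced simplicial cohomology of `Γ` in degree `j` with coefficients in `K`:
cocycles modulo (cocycles that are coboundaries). -/
noncomputable abbrev reducedCohomology (Γ : ASC V) (j : ℤ) : Type :=
  ↥(LinearMap.ker (coboundary K Γ j (j + 1) rfl)) ⧸
    Submodule.comap (LinearMap.ker (coboundary K Γ j (j + 1) rfl)).subtype
      (LinearMap.range (coboundary K Γ (j - 1) j (by omega)))

end Homology

/-- The geometric realization `‖Γ‖` of `Γ`, as the subset of `V → ℝ` consisting of the
convex-weight functions whose support is a face of `Γ`. -/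
def realization [Fintype V] (Γ : ASC V) : Set (V → ℝ) :=
  {x | (∀ v, 0 ≤ x v) ∧ (∑ v, x v) = 1 ∧ ∃ τ ∈ Γ.faces, ∀ v, x v ≠ 0 ↔ v ∈ τ}

end ASC

namespace FinsetChain

section Operators

variable (K : Type*) [Field K] {V : Type*} [LinearOrder V]

/-- The sign picked up by a vertex `v` when it is moved to the front of `insert v τ`. -/
def sgn (τ : Finset V) (v : V) : K := (-1) ^ #{w ∈ τ | w < v}

lemma sgn_mul_self (τ : Finset V) (v : V) : sgn K τ v * sgn K τ v = 1 := by
  rw [sgn, ← mul_pow]; simp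

lemma sgn_insert {τ : Finset V} {v : V} (h : v ∉ τ) (u : V) :
    sgn K (insert v τ) u = (if v < u then -1 else 1) * sgn K τ u := by
  unfold sgn
  rw [filter_insert]
  split_ifs with hvu
  · rw [card_insert_of_notMem (by simp [h]), pow_succ]; ring
  · simp

lemma sgn_swap {τ : Finset V} {u v : V} (hu : u ∉ τ) (hv : v ∉ τ) (huv : u ≠ v) :
    sgn K (insert v τ) u * sgn K (insert u τ) v + sgn K τ v * sgn K τ u = 0 := by
  rw [sgn_insert K hv, sgn_insert K hu]
  rcases lt_or_gt_of_ne huv with h | h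
  · rw [if_neg h.not_gt, if_pos h]; ring
  · rw [if_pos h, if_neg h.not_gt]; ring

variable [Fintype V]

/-- The simplicial boundary operator on functions on the set of all finsets of vertices. -/
def bd : (Finset V → K) →ₗ[K] (Finset V → K) where
  toFun x τ := ∑ v ∈ τᶜ, sgn K τ v * x (insert v τ)
  map_add' x y := by ext τ; simp [mul_add, sum_add_distrib]
  map_smul' c x := by ext τ; simp [mul_sum, mul_left_comm]

lemma bd_apply (x : Finset V → K) (τ : Finset V) :
    bd K x τ = ∑ v ∈ τᶜ, sgn K τ v * x (insert v τ) := rfl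

/-- The operator of taking the cone with apex `v`. -/
def cone (v : V) : (Finset V → K) →ₗ[K] (Finset V → K) where
  toFun x τ := if v ∈ τ then sgn K (τ.erase v) v * x (τ.erase v) else 0
  map_add' x y := by ext τ; by_cases h : v ∈ τ <;> simp [h, mul_add]
  map_smul' c x := by ext τ; by_cases h : v ∈ τ <;> simp [h, mul_left_comm]

lemma cone_apply (v : V) (x : Finset V → K) (τ : Finset V) :
    cone K v x τ = if v ∈ τ then sgn K (τ.erase v) v * x (τ.erase v) else 0 := rfl

lemma bd_cone (v : V) (x : Finset V → K) : bd K (cone K v x) = x - cone K v (bd K x) := by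
  rw [eq_sub_iff_add_eq]
  ext τ
  rw [Pi.add_apply, bd_apply, cone_apply]
  by_cases hv : v ∈ τ
  · rw [if_pos hv]
    obtain ⟨τ, hv', rfl⟩ : ∃ τ', v ∉ τ' ∧ τ = insert v τ' :=
      ⟨τ.erase v, notMem_erase _ _, (insert_erase hv).symm⟩
    rw [erase_insert hv', bd_apply]
    have hc : τᶜ = insert v (insert v τ)ᶜ := by
      ext w; by_cases hw : w = v <;> simp [hw, hv']
    rw [hc, sum_insert (by simp), mul_add, ← mul_assoc, sgn_mul_self, one_mul, mul_sum,
      add_left_comm, ← sum_add_distrib, sum_eq_zero, add_zero]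
    intro u hu
    simp only [mem_compl, mem_insert, not_or] at hu
    have h1 : (insert u (insert v τ)).erase v = insert u τ := by
      rw [insert_comm, erase_insert]; simp [hv', Ne.symm hu.1]
    rw [cone_apply, if_pos (by simp), h1, ← mul_assoc, ← mul_assoc, ← add_mul,
      sgn_swap K hu.2 hv' hu.1, zero_mul]
  · rw [if_neg hv, add_zero, sum_eq_single v]
    · rw [cone_apply, if_pos (by simp), erase_insert hv, ← mul_assoc, sgn_mul_self, one_mul]
    · intro u _ huv
      rw [cone_apply, if_neg (by simp [hv, Ne.symm huv]), mul_zero]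
    · simp [hv]

lemma bd_single_empty : bd K (Pi.single (∅ : Finset V) (1 : K)) = 0 := by
  ext τ
  rw [bd_apply]
  exact sum_eq_zero fun v _ => by simp

lemma cone_single {v : V} {τ : Finset V} (hv : v ∉ τ) :
    cone K v (Pi.single τ 1) = Pi.single (insert v τ) (sgn K τ v) := by
  ext σ
  rw [cone_apply]
  by_cases h : v ∈ σ
  · rw [if_pos h]
    by_cases h2 : σ = insert v τ
    · subst h2; simp [erase_insert hv]
    · have : σ.erase v ≠ τ := fun h3 => h2 (by rw [← h3, insert_erase h])
      simp [this, h2]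
  · rw [if_neg h, Pi.single_eq_of_ne]
    rintro rfl; simp at h

lemma ext_single {N : Type*} [AddCommGroup N] [Module K N] {f g : (Finset V → K) →ₗ[K] N}
    (h : ∀ σ, f (Pi.single σ 1) = g (Pi.single σ 1)) : f = g := by
  refine LinearMap.pi_ext' fun σ => LinearMap.ext_ring (h σ)

lemma bd_bd (x : Finset V → K) : bd K (bd K x) = 0 := by
  suffices h : (bd K (V := V)) ∘ₗ bd K = 0 from LinearMap.congr_fun h x
  refine ext_single K fun σ => ?_
  induction σ using Finset.induction_on with
  | empty => simp [bd_single_empty]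
  | insert v τ hv ih =>
    have h1 : (Pi.single (insert v τ) 1 : Finset V → K)
        = sgn K τ v • cone K v (Pi.single τ 1) := by
      rw [cone_single K hv, ← Pi.single_smul, smul_eq_mul, sgn_mul_self]
    simp only [LinearMap.comp_apply, LinearMap.zero_apply] at ih ⊢
    rw [h1, map_smul, map_smul, bd_cone, map_sub, bd_cone, ih, map_zero, sub_zero, sub_self,
      smul_zero]

lemma bd_single (σ : Finset V) : bd K (Pi.single σ 1) =
    ∑ v ∈ σ, (Pi.single (σ.erase v) (sgn K (σ.erase v) v) : Finset V → K) := by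
  ext τ
  rw [bd_apply, Finset.sum_apply]
  simp only [Pi.single_apply, mul_ite, mul_one, mul_zero]
  rw [← sum_filter, ← sum_filter]
  refine sum_congr ?_ fun v hv => ?_
  · ext v
    simp only [mem_filter, mem_compl]
    constructor
    · rintro ⟨h1, rfl⟩
      exact ⟨mem_insert_self _ _, (erase_insert h1).symm⟩
    · rintro ⟨h1, rfl⟩
      exact ⟨notMem_erase _ _, insert_erase h1⟩
  · rw [mem_filter] at hv
    rw [hv.2]

end Operators

section Support

variable (K : Type*) [Field K] {α : Type*}

/-- The functions supported in `Γ`. -/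
def supp (Γ : Set α) : Submodule K (α → K) where
  carrier := {x | ∀ a, a ∉ Γ → x a = 0}
  add_mem' hx hy a ha := by simp [hx a ha, hy a ha]
  zero_mem' _ _ := rfl
  smul_mem' c x hx a ha := by simp [hx a ha]

variable {K}

lemma supp_mono {Γ Γ' : Set α} (h : Γ ⊆ Γ') : supp K Γ ≤ supp K Γ' :=
  fun _ hx a ha => hx a fun h' => ha (h h')

lemma single_mem_supp [DecidableEq α] {Γ : Set α} {a : α} (h : a ∈ Γ) (c : K) :
    Pi.single a c ∈ supp K Γ := by
  intro b hb
  rw [Pi.single_eq_of_ne]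
  rintro rfl; exact hb h

/-- The differential module of functions supported in `Γ` has no homology. -/
def Acyclic (D : (α → K) →ₗ[K] (α → K)) (Γ : Set α) : Prop :=
  ∀ x ∈ supp K Γ, D x = 0 → ∃ y ∈ supp K Γ, D y = x

lemma acyclic_empty (D : (α → K) →ₗ[K] (α → K)) : Acyclic D ∅ := fun x hx _ =>
  ⟨0, zero_mem _, by ext a; simp [hx a]⟩

variable {V : Type*} [LinearOrder V] [Fintype V]

lemma cone_mem_supp {Γ Γ' : Set (Finset V)} {v : V} (h : ∀ σ ∈ Γ, insert v σ ∈ Γ')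
    {x : Finset V → K} (hx : x ∈ supp K Γ) : cone K v x ∈ supp K Γ' := fun τ hτ => by
  rw [cone_apply]
  split_ifs with hv
  · rw [hx _ fun h' => hτ (by simpa [insert_erase hv] using h _ h'), mul_zero]
  · rfl

lemma acyclic_of_cone {Γ : Set (Finset V)} (v : V) (h : ∀ σ ∈ Γ, insert v σ ∈ Γ) :
    Acyclic (bd K) Γ := fun x hx h0 =>
  ⟨cone K v x, cone_mem_supp h hx, by rw [bd_cone, h0, map_zero, sub_zero]⟩

end Support

section Pairs

variable (K : Type*) [Field K] {U V : Type*} [LinearOrder U] [Fintype U]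
  [LinearOrder V] [Fintype V]

/-- The total boundary operator of the tensor product of the two full simplicial complexes. -/
def bdPair : (Finset U × Finset V → K) →ₗ[K] (Finset U × Finset V → K) where
  toFun x p := bd K (fun ρ => x (ρ, p.2)) p.1 + (-1) ^ #p.1 * bd K (fun τ => x (p.1, τ)) p.2
  map_add' x y := by
    ext p
    have h1 := congrFun (map_add (bd K) (fun ρ => x (ρ, p.2)) fun ρ => y (ρ, p.2)) p.1
    have h2 := congrFun (map_add (bd K) (fun τ => x (p.1, τ)) fun τ => y (p.1, τ)) p.2
    exact (congrArg₂ (fun a b => a + (-1) ^ #p.1 * b) h1 h2).trans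
      (by simp only [Pi.add_apply]; ring)
  map_smul' c x := by
    ext p
    have h1 := congrFun (map_smul (bd K) c fun ρ => x (ρ, p.2)) p.1
    have h2 := congrFun (map_smul (bd K) c fun τ => x (p.1, τ)) p.2
    exact (congrArg₂ (fun a b => a + (-1) ^ #p.1 * b) h1 h2).trans
      (by simp only [Pi.smul_apply, smul_eq_mul, RingHom.id_apply]; ring)

lemma bdPair_apply (x : Finset U × Finset V → K) (ρ : Finset U) (τ : Finset V) :
    bdPair K x (ρ, τ) =
      bd K (fun ρ' => x (ρ', τ)) ρ + (-1) ^ #ρ * bd K (fun τ' => x (ρ, τ')) τ := rfl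

lemma bdPair_bdPair (x : Finset U × Finset V → K) : bdPair K (bdPair K x) = 0 := by
  ext ⟨ρ, τ⟩
  rw [bdPair_apply]
  have h1 : (fun ρ' => bdPair K x (ρ', τ)) = bd K (fun ρ' => x (ρ', τ)) +
      fun ρ' => (-1) ^ #ρ' * bd K (fun τ' => x (ρ', τ')) τ := rfl
  have h2 : (fun τ' => bdPair K x (ρ, τ')) = (fun τ' => bd K (fun ρ' => x (ρ', τ')) ρ) +
      ((-1 : K) ^ #ρ) • bd K (fun τ' => x (ρ, τ')) := rfl
  rw [h1, h2, map_add, map_add, map_smul, bd_bd, bd_bd, zero_add, smul_zero, add_zero]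
  simp only [bd_apply, mul_sum]
  rw [sum_comm, ← sum_add_distrib]
  refine sum_eq_zero fun v _ => ?_
  rw [← sum_add_distrib]
  refine sum_eq_zero fun u hu => ?_
  rw [card_insert_of_notMem (by simpa using hu), pow_succ]
  ring

/-- Exchange of the two tensor factors, with the Koszul sign. -/
def swapPair : (Finset U × Finset V → K) →ₗ[K] (Finset V × Finset U → K) where
  toFun x p := (-1) ^ (#p.1 * #p.2) * x p.swap
  map_add' x y := by ext p; simp [mul_add]
  map_smul' c x := by ext p; simp [mul_left_comm]

lemma swapPair_apply (x : Finset U × Finset V → K) (τ : Finset V) (ρ : Finset U) :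
    swapPair K x (τ, ρ) = (-1) ^ (#τ * #ρ) * x (ρ, τ) := rfl

lemma swapPair_swapPair (x : Finset U × Finset V → K) : swapPair K (swapPair K x) = x := by
  ext ⟨ρ, τ⟩
  rw [swapPair_apply, swapPair_apply, ← mul_assoc, mul_comm #τ, ← mul_pow]
  simp

lemma bdPair_swapPair (x : Finset U × Finset V → K) :
    bdPair K (swapPair K x) = swapPair K (bdPair K x) := by
  ext ⟨τ, ρ⟩
  rw [swapPair_apply, bdPair_apply, bdPair_apply]
  simp only [bd_apply, mul_sum, mul_add, swapPair_apply]
  rw [add_comm]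
  congr 1
  · refine sum_congr rfl fun u hu => ?_
    rw [card_insert_of_notMem (by simpa using hu), Nat.mul_succ, pow_add]
    have : (-1 : K) ^ #τ * (-1) ^ #τ = 1 := by rw [← mul_pow]; simp
    linear_combination (sgn K ρ u * (-1) ^ (#τ * #ρ) * x (insert u ρ, τ)) * this
  · refine sum_congr rfl fun u hu => ?_
    rw [card_insert_of_notMem (by simpa using hu), Nat.succ_mul, pow_add]
    ring

variable {K}

lemma swapPair_mem_supp {F : Set (Finset U × Finset V)} {x : Finset U × Finset V → K}
    (hx : x ∈ supp K F) : swapPair K x ∈ supp K (Prod.swap ⁻¹' F) := by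
  rintro ⟨τ, ρ⟩ h
  rw [swapPair_apply, hx (ρ, τ) h, mul_zero]

lemma acyclic_swap {F : Set (Finset U × Finset V)}
    (h : Acyclic (bdPair K) (Prod.swap ⁻¹' F)) : Acyclic (bdPair K) F := by
  intro x hx h0
  obtain ⟨y, hy, hyx⟩ := h (swapPair K x) (swapPair_mem_supp hx)
    (by rw [bdPair_swapPair, h0, map_zero])
  exact ⟨swapPair K y, swapPair_mem_supp hy, by rw [bdPair_swapPair, hyx, swapPair_swapPair]⟩

lemma bdPair_mem_supp {F : Set (Finset U × Finset V)} (hF : IsLowerSet F)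
    {x : Finset U × Finset V → K} (hx : x ∈ supp K F) : bdPair K x ∈ supp K F := by
  rintro ⟨ρ, τ⟩ h
  have h1 : ∀ v ∈ ρᶜ, sgn K ρ v * x (insert v ρ, τ) = 0 := fun v _ => by
    rw [hx (insert v ρ, τ) fun h' =>
      h (hF (show (ρ, τ) ≤ (insert v ρ, τ) from ⟨subset_insert _ _, le_rfl⟩) h'), mul_zero]
  have h2 : ∀ v ∈ τᶜ, sgn K τ v * x (ρ, insert v τ) = 0 := fun v _ => by
    rw [hx (ρ, insert v τ) fun h' =>
      h (hF (show (ρ, τ) ≤ (ρ, insert v τ) from ⟨le_rfl, subset_insert _ _⟩) h'), mul_zero]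
  rw [bdPair_apply, bd_apply, bd_apply, sum_eq_zero h1, sum_eq_zero h2, mul_zero, add_zero]

/-- If every fibre of the pair `F ⊆ F'` over the first factor is either trivial or an acyclic
complex relative to nothing, then the pair is acyclic. -/
lemma exists_sub_bdPair_mem {F F' : Set (Finset U × Finset V)} (hF : IsLowerSet F)
    (hF' : IsLowerSet F')
    (hfib : ∀ ρ, (∀ τ, (ρ, τ) ∈ F' → (ρ, τ) ∈ F) ∨
      ((∀ τ, (ρ, τ) ∉ F) ∧ Acyclic (bd K) {τ | (ρ, τ) ∈ F'}))
    {x : Finset U × Finset V → K} (hx : x ∈ supp K F') (hDx : bdPair K x ∈ supp K F) :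
    ∃ y ∈ supp K F', x - bdPair K y ∈ supp K F := by
  suffices h : ∀ (p : ℕ) (x : Finset U × Finset V → K), x ∈ supp K F' → bdPair K x ∈ supp K F →
      (∀ ρ τ, p ≤ #ρ → (ρ, τ) ∉ F → x (ρ, τ) = 0) →
      ∃ y ∈ supp K F', x - bdPair K y ∈ supp K F from
    h (Fintype.card U + 1) x hx hDx fun ρ τ h => absurd (card_le_univ ρ) (by omega)
  intro p
  induction p with
  | zero => exact fun x _ _ h => ⟨0, zero_mem _, by
      rw [map_zero, sub_zero]; exact fun ⟨ρ, τ⟩ hp => h ρ τ (Nat.zero_le _) hp⟩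
  | succ p ih =>
    intro x hx hDx hp
    have key : ∀ ρ : Finset U, #ρ = p → ∃ w ∈ supp K {τ | (ρ, τ) ∈ F'},
        ∀ τ, (ρ, τ) ∉ F → x (ρ, τ) = bd K w τ := by
      intro ρ hρ
      rcases hfib ρ with h | ⟨h1, h2⟩
      · refine ⟨0, zero_mem _, fun τ hτ => ?_⟩
        rw [map_zero, hx _ fun h' => hτ (h τ h')]; rfl
      · obtain ⟨w, hw, hwx⟩ := h2 (fun τ => x (ρ, τ)) (fun τ hτ => hx _ hτ) (by
          ext τ
          have h3 := hDx (ρ, τ) (h1 τ)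
          rw [bdPair_apply, bd_apply, sum_eq_zero, zero_add] at h3
          · exact (mul_eq_zero.mp h3).resolve_left (by simp)
          · intro u hu
            rw [hp (insert u ρ) τ (by rw [card_insert_of_notMem (by simpa using hu), hρ])
              fun h' => h1 τ
                (hF (show (ρ, τ) ≤ (insert u ρ, τ) from ⟨subset_insert _ _, le_rfl⟩) h'), mul_zero])
        exact ⟨w, hw, fun τ _ => by rw [hwx]⟩
    choose! w hw hwx using key
    set y : Finset U × Finset V → K := fun q => if #q.1 = p then (-1) ^ p * w q.1 q.2 else 0
      with hy
    have hyF : y ∈ supp K F' := by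
      rintro ⟨ρ, τ⟩ h
      simp only [hy]
      split_ifs with hc
      · rw [hw ρ hc τ h, mul_zero]
      · rfl
    obtain ⟨y', hy', hxy'⟩ := ih (x - bdPair K y) (sub_mem hx (bdPair_mem_supp hF' hyF))
      (by rw [map_sub, bdPair_bdPair, sub_zero]; exact hDx) (by
        intro ρ τ hρ hτ
        rw [Pi.sub_apply, bdPair_apply, bd_apply, sum_eq_zero, zero_add]
        · rcases hρ.eq_or_lt with h | h
          · have h4 : (fun τ' => y (ρ, τ')) = (-1 : K) ^ p • w ρ := by
              ext τ'; simp [hy, h]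
            rw [h4, map_smul, Pi.smul_apply, smul_eq_mul, ← mul_assoc, ← h, ← mul_pow,
              hwx ρ h.symm τ hτ]
            simp
          · have h4 : (fun τ' => y (ρ, τ')) = 0 := by
              ext τ'; simp [hy, h.ne']
            rw [h4, map_zero, hp ρ τ h hτ]; simp
        · intro u hu
          have : #(insert u ρ) ≠ p := by
            rw [card_insert_of_notMem (by simpa using hu)]; omega
          simp [hy, this])
    exact ⟨y + y', add_mem hyF hy', by rw [map_add, ← sub_sub]; exact hxy'⟩

/-- A complex all of whose fibres over the first factor are acyclic is acyclic. -/
lemma acyclic_of_fibres {F : Set (Finset U × Finset V)} (hF : IsLowerSet F)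
    (hfib : ∀ ρ, Acyclic (bd K) {τ | (ρ, τ) ∈ F}) : Acyclic (bdPair K) F := by
  intro x hx h0
  obtain ⟨y, hy, hxy⟩ := exists_sub_bdPair_mem (F := ∅) (isLowerSet_empty) hF
    (fun ρ => Or.inr ⟨fun _ => id, hfib ρ⟩) hx (by rw [h0]; exact zero_mem _)
  exact ⟨y, hy, by ext a; exact (sub_eq_zero.mp (hxy a id)).symm⟩

end Pairs

section Graded

variable {K : Type*} [Field K] {α β : Type*}

/-- The homogeneous functions of degree `j`. -/
def homog (K : Type*) [Field K] (deg : α → ℤ) (j : ℤ) : Submodule K (α → K) :=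
  supp K {a | deg a = j}

open Classical in
/-- The projection to the homogeneous functions of degree `j`. -/
noncomputable def degPart (K : Type*) [Field K] (deg : α → ℤ) (j : ℤ) :
    (α → K) →ₗ[K] (α → K) where
  toFun x a := if deg a = j then x a else 0
  map_add' x y := by ext a; by_cases h : deg a = j <;> simp [h]
  map_smul' c x := by ext a; by_cases h : deg a = j <;> simp [h]

lemma degPart_apply (deg : α → ℤ) (j : ℤ) (x : α → K) (a : α) [Decidable (deg a = j)] :
    degPart K deg j x a = if deg a = j then x a else 0 := by
  simp [degPart]

lemma degPart_mem_homog (deg : α → ℤ) (j : ℤ) (x : α → K) :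
    degPart K deg j x ∈ homog K deg j := fun a ha => by
  classical
  rw [degPart_apply, if_neg (show ¬ deg a = j from ha)]

lemma degPart_eq {deg : α → ℤ} {j : ℤ} {x : α → K} (hx : x ∈ homog K deg j) :
    degPart K deg j x = x := by
  classical
  ext a
  rw [degPart_apply]
  split_ifs with h
  · rfl
  · exact (hx a h).symm

lemma degPart_mem_supp {deg : α → ℤ} {j : ℤ} {x : α → K} {Γ : Set α} (hx : x ∈ supp K Γ) :
    degPart K deg j x ∈ supp K Γ := fun a ha => by
  classical
  rw [degPart_apply, hx a ha, ite_self]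

/-- The cycles supported in `Γ`. -/
def cyc (D : (α → K) →ₗ[K] (α → K)) (Γ : Set α) : Submodule K (α → K) :=
  supp K Γ ⊓ LinearMap.ker D

/-- The boundaries of chains supported in `Γ`. -/
def bdry (D : (α → K) →ₗ[K] (α → K)) (Γ : Set α) : Submodule K (α → K) :=
  (supp K Γ).map D

/-- The quotient of `Z` by `B` in degree `j`. -/
abbrev GrQuot (deg : α → ℤ) (Z B : Submodule K (α → K)) (j : ℤ) : Type _ :=
  ↥(Z ⊓ homog K deg j) ⧸ B.comap (Z ⊓ homog K deg j).subtype

/-- A linear map identifying `Z` modulo `B` with `Z'` modulo `B'` induces an equivalence of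
quotients. -/
lemma nonempty_quotEquiv {M N : Type*} [AddCommGroup M] [Module K M] [AddCommGroup N]
    [Module K N] (f : M →ₗ[K] N) {Z B : Submodule K M} {Z' B' : Submodule K N}
    (h1 : ∀ x ∈ Z, f x ∈ Z') (h2 : ∀ x ∈ Z, f x ∈ B' ↔ x ∈ B)
    (h3 : ∀ y ∈ Z', ∃ x ∈ Z, y - f x ∈ B') :
    Nonempty ((↥Z ⧸ B.comap Z.subtype) ≃ₗ[K] (↥Z' ⧸ B'.comap Z'.subtype)) := by
  set g : ↥Z →ₗ[K] (↥Z' ⧸ B'.comap Z'.subtype) :=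
    (B'.comap Z'.subtype).mkQ ∘ₗ (f.restrict h1) with hg
  have hker : LinearMap.ker g = B.comap Z.subtype := by
    ext x
    simp only [hg, LinearMap.mem_ker, LinearMap.comp_apply, Submodule.mkQ_apply,
      Submodule.Quotient.mk_eq_zero, Submodule.mem_comap, Submodule.subtype_apply]
    exact h2 x x.2
  have hsurj : Function.Surjective g := by
    intro q
    obtain ⟨y, rfl⟩ := Submodule.mkQ_surjective _ q
    obtain ⟨x, hx, hxy⟩ := h3 y y.2
    refine ⟨⟨x, hx⟩, ?_⟩
    simp only [hg, LinearMap.comp_apply, Submodule.mkQ_apply]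
    rw [eq_comm, Submodule.Quotient.eq]
    exact hxy
  exact ⟨(Submodule.quotEquivOfEq _ _ hker.symm).trans (g.quotKerEquivOfSurjective hsurj)⟩

/-- The graded version of `nonempty_quotEquiv`. -/
lemma nonempty_grQuotEquiv {deg : α → ℤ} {deg' : β → ℤ} (f : (α → K) →ₗ[K] (β → K)) (s : ℤ)
    (hf : ∀ j x, f (degPart K deg j x) = degPart K deg' (j + s) (f x))
    {Z B : Submodule K (α → K)} {Z' B' : Submodule K (β → K)}
    (hZ : ∀ j, ∀ x ∈ Z, degPart K deg j x ∈ Z) (hB' : ∀ j, ∀ x ∈ B', degPart K deg' j x ∈ B')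
    (h1 : ∀ x ∈ Z, f x ∈ Z') (h2 : ∀ x ∈ Z, f x ∈ B' ↔ x ∈ B)
    (h3 : ∀ y ∈ Z', ∃ x ∈ Z, y - f x ∈ B') (j k : ℤ) (hk : k = j + s) :
    Nonempty (GrQuot deg Z B j ≃ₗ[K] GrQuot deg' Z' B' k) := by
  subst hk
  refine nonempty_quotEquiv f ?_ (fun x hx => h2 x hx.1) ?_
  · intro x hx
    refine ⟨h1 x hx.1, ?_⟩
    rw [← degPart_eq hx.2, hf]
    exact degPart_mem_homog _ _ _
  · intro y hy
    obtain ⟨x, hx, hxy⟩ := h3 y hy.1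
    refine ⟨degPart K deg j x, ⟨hZ j x hx, degPart_mem_homog _ _ _⟩, ?_⟩
    rw [hf, ← degPart_eq hy.2, ← map_sub]
    exact hB' _ _ hxy

lemma degPart_mem_cyc {deg : α → ℤ} {D : (α → K) →ₗ[K] (α → K)}
    (hD : ∀ j x, D (degPart K deg j x) = degPart K deg (j + -1) (D x)) (Γ : Set α) (j : ℤ)
    (x : α → K) (hx : x ∈ cyc D Γ) : degPart K deg j x ∈ cyc D Γ := by
  refine ⟨degPart_mem_supp hx.1, ?_⟩
  have h : D x = 0 := hx.2
  change D _ = 0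
  rw [hD, h, map_zero]

lemma degPart_mem_bdry {deg : α → ℤ} {D : (α → K) →ₗ[K] (α → K)}
    (hD : ∀ j x, D (degPart K deg j x) = degPart K deg (j + -1) (D x)) (Γ : Set α) (j : ℤ)
    (x : α → K) (hx : x ∈ bdry D Γ) : degPart K deg j x ∈ bdry D Γ := by
  obtain ⟨y, hy, rfl⟩ := hx
  exact ⟨degPart K deg (j + 1) y, degPart_mem_supp hy, by rw [hD]; congr 2; ring⟩

/-- The degree of a finset of vertices is its cardinality. -/
def cardDeg {V : Type*} (σ : Finset V) : ℤ := #σ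

/-- The total degree of a pair of finsets. -/
def pairDeg {U V : Type*} (p : Finset U × Finset V) : ℤ := #p.1 + #p.2

variable {U V : Type*} [LinearOrder U] [Fintype U] [LinearOrder V] [Fintype V]

lemma bd_degPart (j : ℤ) (x : Finset V → K) :
    bd K (degPart K cardDeg j x) = degPart K cardDeg (j + -1) (bd K x) := by
  classical
  ext τ
  rw [degPart_apply, bd_apply, bd_apply]
  have : ∀ v ∈ τᶜ, degPart K cardDeg j x (insert v τ) =
      if cardDeg τ = j + -1 then x (insert v τ) else 0 := fun v hv => by
    rw [degPart_apply]
    congr 1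
    rw [cardDeg, cardDeg, card_insert_of_notMem (by simpa using hv)]
    apply propext; push_cast; constructor <;> intro <;> omega
  rw [sum_congr rfl fun v hv => by rw [this v hv]]
  split_ifs <;> simp

lemma bdPair_degPart (j : ℤ) (x : Finset U × Finset V → K) :
    bdPair K (degPart K pairDeg j x) = degPart K pairDeg (j + -1) (bdPair K x) := by
  classical
  ext ⟨ρ, τ⟩
  rw [degPart_apply, bdPair_apply, bdPair_apply, bd_apply, bd_apply, bd_apply, bd_apply]
  have h1 : ∀ v ∈ ρᶜ, degPart K pairDeg j x (insert v ρ, τ) =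
      if pairDeg (ρ, τ) = j + -1 then x (insert v ρ, τ) else 0 := fun v hv => by
    rw [degPart_apply]
    congr 1
    simp only [pairDeg]
    rw [card_insert_of_notMem (by simpa using hv)]
    apply propext; push_cast; constructor <;> intro <;> omega
  have h2 : ∀ v ∈ τᶜ, degPart K pairDeg j x (ρ, insert v τ) =
      if pairDeg (ρ, τ) = j + -1 then x (ρ, insert v τ) else 0 := fun v hv => by
    rw [degPart_apply]
    congr 1
    simp only [pairDeg]
    rw [card_insert_of_notMem (by simpa using hv)]
    apply propext; push_cast; constructor <;> intro <;> omega
  have e1 : ∑ v ∈ ρᶜ, sgn K ρ v * degPart K pairDeg j x (insert v ρ, τ) = ∑ v ∈ ρᶜ, sgn K ρ v *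
      if pairDeg (ρ, τ) = j + -1 then x (insert v ρ, τ) else 0 :=
    sum_congr rfl fun v hv => by rw [h1 v hv]
  have e2 : ∑ v ∈ τᶜ, sgn K τ v * degPart K pairDeg j x (ρ, insert v τ) = ∑ v ∈ τᶜ, sgn K τ v *
      if pairDeg (ρ, τ) = j + -1 then x (ρ, insert v τ) else 0 :=
    sum_congr rfl fun v hv => by rw [h2 v hv]
  rw [e1, e2]
  split_ifs <;> simp

end Graded

section QuasiIso

variable {K : Type*} [Field K] {U V : Type*} [LinearOrder U] [Fintype U] [LinearOrder V]
  [Fintype V]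

/-- Homology in degree `j` of the functions supported in a set of finsets. -/
abbrev Hom (K : Type*) [Field K] (Γ : Set (Finset V)) (j : ℤ) : Type _ :=
  GrQuot cardDeg (cyc (bd K) Γ) (bdry (bd K) Γ) j

/-- Homology in degree `j` of the functions supported in a set of pairs of finsets. -/
abbrev HomPair (K : Type*) [Field K] (F : Set (Finset U × Finset V)) (j : ℤ) : Type _ :=
  GrQuot pairDeg (cyc (bdPair K) F) (bdry (bdPair K) F) j

open Classical in
/-- The restriction of a function to a set, extended by zero. -/
noncomputable def resOn {α : Type*} (K : Type*) [Field K] (Γ : Set α) :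
    (α → K) →ₗ[K] (α → K) where
  toFun x a := if a ∈ Γ then x a else 0
  map_add' x y := by ext a; by_cases h : a ∈ Γ <;> simp [h]
  map_smul' c x := by ext a; by_cases h : a ∈ Γ <;> simp [h]

lemma resOn_of_mem {α : Type*} {Γ : Set α} {a : α} (h : a ∈ Γ) (x : α → K) :
    resOn K Γ x a = x a := by simp [resOn, h]

lemma resOn_of_notMem {α : Type*} {Γ : Set α} {a : α} (h : a ∉ Γ) (x : α → K) :
    resOn K Γ x a = 0 := by simp [resOn, h]

lemma resOn_mem_supp {α : Type*} (Γ : Set α) (x : α → K) : resOn K Γ x ∈ supp K Γ :=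
  fun _ ha => resOn_of_notMem ha x

/-- The product of a chain in the first factor with a basis element of the second factor. -/
def tensorSingle (K : Type*) [Field K] (U : Type*) {V : Type*} [LinearOrder V]
    (σ : Finset V) : (Finset U → K) →ₗ[K] (Finset U × Finset V → K) where
  toFun w p := if p.2 = σ then w p.1 else 0
  map_add' x y := by ext p; by_cases h : p.2 = σ <;> simp [h]
  map_smul' c x := by ext p; by_cases h : p.2 = σ <;> simp [h]

lemma tensorSingle_apply (σ : Finset V) (w : Finset U → K) (ρ : Finset U) (τ : Finset V) :
    tensorSingle K U σ w (ρ, τ) = if τ = σ then w ρ else 0 := rfl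

lemma bdPair_tensorSingle_empty (w : Finset U → K) :
    bdPair K (tensorSingle K U (∅ : Finset V) w) = tensorSingle K U ∅ (bd K w) := by
  ext ⟨ρ, τ⟩
  rw [bdPair_apply, bd_apply, bd_apply, tensorSingle_apply, bd_apply]
  have h2 : ∑ v ∈ τᶜ, sgn K τ v * tensorSingle K U (∅ : Finset V) w (ρ, insert v τ) = 0 :=
    sum_eq_zero fun v _ => by rw [tensorSingle_apply, if_neg (by simp), mul_zero]
  rw [h2, mul_zero, add_zero]
  split_ifs with h
  · exact sum_congr rfl fun v _ => by rw [tensorSingle_apply, if_pos h]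
  · exact sum_eq_zero fun v _ => by rw [tensorSingle_apply, if_neg h, mul_zero]

/-- The linear map evaluating a chain at a fixed basis element of the second factor. -/
def evalSnd (K : Type*) [Field K] (U : Type*) {V : Type*} (σ : Finset V) :
    (Finset U × Finset V → K) →ₗ[K] (Finset U → K) where
  toFun x ρ := x (ρ, σ)
  map_add' _ _ := rfl
  map_smul' _ _ := rfl

lemma evalSnd_apply (σ : Finset V) (x : Finset U × Finset V → K) (ρ : Finset U) :
    evalSnd K U σ x ρ = x (ρ, σ) := rfl

lemma evalSnd_degPart (σ : Finset V) (j : ℤ) (x : Finset U × Finset V → K) :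
    evalSnd K U σ (degPart K pairDeg j x) = degPart K cardDeg (j + -#σ) (evalSnd K U σ x) := by
  classical
  ext ρ
  rw [degPart_apply, evalSnd_apply, evalSnd_apply, degPart_apply]
  congr 1
  simp only [pairDeg, cardDeg]
  apply propext; constructor <;> intro <;> omega

lemma resOn_degPart {α : Type*} {deg : α → ℤ} (Γ : Set α) (j : ℤ) (x : α → K) :
    resOn K Γ (degPart K deg j x) = degPart K deg j (resOn K Γ x) := by
  classical
  ext a
  rw [degPart_apply]
  by_cases h : a ∈ Γ
  · rw [resOn_of_mem h, resOn_of_mem h, degPart_apply]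
  · rw [resOn_of_notMem h, resOn_of_notMem h, ite_self]

lemma bd_resOn_compl {Λ : Set (Finset U)} (hΛ : IsLowerSet Λ) (c : Finset U → K) {L : Finset U}
    (hL : L ∉ Λ) : bd K (resOn K Λᶜ c) L = bd K c L := by
  rw [bd_apply, bd_apply]
  refine sum_congr rfl fun v _ => ?_
  rw [resOn_of_mem (show insert v L ∈ Λᶜ from fun h => hL (hΛ (subset_insert v L) h))]

lemma resOn_add_compl {α : Type*} (Γ : Set α) (x : α → K) :
    resOn K Γᶜ x = x - resOn K Γ x := by
  ext a
  by_cases h : a ∈ Γ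
  · rw [Pi.sub_apply, resOn_of_mem h, resOn_of_notMem (show a ∉ Γᶜ from fun hc => hc h), sub_self]
  · rw [Pi.sub_apply, resOn_of_notMem h, resOn_of_mem (show a ∈ Γᶜ from h), sub_zero]

/-- One half of Dowker duality: a complex `F` of pairs which over the complement of `Λ` only
consists of pairs with trivial second entry, and whose part over `Λ` is acyclic, computes the
homology of `Λ`. -/
lemma nonempty_homPair_equiv_hom {F : Set (Finset U × Finset V)} {Λ : Set (Finset U)}
    (hΛ : IsLowerSet Λ) (hempty : ∀ L ρ, (L, ρ) ∈ F → L ∉ Λ → ρ = ∅)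
    (hsub : ∀ L ∈ Λ, (L, ∅) ∈ F)
    (hS : Acyclic (bd K) {L | (L, (∅ : Finset V)) ∈ F})
    (hac : Acyclic (bdPair K) {p | p ∈ F ∧ p.1 ∈ Λ}) (j k : ℤ) (hk : j = k + 1) :
    Nonempty (HomPair K F j ≃ₗ[K] Hom K Λ k) := by
  set e : (Finset U × Finset V → K) →ₗ[K] (Finset U → K) :=
    resOn K Λᶜ ∘ₗ evalSnd K U (∅ : Finset V) with he
  have he_mem : ∀ x {L}, L ∉ Λ → e x L = x (L, ∅) := fun x L hL =>
    resOn_of_mem (show L ∈ Λᶜ from hL) _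
  have he_not : ∀ x {L}, L ∈ Λ → e x L = 0 := fun x L hL =>
    resOn_of_notMem (show L ∉ Λᶜ from fun h => h hL) _
  have hD : ∀ x ∈ supp K F, ∀ {L}, L ∉ Λ → bdPair K x (L, ∅) = bd K (e x) L := by
    intro x hx L hL
    have h1 : bd K (fun τ => x (L, τ)) ∅ = 0 := by
      rw [bd_apply]
      refine sum_eq_zero fun v _ => ?_
      rw [hx _ fun h => (insert_ne_empty v ∅) (hempty _ _ h hL), mul_zero]
    rw [bdPair_apply, h1, mul_zero, add_zero, he, LinearMap.comp_apply,
      bd_resOn_compl hΛ _ hL]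
    rfl
  have hTs : ∀ w ∈ supp K {L | (L, (∅ : Finset V)) ∈ F}, tensorSingle K U ∅ w ∈ supp K F := by
    rintro w hw ⟨L, ρ⟩ h
    rw [tensorSingle_apply]
    split_ifs with hρ
    · subst hρ; exact hw L h
    · rfl
  have hΛS : supp K Λ ≤ supp K {L | (L, (∅ : Finset V)) ∈ F} := supp_mono hsub
  have hF'F : supp K {p | p ∈ F ∧ p.1 ∈ Λ} ≤ supp K F := supp_mono fun p hp => hp.1
  have heT : ∀ w, e (tensorSingle K U ∅ w) = w - resOn K Λ w := fun w => by
    rw [he, LinearMap.comp_apply, ← resOn_add_compl]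
    congr 1
  refine nonempty_grQuotEquiv (bd K ∘ₗ e) (-1) ?_
    (fun j x hx => degPart_mem_cyc bdPair_degPart F j x hx)
    (fun j x hx => degPart_mem_bdry bd_degPart Λ j x hx) ?_ ?_ ?_ j k (by omega)
  · intro j x
    rw [he, LinearMap.comp_apply, LinearMap.comp_apply, LinearMap.comp_apply,
      LinearMap.comp_apply, evalSnd_degPart, resOn_degPart, bd_degPart]
    simp
  · intro x hx
    have h0 : bdPair K x = 0 := hx.2
    refine ⟨fun L hL => ?_, bd_bd K _⟩
    rw [LinearMap.comp_apply, ← hD x hx.1 hL, h0]; rfl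
  · intro x hx
    have h0 : bdPair K x = 0 := hx.2
    constructor
    · rintro ⟨u, hu, hux⟩
      have heS : e x ∈ supp K {L | (L, (∅ : Finset V)) ∈ F} := fun L hL => by
        rw [he_mem x fun h => hL (hsub L h)]
        exact hx.1 _ hL
      obtain ⟨w, hw, hwx⟩ := hS (e x - u) (sub_mem heS (hΛS hu)) (by
        rw [map_sub, hux]; exact sub_self _)
      obtain ⟨y, hy, hyx⟩ := hac (x - bdPair K (tensorSingle K U ∅ w)) (by
        rintro ⟨L, ρ⟩ h
        rw [Pi.sub_apply, bdPair_tensorSingle_empty, tensorSingle_apply, hwx]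
        by_cases hL : L ∈ Λ
        · have hLF : (L, ρ) ∉ F := fun h' => h ⟨h', hL⟩
          have hρ : ρ ≠ ∅ := by rintro rfl; exact hLF (hsub L hL)
          rw [if_neg hρ, hx.1 _ hLF, sub_self]
        · split_ifs with hρ
          · subst hρ
            rw [Pi.sub_apply, he_mem x hL, hu L hL, sub_zero, sub_self]
          · rw [hx.1 _ fun h' => hρ (hempty _ _ h' hL), sub_self]) (by
        rw [map_sub, h0, bdPair_bdPair, sub_self])
      exact ⟨y + tensorSingle K U ∅ w, add_mem (hF'F hy) (hTs w hw), by
        rw [map_add, hyx, sub_add_cancel]⟩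
    · rintro ⟨y, hy, rfl⟩
      have h1 : e (bdPair K y) = bd K (e y) - resOn K Λ (bd K (e y)) := by
        rw [← resOn_add_compl]
        ext L
        by_cases hL : L ∈ Λ
        · rw [he_not _ hL, resOn_of_notMem (show L ∉ Λᶜ from fun h => h hL)]
        · rw [he_mem _ hL, resOn_of_mem (show L ∈ Λᶜ from hL), hD y hy hL]
      refine ⟨-resOn K Λ (bd K (e y)), neg_mem (resOn_mem_supp _ _), ?_⟩
      change _ = bd K (e (bdPair K y))
      rw [h1, map_sub, bd_bd, zero_sub, map_neg]
  · intro u hu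
    have h0 : bd K u = 0 := hu.2
    obtain ⟨w, hw, hwu⟩ := hS u (hΛS hu.1) h0
    obtain ⟨v, hv, hvu⟩ := hac (tensorSingle K U ∅ u) (by
      rintro ⟨L, ρ⟩ h
      rw [tensorSingle_apply]
      split_ifs with hρ
      · subst hρ
        exact hu.1 L fun hL => h ⟨hsub L hL, hL⟩
      · rfl) (by rw [bdPair_tensorSingle_empty, h0, map_zero])
    refine ⟨tensorSingle K U ∅ w - v, ⟨sub_mem (hTs w hw) (hF'F hv), ?_⟩, ?_⟩
    · change bdPair K _ = 0
      rw [map_sub, bdPair_tensorSingle_empty, hwu, hvu, sub_self]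
    · have hev : e v = 0 := by
        ext L
        by_cases hL : L ∈ Λ
        · exact he_not v hL
        · rw [he_mem v hL, hv _ fun h => hL h.2]; rfl
      refine ⟨resOn K Λ w, resOn_mem_supp _ _, ?_⟩
      rw [LinearMap.comp_apply, map_sub, hev, sub_zero, heT, map_sub, hwu, sub_sub_cancel]

lemma swapPair_degPart (j : ℤ) (x : Finset U × Finset V → K) :
    swapPair K (degPart K pairDeg j x) = degPart K pairDeg j (swapPair K x) := by
  classical
  ext ⟨τ, ρ⟩
  rw [degPart_apply, swapPair_apply, swapPair_apply, degPart_apply]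
  have : pairDeg (ρ, τ) = j ↔ pairDeg (τ, ρ) = j := by
    simp only [pairDeg]; rw [add_comm]
  simp only [this]
  split_ifs <;> simp

lemma nonempty_homPair_swap (F : Set (Finset U × Finset V)) (j : ℤ) :
    Nonempty (HomPair K F j ≃ₗ[K] HomPair K (Prod.swap ⁻¹' F) j) := by
  have hback : ∀ y ∈ supp K (Prod.swap ⁻¹' F), swapPair K y ∈ supp K F := fun y hy =>
    swapPair_mem_supp hy
  have hcomm : ∀ x : Finset U × Finset V → K,
    bdPair K (swapPair K x) = swapPair K (bdPair K x) := bdPair_swapPair K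
  have hcomm' : ∀ x : Finset V × Finset U → K,
    bdPair K (swapPair K x) = swapPair K (bdPair K x) := bdPair_swapPair K
  refine nonempty_grQuotEquiv (swapPair K) 0 (fun j x => by rw [add_zero, swapPair_degPart])
    (fun j x hx => degPart_mem_cyc bdPair_degPart F j x hx)
    (fun j x hx => degPart_mem_bdry bdPair_degPart _ j x hx) ?_ ?_ ?_ j j (add_zero j).symm
  · intro x hx
    have h0 : bdPair K x = 0 := hx.2
    exact ⟨swapPair_mem_supp hx.1, show bdPair K _ = 0 by rw [hcomm, h0, map_zero]⟩
  · intro x hx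
    constructor
    · rintro ⟨y, hy, hyx⟩
      exact ⟨swapPair K y, hback y hy, by rw [hcomm', hyx, swapPair_swapPair]⟩
    · rintro ⟨y, hy, rfl⟩
      exact ⟨swapPair K y, swapPair_mem_supp hy, hcomm y⟩
  · intro y hy
    have h0 : bdPair K y = 0 := hy.2
    refine ⟨swapPair K y, ⟨hback y hy.1, show bdPair K _ = 0 by rw [hcomm', h0, map_zero]⟩, ?_⟩
    rw [swapPair_swapPair, sub_self]
    exact zero_mem _

/-- An inclusion of complexes of pairs which is fibrewise trivial or has acyclic cofibres induces
an isomorphism in homology. -/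
lemma nonempty_homPair_equiv_of_fibres {F F' : Set (Finset U × Finset V)} (hF : IsLowerSet F)
    (hF' : IsLowerSet F') (hFF' : F ⊆ F')
    (hfib : ∀ ρ, (∀ τ, (ρ, τ) ∈ F' → (ρ, τ) ∈ F) ∨
      ((∀ τ, (ρ, τ) ∉ F) ∧ Acyclic (bd K) {τ | (ρ, τ) ∈ F'})) (j : ℤ) :
    Nonempty (HomPair K F j ≃ₗ[K] HomPair K F' j) := by
  refine nonempty_grQuotEquiv LinearMap.id 0 (fun j x => by rw [add_zero]; rfl)
    (fun j x hx => degPart_mem_cyc bdPair_degPart F j x hx)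
    (fun j x hx => degPart_mem_bdry bdPair_degPart _ j x hx) ?_ ?_ ?_ j j (add_zero j).symm
  · exact fun x hx => ⟨supp_mono hFF' hx.1, hx.2⟩
  · intro x hx
    constructor
    · rintro ⟨y, hy, hyx⟩
      obtain ⟨z, -, hz'⟩ := exists_sub_bdPair_mem hF hF' hfib hy (by rw [hyx]; exact hx.1)
      exact ⟨_, hz', by rw [map_sub, bdPair_bdPair, sub_zero, hyx]; rfl⟩
    · rintro ⟨y, hy, hyx⟩
      exact ⟨y, supp_mono hFF' hy, hyx⟩
  · intro y hy
    have h0 : bdPair K y = 0 := hy.2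
    obtain ⟨z, hz, hz'⟩ := exists_sub_bdPair_mem hF hF' hfib hy.1 (by
      rw [h0]; exact zero_mem _)
    refine ⟨y - bdPair K z, ⟨hz', ?_⟩, z, hz, ?_⟩
    · change bdPair K _ = 0
      rw [map_sub, h0, bdPair_bdPair, sub_self]
    · rw [LinearMap.id_apply, sub_sub_cancel]

/-- The product of a complex `G` with a complex `P` that becomes acyclic after the removal of the
facet `σ` has the homology of `G`, up to a shift. -/
lemma nonempty_homPair_prod_equiv {G : Set (Finset U)} {P : Set (Finset V)} (hG : IsLowerSet G)
    (hP : IsLowerSet P) {σ : Finset V} (hσ : σ ∈ P) (hmax : ∀ τ ∈ P, σ ⊆ τ → τ = σ)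
    (hac : Acyclic (bd K) {τ | τ ∈ P ∧ ¬ σ ⊆ τ}) (j k : ℤ) (hk : j = k + #σ) :
    Nonempty (HomPair K {p : Finset U × Finset V | p.1 ∈ G ∧ p.2 ∈ P} j ≃ₗ[K] Hom K G k) := by
  set F := {p : Finset U × Finset V | p.1 ∈ G ∧ p.2 ∈ P} with hFdef
  set F₀ := {p : Finset U × Finset V | p.1 ∈ G ∧ p.2 ∈ P ∧ ¬ σ ⊆ p.2} with hF₀def
  have hF₀F : supp K F₀ ≤ supp K F := supp_mono fun p hp => ⟨hp.1, hp.2.1⟩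
  have hF₀ : Acyclic (bdPair K) F₀ := by
    refine acyclic_of_fibres
      (fun p q h hp => ⟨hG h.1 hp.1, hP h.2 hp.2.1, fun h' => hp.2.2 (h'.trans h.2)⟩) fun ρ => ?_
    by_cases hρ : ρ ∈ G
    · have : {τ | (ρ, τ) ∈ F₀} = {τ | τ ∈ P ∧ ¬ σ ⊆ τ} := by
        ext τ; exact and_iff_right hρ
      rw [this]; exact hac
    · have : {τ | (ρ, τ) ∈ F₀} = ∅ := by
        ext τ; exact iff_of_false (fun h => hρ h.1) id
      rw [this]; exact acyclic_empty _
  have hD : ∀ x ∈ supp K F, evalSnd K U σ (bdPair K x) = bd K (evalSnd K U σ x) := by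
    intro x hx
    ext ρ
    have h1 : bd K (fun τ => x (ρ, τ)) σ = 0 := by
      rw [bd_apply]
      refine sum_eq_zero fun v hv => ?_
      rw [hx _ fun h => ?_, mul_zero]
      have := hmax _ h.2 (subset_insert _ _)
      rw [mem_compl] at hv
      exact hv (this ▸ mem_insert_self v σ)
    rw [evalSnd_apply, bdPair_apply, h1, mul_zero, add_zero]
    rfl
  have hF₀mem : ∀ x ∈ supp K F, evalSnd K U σ x = 0 → x ∈ supp K F₀ := by
    rintro x hx h0 ⟨ρ, τ⟩ h
    by_cases hF : (ρ, τ) ∈ F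
    · have hτ : σ ⊆ τ := by
        by_contra h'
        exact h ⟨hF.1, hF.2, h'⟩
      rw [hmax τ hF.2 hτ]
      exact congrFun h0 ρ
    · exact hx _ hF
  have hFl : IsLowerSet F := fun p q h hp => ⟨hG h.1 hp.1, hP h.2 hp.2⟩
  have hT : ∀ u ∈ supp K G, tensorSingle K U σ u ∈ supp K F := by
    rintro u hu ⟨ρ, τ⟩ h
    rw [tensorSingle_apply]
    split_ifs with hτ
    · subst hτ
      exact hu ρ fun h' => h ⟨h', hσ⟩
    · rfl
  have hET : ∀ u : Finset U → K, evalSnd K U σ (tensorSingle K U σ u) = u := fun u => by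
    ext ρ; rw [evalSnd_apply, tensorSingle_apply, if_pos rfl]
  refine nonempty_grQuotEquiv (evalSnd K U σ) (-#σ) (fun j x => evalSnd_degPart σ j x)
    (fun j x hx => degPart_mem_cyc bdPair_degPart F j x hx)
    (fun j x hx => degPart_mem_bdry bd_degPart _ j x hx) ?_ ?_ ?_ j k (by omega)
  · intro x hx
    have h0 : bdPair K x = 0 := hx.2
    refine ⟨fun ρ hρ => hx.1 _ fun h => hρ h.1, ?_⟩
    change bd K _ = 0
    rw [← hD x hx.1, h0, map_zero]
  · intro x hx
    have h0 : bdPair K x = 0 := hx.2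
    constructor
    · rintro ⟨u, hu, hux⟩
      obtain ⟨y, hy, hyx⟩ := hF₀ (x - bdPair K (tensorSingle K U σ u))
        (hF₀mem _ (sub_mem hx.1 (bdPair_mem_supp hFl (hT u hu))) (by
          rw [map_sub, hD _ (hT u hu), hET, hux, sub_self]))
        (by rw [map_sub, h0, bdPair_bdPair, sub_self])
      exact ⟨y + tensorSingle K U σ u, add_mem (hF₀F hy) (hT u hu), by
        rw [map_add, hyx, sub_add_cancel]⟩
    · rintro ⟨y, hy, rfl⟩
      exact ⟨evalSnd K U σ y, fun ρ hρ => hy _ fun h => hρ h.1, (hD y hy).symm⟩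
  · intro u hu
    have h0 : bd K u = 0 := hu.2
    obtain ⟨v, hv, hvu⟩ := hF₀ (bdPair K (tensorSingle K U σ u))
      (hF₀mem _ (bdPair_mem_supp hFl (hT u hu.1)) (by rw [hD _ (hT u hu.1), hET, h0]))
      (bdPair_bdPair K _)
    refine ⟨tensorSingle K U σ u - v, ⟨sub_mem (hT u hu.1) (hF₀F hv), ?_⟩, ?_⟩
    · change bdPair K _ = 0
      rw [map_sub, hvu, sub_self]
    · have hv0 : evalSnd K U σ v = 0 := by
        ext ρ
        exact hv _ fun h => h.2.2 subset_rfl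
      rw [map_sub, hET, hv0, sub_zero, sub_self]
      exact zero_mem _

end QuasiIso

section Join

variable {K : Type*} [Field K] {V : Type*} [LinearOrder V] [Fintype V]

/-- The product of the boundary of the simplex `I` with a chain. -/
def joinBoundary (K : Type*) [Field K] {V : Type*} [LinearOrder V] [Fintype V] (I : Finset V) :
    (Finset V → K) →ₗ[K] (Finset V × Finset V → K) where
  toFun u p := bd K (Pi.single I 1) p.1 * u p.2
  map_add' x y := by ext p; simp [mul_add]
  map_smul' c x := by ext p; simp [mul_left_comm]

lemma joinBoundary_apply (I : Finset V) (u : Finset V → K) (ρ τ : Finset V) :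
    joinBoundary K I u (ρ, τ) = bd K (Pi.single I 1) ρ * u τ := rfl

/-- The product of the simplex `I` with a chain. -/
def joinSimplex (K : Type*) [Field K] {V : Type*} [LinearOrder V] (I : Finset V) :
    (Finset V → K) →ₗ[K] (Finset V × Finset V → K) where
  toFun u p := if p.1 = I then u p.2 else 0
  map_add' x y := by ext p; by_cases h : p.1 = I <;> simp [h]
  map_smul' c x := by ext p; by_cases h : p.1 = I <;> simp [h]

lemma joinSimplex_apply (I : Finset V) (u : Finset V → K) (ρ τ : Finset V) :
    joinSimplex K I u (ρ, τ) = if ρ = I then u τ else 0 := rfl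

lemma bd_single_eq_zero {I ρ : Finset V} (h : ¬ (ρ ⊆ I ∧ #ρ + 1 = #I)) :
    bd K (Pi.single I 1) ρ = 0 := by
  rw [bd_apply]
  refine sum_eq_zero fun v hv => ?_
  rw [Pi.single_eq_of_ne, mul_zero]
  rintro rfl
  exact h ⟨subset_insert _ _, (card_insert_of_notMem (by simpa using hv)).symm⟩

lemma bdPair_joinSimplex (I : Finset V) (u : Finset V → K) :
    bdPair K (joinSimplex K I u) =
      joinBoundary K I u + (-1 : K) ^ #I • joinSimplex K I (bd K u) := by
  ext ⟨ρ, τ⟩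
  rw [bdPair_apply, Pi.add_apply, Pi.smul_apply, joinBoundary_apply, joinSimplex_apply, bd_apply,
    bd_apply, bd_apply, sum_mul]
  congr 1
  · refine sum_congr rfl fun v _ => ?_
    rw [joinSimplex_apply, Pi.single_apply]
    split_ifs <;> simp
  · split_ifs with h
    · rw [h, smul_eq_mul, bd_apply]
      simp only [joinSimplex_apply, if_true]
    · rw [sum_eq_zero fun v _ => by rw [joinSimplex_apply, if_neg h, mul_zero]]
      simp

/-- The complex of those pairs of a face of the simplex `I` and a face of `P` that do not
cover `I`. -/
def notCover (P : Set (Finset V)) (I : Finset V) : Set (Finset V × Finset V) :=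
  {p | p.1 ⊆ I ∧ p.2 ∈ P ∧ ¬ I ⊆ p.1 ∪ p.2}

lemma isLowerSet_notCover {P : Set (Finset V)} (hP : IsLowerSet P) (I : Finset V) :
    IsLowerSet (notCover P I) := fun p q h hp =>
  ⟨(show q.1 ⊆ p.1 from h.1).trans hp.1, hP h.2 hp.2.1,
    fun h' => hp.2.2 (h'.trans (union_subset_union h.1 h.2))⟩

/-- Adding to `notCover P I` the pairs `(I, τ)` with `τ` disjoint from `I` makes it acyclic. -/
lemma acyclic_notCover_union {P : Set (Finset V)} (hP : IsLowerSet P) {I : Finset V}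
    (hI : I.Nonempty) :
    Acyclic (bdPair K) (notCover P I ∪ {p | p.1 ⊆ I ∧ p.2 ∈ P ∧ Disjoint p.2 I}) := by
  refine acyclic_swap (acyclic_of_fibres ?_ fun τ => ?_)
  · rintro p q h (hp | hp)
    · exact Or.inl (isLowerSet_notCover hP I (show q.swap ≤ p.swap from ⟨h.2, h.1⟩) hp)
    · exact Or.inr ⟨(show q.2 ⊆ p.2 from h.2).trans hp.1, hP h.1 hp.2.1,
        hp.2.2.mono_left h.1⟩
  · by_cases hτ : τ ∈ P
    · by_cases hd : Disjoint τ I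
      · obtain ⟨v, hv⟩ := hI
        refine acyclic_of_cone v fun ρ hρ => Or.inr ⟨insert_subset hv ?_, hτ, hd⟩
        rcases hρ with hρ | hρ
        · exact hρ.1
        · exact hρ.1
      · obtain ⟨v, hvτ, hvI⟩ := not_disjoint_iff.mp hd
        refine acyclic_of_cone v fun ρ hρ => ?_
        rcases hρ with hρ | hρ
        · refine Or.inl ⟨insert_subset hvI hρ.1, hτ, fun h => hρ.2.2 ?_⟩
          change I ⊆ insert v ρ ∪ τ at h
          rwa [insert_union, insert_eq_of_mem (mem_union_right _ hvτ)] at h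
        · exact absurd hρ.2.2 hd
    · convert acyclic_empty (bd K) using 1
      ext ρ
      refine iff_of_false ?_ id
      rintro (h | h)
      · exact hτ h.2.1
      · exact hτ h.2.1

lemma joinBoundary_degPart (I : Finset V) (j : ℤ) (u : Finset V → K) :
    joinBoundary K I (degPart K cardDeg j u) =
      degPart K pairDeg (j + (#I - 1)) (joinBoundary K I u) := by
  classical
  ext ⟨ρ, τ⟩
  rw [degPart_apply, joinBoundary_apply, joinBoundary_apply, degPart_apply]
  by_cases h : ρ ⊆ I ∧ #ρ + 1 = #I
  · have : cardDeg τ = j ↔ pairDeg (ρ, τ) = j + (#I - 1) := by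
      simp only [pairDeg, cardDeg]
      have := h.2
      omega
    simp only [this]
    split_ifs <;> simp
  · rw [bd_single_eq_zero h]; simp

/-- The complex `notCover P I` computes the homology of the restriction of `P` to the complement
of `I`, up to a shift. -/
lemma nonempty_hom_equiv_notCover {P : Set (Finset V)} (hP : IsLowerSet P) {I : Finset V}
    (hI : I.Nonempty) (j k : ℤ) (hk : k = j + (#I - 1)) :
    Nonempty (Hom K {τ | τ ∈ P ∧ Disjoint τ I} j ≃ₗ[K] HomPair K (notCover P I) k) := by
  set R := {τ | τ ∈ P ∧ Disjoint τ I} with hR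
  set E' := notCover P I ∪ {p | p.1 ⊆ I ∧ p.2 ∈ P ∧ Disjoint p.2 I} with hE'
  have hac : Acyclic (bdPair K) E' := acyclic_notCover_union hP hI
  have hEE' : supp K (notCover P I) ≤ supp K E' := supp_mono Set.subset_union_left
  have hE'I : ∀ {ρ τ}, (ρ, τ) ∈ E' → ρ ⊆ I := by
    rintro ρ τ (h | h)
    · exact h.1
    · exact h.1
  have hEI : ∀ {ρ τ}, (ρ, τ) ∈ notCover P I → ρ ≠ I := by
    rintro ρ τ h rfl
    exact h.2.2 subset_union_left
  have hRI : ∀ τ, (I, τ) ∈ E' → τ ∈ R := by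
    rintro τ (h | h)
    · exact absurd rfl (hEI h)
    · exact h.2
  have hslice : ∀ y ∈ supp K E', (fun τ => y (I, τ)) ∈ supp K R := fun y hy τ hτ =>
    hy _ fun h => hτ (hRI τ h)
  have hmem : ∀ y ∈ supp K E', (∀ τ, y (I, τ) = 0) → y ∈ supp K (notCover P I) := by
    rintro y hy h ⟨ρ, τ⟩ hp
    by_cases hρ : ρ = I
    · subst hρ; exact h τ
    · by_cases h2 : (ρ, τ) ∈ E'
      · rcases h2 with h2 | h2
        · exact absurd h2 hp
        · refine absurd ⟨h2.1, h2.2.1, fun h3 => hρ (subset_antisymm h2.1 fun v hv => ?_)⟩ hp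
          rcases mem_union.mp (h3 hv) with h4 | h4
          · exact h4
          · exact absurd hv (disjoint_left.mp h2.2.2 h4)
      · exact hy _ h2
  have hDI : ∀ y ∈ supp K E', ∀ τ,
      bdPair K y (I, τ) = (-1) ^ #I * bd K (fun τ' => y (I, τ')) τ := by
    intro y hy τ
    rw [bdPair_apply, bd_apply, sum_eq_zero, zero_add]
    intro v hv
    rw [hy _ fun h => ?_, mul_zero]
    rw [mem_compl] at hv
    exact hv (hE'I h (mem_insert_self _ _))
  have hT : ∀ u ∈ supp K R, joinSimplex K I u ∈ supp K E' := by
    rintro u hu ⟨ρ, τ⟩ h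
    rw [joinSimplex_apply]
    split_ifs with hρ
    · subst hρ
      exact hu τ fun h' => h (Or.inr ⟨subset_rfl, h'⟩)
    · rfl
  have hB : ∀ u ∈ supp K R, joinBoundary K I u ∈ supp K (notCover P I) := by
    rintro u hu ⟨ρ, τ⟩ h
    rw [joinBoundary_apply]
    by_cases hτ : τ ∈ R
    · rw [bd_single_eq_zero, zero_mul]
      rintro ⟨h1, h2⟩
      refine h ⟨h1, hτ.1, fun h3 => ?_⟩
      have : I ⊆ ρ := fun v hv => by
        rcases mem_union.mp (h3 hv) with h4 | h4
        · exact h4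
        · exact absurd hv (disjoint_left.mp hτ.2 h4)
      have := card_le_card this
      omega
    · rw [hu τ hτ, mul_zero]
  have hsq : (-1 : K) ^ #I * (-1) ^ #I = 1 := by rw [← mul_pow]; simp
  refine nonempty_grQuotEquiv (joinBoundary K I) (#I - 1) (joinBoundary_degPart I)
    (fun j x hx => degPart_mem_cyc bd_degPart R j x hx)
    (fun j x hx => degPart_mem_bdry bdPair_degPart _ j x hx) ?_ ?_ ?_ j k hk
  · intro u hu
    have h0 : bd K u = 0 := hu.2
    have h1 := bdPair_joinSimplex (K := K) I u
    rw [h0, map_zero, smul_zero, add_zero] at h1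
    exact ⟨hB u hu.1, show bdPair K _ = 0 by rw [← h1, bdPair_bdPair]⟩
  · intro u hu
    have h0 : bd K u = 0 := hu.2
    have h1 := bdPair_joinSimplex (K := K) I u
    rw [h0, map_zero, smul_zero, add_zero] at h1
    constructor
    · rintro ⟨w, hw, hwu⟩
      obtain ⟨y, hy, hyu⟩ := hac (joinSimplex K I u - w) (sub_mem (hT u hu.1) (hEE' hw))
        (by rw [map_sub, h1, hwu, sub_self])
      refine ⟨(-1 : K) ^ #I • fun τ => y (I, τ), Submodule.smul_mem _ _ (hslice y hy), ?_⟩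
      ext τ
      rw [map_smul, Pi.smul_apply, smul_eq_mul, ← hDI y hy, hyu, Pi.sub_apply, joinSimplex_apply,
        if_pos rfl, hw (I, τ) fun h => hEI h rfl, sub_zero]
    · rintro ⟨t, ht, rfl⟩
      refine ⟨-((-1 : K) ^ #I • joinBoundary K I t),
        neg_mem (Submodule.smul_mem _ _ (hB t ht)), ?_⟩
      have h2 := congrArg (bdPair K) (bdPair_joinSimplex (K := K) I t)
      rw [bdPair_bdPair, map_add, map_smul, h1] at h2
      rw [map_neg, map_smul, ← neg_eq_of_add_eq_zero_left h2.symm, smul_neg, neg_neg, smul_smul,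
        hsq, one_smul]
  · intro z hz
    have h0 : bdPair K z = 0 := hz.2
    obtain ⟨y, hy, rfl⟩ := hac z (hEE' hz.1) h0
    have hu0 : bd K (fun τ => y (I, τ)) = 0 := by
      ext τ
      have h1 := hDI y hy τ
      rw [hz.1 (I, τ) fun h => hEI h rfl, eq_comm, mul_eq_zero] at h1
      exact h1.resolve_left (by simp)
    refine ⟨fun τ => y (I, τ), ⟨hslice y hy, hu0⟩, y - joinSimplex K I (fun τ => y (I, τ)), ?_, ?_⟩
    · refine hmem _ (sub_mem hy (hT _ (hslice y hy))) fun τ => ?_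
      rw [Pi.sub_apply, joinSimplex_apply, if_pos rfl, sub_self]
    · rw [map_sub, bdPair_joinSimplex, hu0, map_zero, smul_zero, add_zero]

end Join

section Dowker

variable {K : Type*} [Field K] {U V : Type*} [LinearOrder U] [Fintype U] [LinearOrder V]
  [Fintype V]

lemma exists_minimal_nonface {P : Set (Finset V)} {A : Finset V} (hA : A ∉ P) :
    ∃ t ⊆ A, t ∉ P ∧ ∀ t' ⊂ t, t' ∈ P := by
  induction A using Finset.strongInduction with
  | H A ih =>
    by_cases h : ∀ t' ⊂ A, t' ∈ P
    · exact ⟨A, subset_rfl, hA, h⟩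
    · push Not at h
      obtain ⟨t', ht', ht'P⟩ := h
      obtain ⟨t, htt', ht⟩ := ih t' ht' ht'P
      exact ⟨t, htt'.trans ht'.1, ht⟩

/-- The combinatorial core: if `P` becomes acyclic after deleting any of its nonempty faces, then
the complex of families of minimal non-faces not covering `I` has the homology of the restriction
of `P` to the complement of `I`, up to a shift. -/
theorem nonempty_hom_equiv {P : Set (Finset V)} (hP : IsLowerSet P) {σ : Finset V} (hσ : σ ∈ P)
    (hmax : ∀ τ ∈ P, σ ⊆ τ → τ = σ)
    (hac : ∀ ρ ∈ P, Acyclic (bd K) {τ | τ ∈ P ∧ ¬ ρ ⊆ τ}) {I : Finset V} {J : U → Finset V}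
    (hJ : ∀ t, (∃ k, J k = t) ↔ (t ∉ P ∧ ∀ t' ⊂ t, t' ∈ P) ∧ t ⊆ I) (hIP : I ∉ P) (j k : ℤ)
    (hk : k + #σ = j + (#I - 1)) :
    Nonempty (Hom K {τ | τ ∈ P ∧ Disjoint τ I} j ≃ₗ[K] Hom K {L : Finset U | L.sup J ≠ I} k) := by
  have hI : I.Nonempty := by
    rw [nonempty_iff_ne_empty]
    rintro rfl
    exact hIP (hP (empty_subset σ) hσ)
  have hJP : ∀ u, J u ∉ P := fun u => ((hJ _).1 ⟨u, rfl⟩).1.1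
  have hJI : ∀ u, J u ⊆ I := fun u => ((hJ _).1 ⟨u, rfl⟩).2
  have hex : ∀ A ⊆ I, A ∉ P → ∃ u, J u ⊆ A := by
    intro A hA hAP
    obtain ⟨t, ht, ht'⟩ := exists_minimal_nonface hAP
    obtain ⟨u, rfl⟩ := (hJ t).2 ⟨ht', ht.trans hA⟩
    exact ⟨u, ht⟩
  set G : Set (Finset V) := {ρ | ρ ⊆ I ∧ I \ ρ ∉ P} with hGdef
  have hG : IsLowerSet G := fun ρ ρ' h hρ =>
    ⟨(show ρ' ⊆ ρ from h).trans hρ.1, fun h' => hρ.2 (hP (sdiff_subset_sdiff subset_rfl h) h')⟩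
  set B : Set (Finset U × Finset V) := {p | p.2 ⊆ I ∧ ∀ u ∈ p.1, Disjoint (J u) p.2} with hBdef
  have hB : IsLowerSet B := fun p q h hp =>
    ⟨(show q.2 ⊆ p.2 from h.2).trans hp.1, fun u hu => (hp.2 u (h.1 hu)).mono_right h.2⟩
  have hΛ : IsLowerSet {L : Finset U | L.sup J ≠ I} := fun L L' h hL hL' =>
    hL (subset_antisymm (Finset.sup_le fun u _ => hJI u) (hL' ▸ sup_mono h))
  obtain ⟨u₀, -⟩ := hex I subset_rfl hIP
  obtain ⟨v₀, hv₀⟩ := hI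
  have e₁ := nonempty_hom_equiv_notCover (K := K) hP ⟨v₀, hv₀⟩ j _ hk
  have hGP : IsLowerSet {p : Finset V × Finset V | p.1 ∈ G ∧ p.2 ∈ P} := fun p q h hp =>
    ⟨hG h.1 hp.1, hP h.2 hp.2⟩
  have e₂ := nonempty_homPair_equiv_of_fibres (K := K) hGP (isLowerSet_notCover hP I)
    (fun p hp => ⟨hp.1.1, hp.2, fun h => hp.1.2 (hP (sdiff_le_iff.mpr h) hp.2)⟩) (fun ρ => by
      by_cases hρ : ρ ∈ G
      · exact Or.inl fun τ hτ => ⟨hρ, hτ.2.1⟩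
      · refine Or.inr ⟨fun τ h => hρ h.1, ?_⟩
        by_cases hρI : ρ ⊆ I
        · convert hac (I \ ρ) (by by_contra h; exact hρ ⟨hρI, h⟩) using 1
          ext τ
          change (ρ ⊆ I ∧ τ ∈ P ∧ ¬ I ⊆ ρ ∪ τ) ↔ (τ ∈ P ∧ ¬ I \ ρ ⊆ τ)
          have h : I \ ρ ⊆ τ ↔ I ⊆ ρ ∪ τ := sdiff_le_iff
          rw [and_iff_right hρI, h]
        · convert acyclic_empty (bd K) using 1
          ext τ
          exact iff_of_false (fun h => hρI h.1) id) (k + #σ)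
  have e₃ := nonempty_homPair_prod_equiv (K := K) hG hP hσ hmax (hac σ hσ) _ k rfl
  have e₄ : Nonempty (HomPair K (Prod.swap ⁻¹' B) (k + 1) ≃ₗ[K] Hom K G k) := by
    refine nonempty_homPair_equiv_hom (F := Prod.swap ⁻¹' B) (Λ := G)
      hG ?_ ?_ ?_ ?_ _ k rfl
    · intro ρ L h hρ
      rw [eq_empty_iff_forall_notMem]
      intro u hu
      refine hρ ⟨h.1, fun h' => hJP u (hP (fun v hv => mem_sdiff.mpr ⟨hJI u hv, ?_⟩) h')⟩
      exact disjoint_left.mp (h.2 u hu) hv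
    · exact fun ρ hρ => ⟨hρ.1, fun u hu => absurd hu (notMem_empty u)⟩
    · exact acyclic_of_cone v₀ fun ρ hρ =>
        ⟨insert_subset hv₀ hρ.1, fun u hu => absurd hu (notMem_empty u)⟩
    · refine acyclic_of_fibres (fun p q h hp =>
        ⟨hB (show q.swap ≤ p.swap from ⟨h.2, h.1⟩) hp.1, hG h.1 hp.2⟩) fun ρ => ?_
      by_cases hρ : ρ ∈ G
      · obtain ⟨u, hu⟩ := hex (I \ ρ) sdiff_subset hρ.2
        refine acyclic_of_cone u fun L hL => ⟨⟨hρ.1, fun w hw => ?_⟩, hρ⟩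
        rcases mem_insert.mp hw with rfl | hw
        · exact disjoint_of_subset_left hu sdiff_disjoint
        · exact hL.1.2 w hw
      · convert acyclic_empty (bd K) using 1
        ext L
        exact iff_of_false (fun h => hρ h.2) id
  have e₅ := nonempty_homPair_swap (K := K) B (k + 1)
  have e₆ : Nonempty (HomPair K B (k + 1) ≃ₗ[K] Hom K {L : Finset U | L.sup J ≠ I} k) := by
    refine nonempty_homPair_equiv_hom hΛ ?_ ?_ ?_ ?_ _ k rfl
    · intro L ρ h hL
      rw [Set.mem_ofPred_eq, not_not] at hL
      rw [eq_empty_iff_forall_notMem]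
      intro v hv
      have hvI := h.1 hv
      rw [← hL, mem_sup] at hvI
      obtain ⟨u, hu, hvu⟩ := hvI
      exact disjoint_left.mp (h.2 u hu) hvu hv
    · exact fun L _ => ⟨empty_subset _, fun u _ => disjoint_empty_right _⟩
    · exact acyclic_of_cone u₀ fun L _ => ⟨empty_subset _, fun u _ => disjoint_empty_right _⟩
    · refine acyclic_of_fibres (fun p q h hp => ⟨hB h hp.1, hΛ h.1 hp.2⟩) fun L => ?_
      by_cases hL : L.sup J = I
      · convert acyclic_empty (bd K) using 1
        ext L
        exact iff_of_false (fun h => h.2 hL) id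
      · obtain ⟨v, hvI, hv⟩ : ∃ v ∈ I, v ∉ L.sup J := by
          by_contra! h
          exact hL (subset_antisymm (Finset.sup_le fun u _ => hJI u) h)
        refine acyclic_of_cone v fun ρ hρ => ⟨⟨insert_subset hvI hρ.1.1, fun u hu => ?_⟩, hL⟩
        change Disjoint (J u) (insert v ρ)
        rw [disjoint_insert_right]
        exact ⟨fun h => hv (mem_sup.mpr ⟨u, hu, h⟩), hρ.1.2 u hu⟩
  obtain ⟨e₁⟩ := e₁
  obtain ⟨e₂⟩ := e₂
  obtain ⟨e₃⟩ := e₃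
  obtain ⟨e₄⟩ := e₄
  obtain ⟨e₅⟩ := e₅
  obtain ⟨e₆⟩ := e₆
  exact ⟨e₁.trans (e₂.symm.trans (e₃.trans (e₄.symm.trans (e₅.symm.trans e₆))))⟩

end Dowker

section Translation

variable {V : Type} [LinearOrder V] [Fintype V] (K : Type) [Field K]

/-- A simplicial chain, as a function on all finsets of vertices. -/
noncomputable def toFun (Γ : ASC V) (j : ℤ) : ASC.Chains K Γ j →ₗ[K] (Finset V → K) :=
  Finsupp.lsum K fun σ : ASC.Cells Γ j => LinearMap.toSpanSingleton K _ (Pi.single σ.1 1)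

lemma toFun_single (Γ : ASC V) (j : ℤ) (σ : ASC.Cells Γ j) (c : K) :
    toFun K Γ j (Finsupp.single σ c : ASC.Cells Γ j →₀ K) = Pi.single σ.1 c := by
  refine (Finsupp.lsum_single K _ σ c).trans ?_
  rw [LinearMap.toSpanSingleton_apply, ← Pi.single_smul, smul_eq_mul, mul_one]

lemma toFun_boundary (Γ : ASC V) (j k : ℤ) (hk : k = j - 1) (x : ASC.Chains K Γ j) :
    toFun K Γ k (ASC.boundary K Γ j k hk x) = bd K (toFun K Γ j x) := by
  suffices h : toFun K Γ k ∘ₗ ASC.boundary K Γ j k hk = bd K ∘ₗ toFun K Γ j from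
    LinearMap.congr_fun h x
  refine Finsupp.lhom_ext' fun σ => LinearMap.ext_ring ?_
  change toFun K Γ k (ASC.boundary K Γ j k hk (Finsupp.single σ 1 : ASC.Cells Γ j →₀ K)) =
    bd K (toFun K Γ j (Finsupp.single σ 1 : ASC.Cells Γ j →₀ K))
  rw [toFun_single, bd_single]
  have h1 : ASC.boundary K Γ j k hk (Finsupp.single σ 1 : ASC.Cells Γ j →₀ K) = _ :=
    Finsupp.lsum_single K _ σ 1
  rw [h1, LinearMap.toSpanSingleton_apply, one_smul]
  refine (map_sum (toFun K Γ k) _ _).trans ?_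
  rw [← sum_attach σ.1]
  refine sum_congr rfl fun v _ => ?_
  refine (toFun_single K Γ k _ _).trans ?_
  congr 1
  unfold sgn
  congr 2
  ext w
  simp only [mem_filter, mem_erase]
  exact ⟨fun h => ⟨⟨h.2.ne, h.1⟩, h.2⟩, fun h => ⟨h.1.2, h.2⟩⟩

lemma toFun_apply (Γ : ASC V) (j : ℤ) (x : ASC.Cells Γ j →₀ K) (σ : ASC.Cells Γ j) :
    toFun K Γ j x σ.1 = x σ := by
  suffices h : LinearMap.proj σ.1 ∘ₗ toFun K Γ j = Finsupp.lapply σ from LinearMap.congr_fun h x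
  refine Finsupp.lhom_ext' fun σ' => LinearMap.ext_ring ?_
  change toFun K Γ j (Finsupp.single σ' 1 : ASC.Cells Γ j →₀ K) σ.1 = Finsupp.single σ' 1 σ
  classical
  rw [toFun_single, Pi.single_apply, Finsupp.single_apply]
  exact if_congr (eq_comm.trans Subtype.ext_iff.symm) rfl rfl

lemma toFun_mem (Γ : ASC V) (j : ℤ) (x : ASC.Chains K Γ j) :
    toFun K Γ j x ∈ supp K Γ.faces ⊓ homog K cardDeg (j + 1) := by
  induction x using Finsupp.induction_linear with
  | zero => exact (map_zero (toFun K Γ j)).symm ▸ zero_mem _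
  | add f g hf hg => exact (map_add (toFun K Γ j) f g).symm ▸ add_mem hf hg
  | single σ c =>
    rw [toFun_single]
    exact ⟨single_mem_supp σ.2.1 c, single_mem_supp (Γ := {a | cardDeg a = j + 1}) σ.2.2 c⟩

lemma exists_toFun_eq (Γ : ASC V) (j : ℤ) {y : Finset V → K}
    (hy : y ∈ supp K Γ.faces ⊓ homog K cardDeg (j + 1)) : ∃ x, toFun K Γ j x = y := by
  have : Finite (ASC.Cells Γ j) := Subtype.finite
  refine ⟨(Finsupp.equivFunOnFinite.symm fun σ : ASC.Cells Γ j => y σ.1), ?_⟩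
  ext τ
  by_cases h : τ ∈ Γ.faces ∧ (#τ : ℤ) = j + 1
  · exact (toFun_apply K Γ j _ ⟨τ, h⟩).trans rfl
  · rcases not_and_or.mp h with h' | h'
    · exact ((toFun_mem K Γ j _).1 τ h').trans (hy.1 τ h').symm
    · exact ((toFun_mem K Γ j _).2 τ h').trans (hy.2 τ h').symm

lemma toFun_injective (Γ : ASC V) (j : ℤ) : Function.Injective (toFun K Γ j) := fun x y h =>
  Finsupp.ext fun σ => by
    rw [← toFun_apply K Γ j x, ← toFun_apply K Γ j y]
    exact congrFun h σ.1

/-- Reduced simplicial homology computed with functions on the finsets of vertices. -/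
lemma nonempty_reducedHomology_equiv (Γ : ASC V) (j k : ℤ) (hk : k = j + 1) :
    Nonempty (ASC.reducedHomology K Γ j ≃ₗ[K] Hom K Γ.faces k) := by
  subst hk
  refine nonempty_quotEquiv (toFun K Γ j) ?_ ?_ ?_
  · intro x hx
    have h0 : ASC.boundary K Γ j (j - 1) rfl x = 0 := hx
    refine ⟨⟨(toFun_mem K Γ j x).1, ?_⟩, (toFun_mem K Γ j x).2⟩
    change bd K _ = 0
    rw [← toFun_boundary K Γ j (j - 1) rfl, h0, map_zero]
  · intro x _
    constructor
    · rintro ⟨y, hy, hyx⟩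
      have hy' : degPart K cardDeg (j + 1 + 1) y ∈
          supp K Γ.faces ⊓ homog K cardDeg (j + 1 + 1) :=
        ⟨degPart_mem_supp hy, degPart_mem_homog _ _ _⟩
      obtain ⟨z, hz⟩ := exists_toFun_eq K Γ (j + 1) hy'
      refine ⟨z, toFun_injective K Γ j ?_⟩
      rw [toFun_boundary, hz, bd_degPart, hyx, add_neg_cancel_right,
        degPart_eq (toFun_mem K Γ j x).2]
    · rintro ⟨z, rfl⟩
      exact ⟨toFun K Γ (j + 1) z, (toFun_mem K Γ (j + 1) z).1, (toFun_boundary K Γ _ _ _ z).symm⟩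
  · intro y hy
    obtain ⟨x, rfl⟩ := exists_toFun_eq K Γ j ⟨hy.1.1, hy.2⟩
    refine ⟨x, toFun_injective K Γ (j - 1) ?_, by rw [sub_self]; exact zero_mem _⟩
    rw [toFun_boundary, map_zero]
    exact hy.1.2

end Translation

section ListChains

variable (K : Type*) [Field K] {X Y : Type*}

/-- Prepending a point to all lists in a chain. -/
noncomputable def consChain (x : X) : (List X →₀ K) →ₗ[K] (List X →₀ K) :=
  Finsupp.lmapDomain K K (List.cons x)

lemma consChain_single (x : X) (l : List X) (c : K) :
    consChain K x (Finsupp.single l c) = Finsupp.single (x :: l) c := by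
  rw [consChain, Finsupp.lmapDomain_apply, Finsupp.mapDomain_single]

/-- The boundary of a list of points. -/
noncomputable def listBoundary : List X → (List X →₀ K)
  | [] => 0
  | x :: l => Finsupp.single l 1 - consChain K x (listBoundary l)

/-- The boundary operator on chains of lists. -/
noncomputable def listBd : (List X →₀ K) →ₗ[K] (List X →₀ K) :=
  Finsupp.linearCombination K (listBoundary K)

lemma list_lhom_ext {N : Type*} [AddCommGroup N] [Module K N] {f g : (List X →₀ K) →ₗ[K] N}
    (h : ∀ l, f (Finsupp.single l 1) = g (Finsupp.single l 1)) : f = g :=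
  Finsupp.lhom_ext' fun l => LinearMap.ext_ring (h l)

lemma listBd_nil : listBd K (Finsupp.single ([] : List X) 1) = 0 := by
  rw [listBd, Finsupp.linearCombination_single, listBoundary, smul_zero]

lemma listBd_consChain (x : X) (c : List X →₀ K) :
    listBd K (consChain K x c) = c - consChain K x (listBd K c) := by
  suffices h : listBd K ∘ₗ consChain K x = LinearMap.id - consChain K x ∘ₗ listBd K from
    LinearMap.congr_fun h c
  refine list_lhom_ext K fun l => ?_
  simp only [LinearMap.comp_apply, LinearMap.sub_apply, LinearMap.id_apply, consChain_single,
    listBd, Finsupp.linearCombination_single, one_smul, listBoundary]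

/-- A differential module with cone operators, indexed by the points of `Y`, and a filtration
indexed by the sets of points of `Y`. -/
structure ConeModule (K : Type*) [Field K] (Y : Type*) (T : Type*) [AddCommGroup T]
    [Module K T] where
  D : T →ₗ[K] T
  e : Y → T →ₗ[K] T
  u : T
  W : Set Y → Submodule K T
  D_u : D u = 0
  D_e : ∀ y t, D (e y t) = t - e y (D t)
  u_mem : ∀ S, u ∈ W S
  e_mem : ∀ S, ∀ y ∈ S, ∀ t ∈ W S, e y t ∈ W S

/-- Chains of lists form a cone module. -/
noncomputable def listCone (K : Type*) [Field K] (X : Type*) :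
    ConeModule K X (List X →₀ K) where
  D := listBd K
  e := consChain K
  u := Finsupp.single [] 1
  W S := Finsupp.supported K K {l | ∀ x ∈ l, x ∈ S}
  D_u := listBd_nil K
  D_e := listBd_consChain K
  u_mem S := Finsupp.single_mem_supported K 1 (by simp)
  e_mem S y hy t ht := by
    rw [Finsupp.supported_eq_span_single] at ht
    induction ht using Submodule.span_induction with
    | mem t h =>
      obtain ⟨l, hl, rfl⟩ := h
      rw [consChain_single]
      refine Finsupp.single_mem_supported K 1 ?_
      simpa [hy] using hl
    | zero => rw [map_zero]; exact zero_mem _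
    | add a b _ _ ha hb => rw [map_add]; exact add_mem ha hb
    | smul c a _ ha => rw [map_smul]; exact Submodule.smul_mem _ _ ha

/-- Simplicial chains form a cone module. -/
def finsetCone (K : Type*) [Field K] (V : Type*) [LinearOrder V] [Fintype V] :
    ConeModule K V (Finset V → K) where
  D := bd K
  e := cone K
  u := Pi.single ∅ 1
  W S := supp K {τ | ↑τ ⊆ S}
  D_u := bd_single_empty K
  D_e := bd_cone K
  u_mem S := single_mem_supp (by simp) 1
  e_mem S y hy t ht := cone_mem_supp (fun σ hσ => by
    simpa [Set.insert_subset_iff, hy] using hσ) ht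

namespace ConeModule

variable {K} {T : Type*} [AddCommGroup T] [Module K T] (C : ConeModule K Y T)

/-- The image of a list of points under a map of points. -/
def listMap (f : X → Y) : List X → T
  | [] => C.u
  | x :: l => C.e (f x) (listMap f l)

/-- The chain map induced by a map of points. -/
noncomputable def chainMap (f : X → Y) : (List X →₀ K) →ₗ[K] T :=
  Finsupp.linearCombination K (C.listMap f)

lemma chainMap_single (f : X → Y) (l : List X) :
    C.chainMap f (Finsupp.single l 1) = C.listMap f l := by
  rw [chainMap, Finsupp.linearCombination_single, one_smul]

lemma chainMap_consChain (f : X → Y) (x : X) (c : List X →₀ K) :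
    C.chainMap f (consChain K x c) = C.e (f x) (C.chainMap f c) := by
  suffices h : C.chainMap f ∘ₗ consChain K x = C.e (f x) ∘ₗ C.chainMap f from
    LinearMap.congr_fun h c
  refine list_lhom_ext K fun l => ?_
  simp only [LinearMap.comp_apply, consChain_single, chainMap_single, listMap]

lemma D_chainMap (f : X → Y) (c : List X →₀ K) :
    C.D (C.chainMap f c) = C.chainMap f (listBd K c) := by
  suffices h : C.D ∘ₗ C.chainMap f = C.chainMap f ∘ₗ listBd K from LinearMap.congr_fun h c
  refine list_lhom_ext K fun l => ?_
  simp only [LinearMap.comp_apply]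
  induction l with
  | nil => rw [listBd_nil, map_zero, chainMap_single, listMap, C.D_u]
  | cons x l ih =>
    rw [← consChain_single, chainMap_consChain, listBd_consChain, C.D_e, ih, map_sub,
      chainMap_consChain]

/-- The prism over a list of points. -/
def listPrism (f g : X → Y) : List X → T
  | [] => 0
  | x :: l => C.e (f x) (C.e (g x) (C.listMap g l)) - C.e (f x) (listPrism f g l)

/-- The prism operator. -/
noncomputable def prism (f g : X → Y) : (List X →₀ K) →ₗ[K] T :=
  Finsupp.linearCombination K (C.listPrism f g)

lemma prism_single (f g : X → Y) (l : List X) :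
    C.prism f g (Finsupp.single l 1) = C.listPrism f g l := by
  rw [prism, Finsupp.linearCombination_single, one_smul]

lemma prism_consChain (f g : X → Y) (x : X) (c : List X →₀ K) :
    C.prism f g (consChain K x c) =
      C.e (f x) (C.e (g x) (C.chainMap g c)) - C.e (f x) (C.prism f g c) := by
  suffices h : C.prism f g ∘ₗ consChain K x =
      C.e (f x) ∘ₗ C.e (g x) ∘ₗ C.chainMap g - C.e (f x) ∘ₗ C.prism f g from
    LinearMap.congr_fun h c
  refine list_lhom_ext K fun l => ?_
  simp only [LinearMap.comp_apply, LinearMap.sub_apply, consChain_single, chainMap_single,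
    prism_single, listPrism]

lemma D_prism_add (f g : X → Y) (c : List X →₀ K) :
    C.D (C.prism f g c) + C.prism f g (listBd K c) = C.chainMap g c - C.chainMap f c := by
  suffices h : C.D ∘ₗ C.prism f g + C.prism f g ∘ₗ listBd K = C.chainMap g - C.chainMap f from
    LinearMap.congr_fun h c
  refine list_lhom_ext K fun l => ?_
  simp only [LinearMap.comp_apply, LinearMap.add_apply, LinearMap.sub_apply]
  induction l with
  | nil =>
    rw [listBd_nil, map_zero, prism_single, listPrism, map_zero, chainMap_single, chainMap_single,
      listMap, listMap, sub_self, add_zero]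
  | cons x l ih =>
    have h1 := congrArg (C.e (f x)) ih
    rw [map_add, map_sub] at h1
    rw [← consChain_single, chainMap_consChain, chainMap_consChain, listBd_consChain,
      prism_consChain, map_sub, map_sub, prism_consChain, C.D_e, C.D_e, C.D_e, map_sub,
      D_chainMap, ← sub_eq_zero]
    rw [← sub_eq_zero] at h1
    rw [← h1]
    abel

lemma listMap_mem {S : Set Y} (f : X → Y) (l : List X) (h : ∀ x ∈ l, f x ∈ S) :
    C.listMap f l ∈ C.W S := by
  induction l with
  | nil => exact C.u_mem S
  | cons x l ih =>
    exact C.e_mem S _ (h x (by simp)) _ (ih fun y hy => h y (by simp [hy]))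

lemma listPrism_mem {S : Set Y} (f g : X → Y) (l : List X) (hf : ∀ x ∈ l, f x ∈ S)
    (hg : ∀ x ∈ l, g x ∈ S) : C.listPrism f g l ∈ C.W S := by
  induction l with
  | nil => exact zero_mem _
  | cons x l ih =>
    refine sub_mem (C.e_mem S _ (hf x (by simp)) _ (C.e_mem S _ (hg x (by simp)) _
      (C.listMap_mem g l fun y hy => hg y (by simp [hy])))) (C.e_mem S _ (hf x (by simp)) _
      (ih (fun y hy => hf y (by simp [hy])) fun y hy => hg y (by simp [hy])))

lemma chainMap_mem {E : Submodule K T} (f : X → Y) (z : List X →₀ K)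
    (h : ∀ l ∈ z.support, C.listMap f l ∈ E) : C.chainMap f z ∈ E := by
  rw [chainMap, Finsupp.linearCombination_apply, Finsupp.sum]
  exact sum_mem fun l hl => Submodule.smul_mem _ _ (h l hl)

lemma prism_mem {E : Submodule K T} (f g : X → Y) (z : List X →₀ K)
    (h : ∀ l ∈ z.support, C.listPrism f g l ∈ E) : C.prism f g z ∈ E := by
  rw [prism, Finsupp.linearCombination_apply, Finsupp.sum]
  exact sum_mem fun l hl => Submodule.smul_mem _ _ (h l hl)

/-- A cycle of lists which can be moved to a constant through small steps is mapped to
a boundary. -/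
lemma exists_D_eq_chainMap {E : Submodule K T} (f : ℕ → X → Y) (N : ℕ) (c : Y)
    (hc : ∀ x, f N x = c) (hcE : C.W {c} ≤ E) {z : List X →₀ K} (hz : listBd K z = 0)
    (h : ∀ l ∈ z.support, ∀ i < N, ∃ S, (∀ x ∈ l, f i x ∈ S ∧ f (i + 1) x ∈ S) ∧ C.W S ≤ E) :
    ∃ y ∈ E, C.D y = C.chainMap (f 0) z := by
  suffices hi : ∀ i ≤ N, ∃ y ∈ E, C.D y = C.chainMap (f i) z from hi 0 (Nat.zero_le N)
  refine fun i hi => Nat.decreasingInduction' (fun k hk _ ⟨y, hy, hyz⟩ => ?_) hi ?_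
  · refine ⟨y - C.prism (f k) (f (k + 1)) z, sub_mem hy (C.prism_mem _ _ _ fun l hl => ?_), ?_⟩
    · obtain ⟨S, hS, hSE⟩ := h l hl k hk
      exact hSE (C.listPrism_mem _ _ l (fun x hx => (hS x hx).1) fun x hx => (hS x hx).2)
    · have h1 := C.D_prism_add (f k) (f (k + 1)) z
      rw [hz, map_zero, add_zero] at h1
      rw [map_sub, h1, hyz, sub_sub_cancel]
  · refine ⟨C.e c (C.chainMap (f N) z), hcE (C.e_mem {c} c (Set.mem_singleton c) _ ?_), ?_⟩
    · exact C.chainMap_mem _ _ fun l _ => C.listMap_mem _ l fun x _ => hc x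
    · rw [C.D_e, D_chainMap, hz, map_zero, map_zero, sub_zero]

end ConeModule

lemma listCone_chainMap_id (z : List X →₀ K) : (listCone K X).chainMap id z = z := by
  suffices h : (listCone K X).chainMap id = LinearMap.id from LinearMap.congr_fun h z
  refine list_lhom_ext K fun l => ?_
  rw [ConeModule.chainMap_single, LinearMap.id_apply]
  induction l with
  | nil => rfl
  | cons x l ih =>
    rw [ConeModule.listMap, ih]
    exact consChain_single K x l 1

end ListChains

section Carrier

variable {K : Type*} [Field K] {V : Type*} [LinearOrder V] [Fintype V]
  {T : Type*} [AddCommGroup T] [Module K T]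

lemma bd_single_eq_sum (σ : Finset V) : bd K (Pi.single σ 1) =
    ∑ v ∈ σ, (sgn K (σ.erase v) v) • (Pi.single (σ.erase v) 1 : Finset V → K) := by
  rw [bd_single]
  refine sum_congr rfl fun v _ => ?_
  rw [← Pi.single_smul, smul_eq_mul, mul_one]

/-- The acyclic carrier theorem for simplicial chains. -/
lemma exists_of_carrier {Q : Set (Finset V)} (hQ : IsLowerSet Q) (D : T →ₗ[K] T)
    (a : (Finset V → K) →ₗ[K] T) (ε : K) (E : Finset V → Submodule K T)
    (hE : Monotone E) (hac : ∀ σ ∈ Q, σ.Nonempty → ∀ x ∈ E σ, D x = 0 → ∃ y ∈ E σ, D y = x)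
    (haE : ∀ σ ∈ Q, a (Pi.single σ 1) ∈ E σ)
    (hDa : ∀ σ ∈ Q, D (a (Pi.single σ 1)) = -(ε • a (bd K (Pi.single σ 1))))
    (t₀ : T) (ht₀ : t₀ ∈ E ∅) (hDt₀ : D t₀ = a (Pi.single ∅ 1)) :
    ∃ h : (Finset V → K) →ₗ[K] T, h (Pi.single ∅ 1) = t₀ ∧ ∀ σ ∈ Q, h (Pi.single σ 1) ∈ E σ ∧
      D (h (Pi.single σ 1)) = a (Pi.single σ 1) + ε • h (bd K (Pi.single σ 1)) := by
  suffices H : ∀ n : ℕ, ∃ h : (Finset V → K) →ₗ[K] T, h (Pi.single ∅ 1) = t₀ ∧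
      ∀ σ ∈ Q, #σ ≤ n → h (Pi.single σ 1) ∈ E σ ∧
      D (h (Pi.single σ 1)) = a (Pi.single σ 1) + ε • h (bd K (Pi.single σ 1)) by
    obtain ⟨h, h0, h1⟩ := H (Fintype.card V)
    exact ⟨h, h0, fun σ hσ => h1 σ hσ (card_le_univ σ)⟩
  have hbasis : ∀ b : Finset V → T, ∃ h : (Finset V → K) →ₗ[K] T,
      ∀ σ, h (Pi.single σ 1) = b σ := fun b =>
    ⟨(Pi.basisFun K (Finset V)).constr K b, fun σ => by
      rw [← Pi.basisFun_apply, Module.Basis.constr_basis]⟩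
  intro n
  induction n with
  | zero =>
    obtain ⟨h, hh⟩ := hbasis fun _ => t₀
    refine ⟨h, hh _, fun σ hσ hσ0 => ?_⟩
    obtain rfl : σ = ∅ := by simpa using hσ0
    rw [hh, bd_single_empty, map_zero, smul_zero, add_zero]
    exact ⟨ht₀, hDt₀⟩
  | succ n ih =>
    obtain ⟨h, h0, hh⟩ := ih
    have hsum : ∀ σ, h (bd K (Pi.single σ 1)) =
        ∑ v ∈ σ, (sgn K (σ.erase v) v) • h (Pi.single (σ.erase v) 1) := fun σ => by
      rw [bd_single_eq_sum, map_sum]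
      exact sum_congr rfl fun v _ => map_smul _ _ _
    have hmem : ∀ σ ∈ Q, #σ = n + 1 → h (bd K (Pi.single σ 1)) ∈ E σ := fun σ hσ hn => by
      rw [hsum]
      refine sum_mem fun v hv => Submodule.smul_mem _ _ (hE (erase_subset v σ) (hh _ ?_ ?_).1)
      · exact hQ (erase_subset v σ) hσ
      · rw [card_erase_of_mem hv]; omega
    have hDh : ∀ σ ∈ Q, #σ = n + 1 → D (h (bd K (Pi.single σ 1))) = a (bd K (Pi.single σ 1)) := by
      intro σ hσ hn
      have h1 : D (h (bd K (Pi.single σ 1))) =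
          a (bd K (Pi.single σ 1)) + ε • h (bd K (bd K (Pi.single σ 1))) := by
        conv_lhs => rw [hsum, map_sum]
        conv_rhs => rw [bd_single_eq_sum σ, map_sum, map_sum, map_sum, smul_sum,
          ← sum_add_distrib]
        refine sum_congr rfl fun v hv => ?_
        rw [map_smul, (hh _ (hQ (erase_subset v σ) hσ)
          (by rw [card_erase_of_mem hv]; omega)).2, map_smul, map_smul, map_smul, smul_add,
          smul_comm ε]
      rw [h1, bd_bd, map_zero, smul_zero, add_zero]
    have hex : ∀ σ ∈ Q, #σ = n + 1 → ∃ y ∈ E σ,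
        D y = a (Pi.single σ 1) + ε • h (bd K (Pi.single σ 1)) := fun σ hσ hn => by
      refine hac σ hσ (card_pos.mp (by omega)) _
        (add_mem (haE σ hσ) (Submodule.smul_mem _ _ (hmem σ hσ hn))) ?_
      rw [map_add, map_smul, hDh σ hσ hn, hDa σ hσ, neg_add_cancel]
    choose! y hy hDy using hex
    obtain ⟨h', hh'⟩ := hbasis fun σ => if #σ = n + 1 then y σ else h (Pi.single σ 1)
    have heq : ∀ σ, #σ ≤ n → h' (Pi.single σ 1) = h (Pi.single σ 1) := fun σ hσ => by
      rw [hh', if_neg (by omega)]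
    have hbd : ∀ σ, #σ ≤ n + 1 → h' (bd K (Pi.single σ 1)) = h (bd K (Pi.single σ 1)) := by
      intro σ hσ
      rw [bd_single_eq_sum, map_sum, map_sum]
      refine sum_congr rfl fun v hv => ?_
      rw [map_smul, map_smul, heq _ (by rw [card_erase_of_mem hv]; omega)]
    refine ⟨h', by rw [heq _ (by simp), h0], fun σ hσ hn => ?_⟩
    rw [hbd σ hn]
    rcases Nat.lt_or_eq_of_le hn with hn | hn
    · rw [heq σ (by omega)]
      exact hh σ hσ (by omega)
    · rw [hh', if_pos hn]
      exact ⟨hy σ hσ hn, hDy σ hσ hn⟩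

/-- Linear maps which agree on the simplices of `Q` agree on chains supported in `Q`. -/
lemma eqOn_supp {Q : Set (Finset V)} {f g : (Finset V → K) →ₗ[K] T}
    (h : ∀ σ ∈ Q, f (Pi.single σ 1) = g (Pi.single σ 1)) {x : Finset V → K} (hx : x ∈ supp K Q) :
    f x = g x := by
  have hsum : x = ∑ σ, x σ • (Pi.single σ 1 : Finset V → K) := by
    ext τ
    simp [Finset.sum_apply, Pi.single_apply]
  rw [hsum, map_sum, map_sum]
  refine sum_congr rfl fun σ _ => ?_
  rw [map_smul, map_smul]
  by_cases hσ : σ ∈ Q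
  · rw [h σ hσ]
  · rw [hx σ hσ, zero_smul, zero_smul]

lemma map_mem_of_supp {Q : Set (Finset V)} {f : (Finset V → K) →ₗ[K] T} {E : Submodule K T}
    (h : ∀ σ ∈ Q, f (Pi.single σ 1) ∈ E) {x : Finset V → K} (hx : x ∈ supp K Q) : f x ∈ E := by
  have hsum : x = ∑ σ, x σ • (Pi.single σ 1 : Finset V → K) := by
    ext τ
    simp [Finset.sum_apply, Pi.single_apply]
  rw [hsum, map_sum]
  refine sum_mem fun σ _ => ?_
  rw [map_smul]
  by_cases hσ : σ ∈ Q
  · exact Submodule.smul_mem _ _ (h σ hσ)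
  · rw [hx σ hσ, zero_smul]; exact zero_mem _

end Carrier

section Realization

variable {V : Type} [Fintype V]

/-- The points of the standard simplex supported in `σ`. -/
def simplexFace (σ : Finset V) : Set (V → ℝ) :=
  {x | (∀ v, 0 ≤ x v) ∧ ∑ v, x v = 1 ∧ ∀ v, v ∉ σ → x v = 0}

lemma simplexFace_mono {σ τ : Finset V} (h : σ ⊆ τ) : simplexFace σ ⊆ simplexFace τ :=
  fun _ hx => ⟨hx.1, hx.2.1, fun v hv => hx.2.2 v fun h' => hv (h h')⟩

lemma convex_simplexFace (σ : Finset V) : Convex ℝ (simplexFace σ) := by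
  intro x hx y hy a b ha hb hab
  refine ⟨fun v => ?_, ?_, fun v hv => ?_⟩
  · have h1 := hx.1 v
    have h2 := hy.1 v
    simp only [Pi.add_apply, Pi.smul_apply, smul_eq_mul]
    positivity
  · simp only [Pi.add_apply, Pi.smul_apply, smul_eq_mul, sum_add_distrib, ← mul_sum, hx.2.1,
      hy.2.1, mul_one, hab]
  · simp [hx.2.2 v hv, hy.2.2 v hv]

lemma isCompact_simplexFace (σ : Finset V) : IsCompact (simplexFace σ) := by
  have h : simplexFace σ = stdSimplex ℝ V ∩ ⋂ v ∈ {v | v ∉ σ}, {x | x v = 0} := by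
    ext x
    simp [simplexFace, stdSimplex, and_assoc]
  rw [h]
  refine (isCompact_stdSimplex ℝ V).inter_right (isClosed_biInter fun v _ => ?_)
  exact isClosed_eq (continuous_apply v) continuous_const

lemma single_mem_simplexFace [DecidableEq V] {σ : Finset V} {v : V} (hv : v ∈ σ) :
    Pi.single v 1 ∈ simplexFace σ := by
  refine ⟨fun w => ?_, by simp, fun w hw => ?_⟩
  · rw [Pi.single_apply]; split_ifs <;> norm_num
  · rw [Pi.single_eq_of_ne]
    rintro rfl
    exact hw hv

lemma mem_realization_iff {Q : ASC V} {x : V → ℝ} :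
    x ∈ Q.realization ↔ ∃ σ ∈ Q.faces, x ∈ simplexFace σ := by
  classical
  constructor
  · rintro ⟨h1, h2, σ, hσ, h3⟩
    exact ⟨σ, hσ, h1, h2, fun v hv => by_contra fun h => hv ((h3 v).mp h)⟩
  · rintro ⟨σ, hσ, h1, h2, h3⟩
    refine ⟨h1, h2, ({v | x v ≠ 0} : Finset V), Q.down_closed hσ fun v hv => ?_, fun v => by simp⟩
    by_contra h
    simp [h3 v h] at hv

lemma mem_faces_of_mem_realization {Q : ASC V} {x : V → ℝ} (hx : x ∈ Q.realization)
    {τ : Finset V} (hτ : ∀ v ∈ τ, x v ≠ 0) : τ ∈ Q.faces := by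
  obtain ⟨_, _, σ, hσ, h⟩ := hx
  exact Q.down_closed hσ fun v hv => (h v).mp (hτ v hv)

lemma realization_eq_biUnion (Q : ASC V) :
    Q.realization = ⋃ σ ∈ Q.faces, simplexFace σ := by
  ext x
  simp [mem_realization_iff]

lemma isCompact_realization (Q : ASC V) : IsCompact Q.realization := by
  rw [realization_eq_biUnion]
  exact (Set.toFinite _).isCompact_biUnion fun σ _ => isCompact_simplexFace σ

lemma exists_card_inv_le {x : V → ℝ} (hx : ∑ v, x v = 1) :
    ∃ v, ((Fintype.card V : ℝ))⁻¹ ≤ x v := by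
  have hne : Nonempty V := by
    by_contra h
    rw [not_nonempty_iff] at h
    simp at hx
  by_contra! h
  have h1 : ∑ v, x v < ∑ _v : V, ((Fintype.card V : ℝ))⁻¹ :=
    sum_lt_sum_of_nonempty univ_nonempty fun v _ => h v
  rw [hx, sum_const, card_univ, nsmul_eq_mul, mul_inv_cancel₀ (by simp)] at h1
  exact lt_irrefl _ h1

end Realization

section Contraction

/-- A contraction of a compact set can be cut into finitely many small steps. -/
lemma exists_discrete_contraction {X : Type*} [MetricSpace X] {R : Set X} (hR : IsCompact R)
    (h : ContractibleSpace R) {ε : ℝ} (hε : 0 < ε) :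
    ∃ c ∈ R, ∃ δ > 0, ∃ N : ℕ, ∃ F : ℕ → X → X, (∀ x, F 0 x = x) ∧ (∀ x, F N x = c) ∧
      (∀ i, ∀ x ∈ R, F i x ∈ R) ∧ ∀ i < N, ∀ x ∈ R, ∀ y ∈ R, dist x y < δ →
        dist (F i x) (F i y) < ε ∧ dist (F i x) (F (i + 1) y) < ε := by
  classical
  have : CompactSpace R := isCompact_iff_compactSpace.mp hR
  obtain ⟨c, ⟨H⟩⟩ := id_nullhomotopic R
  have hu : UniformContinuous H := CompactSpace.uniformContinuous_of_continuous H.continuous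
  obtain ⟨δ, hδ, hH⟩ := Metric.uniformContinuous_iff.mp hu ε hε
  obtain ⟨N, hN⟩ := exists_nat_one_div_lt hδ
  have hN0 : (0 : ℝ) < N + 1 := by positivity
  let t : ℕ → unitInterval := fun i => Set.projIcc 0 1 zero_le_one ((i : ℝ) / (N + 1))
  have ht : ∀ i, dist (t i) (t (i + 1)) < δ := fun i => by
    refine lt_of_le_of_lt ?_ hN
    have h1 := (LipschitzWith.projIcc (zero_le_one (α := ℝ))).dist_le_mul
      ((i : ℝ) / (N + 1)) (((i + 1 : ℕ) : ℝ) / (N + 1))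
    refine h1.trans (le_of_eq ?_)
    rw [NNReal.coe_one, one_mul, Real.dist_eq, ← sub_div, abs_div, abs_of_pos hN0]
    simp
  refine ⟨c, c.2, δ, hδ, N + 1, fun i x => if hx : x ∈ R then H (t i, ⟨x, hx⟩) else
    if i = 0 then x else c, fun x => ?_, fun x => ?_, fun i x hx => ?_,
    fun i hi x hx y hy hxy => ?_⟩
  · have h0 : t 0 = 0 := by
      simp only [t, Nat.cast_zero, zero_div]
      exact Set.projIcc_left _
    beta_reduce
    by_cases hx : x ∈ R
    · rw [dif_pos hx, h0, H.apply_zero]; rfl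
    · rw [dif_neg hx, if_pos rfl]
  · have h1 : t (N + 1) = 1 := by
      simp only [t]
      rw [Nat.cast_add, Nat.cast_one, div_self hN0.ne']
      exact Set.projIcc_right _
    beta_reduce
    by_cases hx : x ∈ R
    · rw [dif_pos hx, h1, H.apply_one]; rfl
    · rw [dif_neg hx, if_neg (by omega)]
  · beta_reduce
    rw [dif_pos hx]
    exact Subtype.coe_prop _
  · beta_reduce
    rw [dif_pos hx, dif_pos hy, dif_pos hy]
    constructor
    · refine hH (a := (t i, ⟨x, hx⟩)) (b := (t i, ⟨y, hy⟩)) ?_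
      rw [Prod.dist_eq, dist_self]
      exact max_lt hδ hxy
    · refine hH (a := (t i, ⟨x, hx⟩)) (b := (t (i + 1), ⟨y, hy⟩)) ?_
      rw [Prod.dist_eq]
      exact max_lt (ht i) hxy

variable (K : Type*) [Field K] {X : Type*} [NormedAddCommGroup X]

/-- The chains of lists of points of `A` of diameter smaller than `δ`. -/
def smallLists (A : Set X) (δ : ℝ) : Submodule K (List X →₀ K) :=
  Finsupp.supported K K {l | (∀ x ∈ l, x ∈ A) ∧ ∀ x ∈ l, ∀ y ∈ l, dist x y < δ}

lemma smallLists_mono {A B : Set X} (h : A ⊆ B) (δ : ℝ) :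
    smallLists K A δ ≤ smallLists K B δ :=
  Finsupp.supported_mono fun _ hl => ⟨fun x hx => h (hl.1 x hx), hl.2⟩

variable [NormedSpace ℝ X]

/-- Small chains of lists in a nonempty convex set are acyclic. -/
lemma exists_listBd_eq_of_convex {A : Set X} (hA : Convex ℝ A) (hne : A.Nonempty) {δ : ℝ}
    (hδ : 0 < δ) {z : List X →₀ K} (hz : z ∈ smallLists K A δ) (hz0 : listBd K z = 0) :
    ∃ y ∈ smallLists K A δ, listBd K y = z := by
  obtain ⟨c, hc⟩ := hne
  have hN : ∀ᶠ N : ℕ in Filter.atTop, ∀ l ∈ z.support, ∀ x ∈ {x | x ∈ l}, ∀ y ∈ {x | x ∈ l},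
      dist x y + dist y c / N < δ := by
    rw [Filter.eventually_all_finset]
    intro l hl
    rw [Filter.eventually_all_finite (List.finite_toSet l)]
    intro x hx
    rw [Filter.eventually_all_finite (List.finite_toSet l)]
    intro y hy
    have h1 : Filter.Tendsto (fun N : ℕ => dist x y + dist y c / N) Filter.atTop
        (nhds (dist x y + 0)) :=
      tendsto_const_nhds.add (tendsto_const_div_atTop_nhds_zero_nat _)
    refine h1.eventually_lt_const ?_
    rw [add_zero]
    exact (hz hl).2 x hx y hy
  obtain ⟨N, hN, hN0⟩ := (hN.and (Filter.eventually_gt_atTop 0)).exists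
  have hN1 : (0 : ℝ) < N := by exact_mod_cast hN0
  let f : ℕ → X → X := fun i x => x + ((i : ℝ) / N) • (c - x)
  have hf0 : f 0 = id := by ext x; simp [f]
  have hfA : ∀ i ≤ N, ∀ x ∈ A, f i x ∈ A := fun i hi x hx =>
    hA.add_smul_sub_mem hx hc ⟨by positivity, div_le_one_of_le₀ (by exact_mod_cast hi) hN1.le⟩
  have hd : ∀ i ≤ N, ∀ x y, dist (f i x) (f i y) ≤ dist x y := fun i hi x y => by
    have h1 : f i x - f i y = (1 - (i : ℝ) / N) • (x - y) := by simp only [f]; module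
    have h2 : (i : ℝ) / N ≤ 1 := div_le_one_of_le₀ (by exact_mod_cast hi) hN1.le
    have h3 : 0 ≤ (i : ℝ) / N := by positivity
    rw [dist_eq_norm, h1, norm_smul, dist_eq_norm, Real.norm_of_nonneg (by linarith)]
    exact mul_le_of_le_one_left (norm_nonneg _) (by linarith)
  have hs : ∀ i y, dist (f i y) (f (i + 1) y) = dist y c / N := fun i y => by
    have h1 : f i y - f (i + 1) y = (1 / (N : ℝ)) • (y - c) := by
      simp only [f, Nat.cast_add, Nat.cast_one, add_div]; module
    rw [dist_eq_norm, h1, norm_smul, dist_eq_norm, Real.norm_of_nonneg (by positivity)]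
    ring
  have hmain := (listCone K X).exists_D_eq_chainMap (E := smallLists K A δ) f N c
    (fun x => by simp [f, hN1.ne']) (Finsupp.supported_mono fun l hl => ?_) hz0
    fun l hl i hi => ⟨{y | ∃ x ∈ l, y = f i x ∨ y = f (i + 1) x},
      fun x hx => ⟨⟨x, hx, Or.inl rfl⟩, x, hx, Or.inr rfl⟩,
      Finsupp.supported_mono fun l' hl' => ⟨fun y hy => ?_, fun y hy y' hy' => ?_⟩⟩
  · rwa [hf0, listCone_chainMap_id] at hmain
  · refine ⟨fun x hx => by rw [hl x hx]; exact hc, fun x hx y hy => ?_⟩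
    rw [hl x hx, hl y hy, dist_self]
    exact hδ
  · obtain ⟨x, hx, rfl | rfl⟩ := hl' y hy
    · exact hfA i hi.le x ((hz hl).1 x hx)
    · exact hfA (i + 1) hi x ((hz hl).1 x hx)
  · have key : ∀ x ∈ l, ∀ x' ∈ l, dist (f i x) (f (i + 1) x') < δ := fun x hx x' hx' =>
      calc dist (f i x) (f (i + 1) x') ≤ dist (f i x) (f i x') + dist (f i x') (f (i + 1) x') :=
            dist_triangle _ _ _
        _ ≤ dist x x' + dist x' c / N := add_le_add (hd i hi.le x x') (hs i x').le
        _ < δ := hN l hl x hx x' hx'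
    obtain ⟨x, hx, rfl | rfl⟩ := hl' y hy <;> obtain ⟨x', hx', rfl | rfl⟩ := hl' y' hy'
    · exact (hd i hi.le x x').trans_lt ((hz hl).2 x hx x' hx')
    · exact key x hx x' hx'
    · rw [dist_comm]; exact key x' hx' x hx
    · exact (hd (i + 1) hi x x').trans_lt ((hz hl).2 x hx x' hx')

end Contraction

section Acyclic

variable (K : Type*) [Field K] {V : Type} [LinearOrder V] [Fintype V]

/-- A simplicial complex with contractible realization is acyclic. -/
theorem acyclic_of_contractibleSpace (Q : ASC V) (h : ContractibleSpace Q.realization) :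
    Acyclic (bd K) Q.faces := by
  have hlow : IsLowerSet Q.faces := fun σ τ h1 h2 => Q.down_closed h2 h1
  obtain ⟨x₀, hx₀⟩ : Q.realization.Nonempty := Set.nonempty_coe_sort.mp inferInstance
  obtain ⟨v₀, -⟩ := exists_card_inv_le hx₀.2.1
  have hV : Nonempty V := ⟨v₀⟩
  have hcard : (0 : ℝ) < (Fintype.card V : ℝ)⁻¹ := by
    have := Fintype.card_pos (α := V)
    positivity
  obtain ⟨c, hc, δ, hδ, N, F, hF0, hFN, hFR, hF⟩ :=
    exists_discrete_contraction (isCompact_realization Q) h hcard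
  have hr : ∀ x ∈ Q.realization, ∃ v, (Fintype.card V : ℝ)⁻¹ ≤ x v :=
    fun x hx => exists_card_inv_le hx.2.1
  choose! r hr using hr
  have hrσ : ∀ σ ∈ Q.faces, ∀ x ∈ simplexFace σ, r x ∈ σ := fun σ hσ x hx => by
    by_contra hn
    have h1 := hr x (mem_realization_iff.mpr ⟨σ, hσ, hx⟩)
    rw [hx.2.2 _ hn] at h1
    exact h1.not_gt hcard
  obtain ⟨θ, hθ0, hθ⟩ := exists_of_carrier (K := K) hlow (listBd K) 0 1
    (fun σ => smallLists K (simplexFace σ) δ)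
    (fun σ τ hστ => smallLists_mono K (simplexFace_mono hστ) δ)
    (fun σ hσ hne x hx hx0 => exists_listBd_eq_of_convex K (convex_simplexFace σ)
      ⟨_, single_mem_simplexFace hne.choose_spec⟩ hδ hx hx0)
    (fun σ _ => zero_mem _) (fun σ _ => by simp) (Finsupp.single [] 1)
    (Finsupp.single_mem_supported K 1 (by simp)) (by rw [listBd_nil]; simp)
  have hDθ : ∀ σ ∈ Q.faces, listBd K (θ (Pi.single σ 1)) = θ (bd K (Pi.single σ 1)) :=
    fun σ hσ => by rw [(hθ σ hσ).2]; simp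
  let C := finsetCone K V
  obtain ⟨g, -, hg⟩ := exists_of_carrier (K := K) hlow (bd K)
    (LinearMap.id - C.chainMap r ∘ₗ θ) (-1) (fun σ => supp K {τ | τ ⊆ σ})
    (fun σ τ hστ => supp_mono fun ρ (hρ : ρ ⊆ σ) => hρ.trans hστ)
    (fun σ hσ hne x hx hx0 => by
      obtain ⟨v, hv⟩ := hne
      refine ⟨cone K v x, cone_mem_supp (fun ρ (hρ : ρ ⊆ σ) => insert_subset hv hρ) hx, ?_⟩
      rw [bd_cone, hx0, map_zero, sub_zero])
    (fun σ hσ => by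
      refine sub_mem (single_mem_supp (Subset.refl σ) 1) (C.chainMap_mem _ _ fun l hl => ?_)
      refine supp_mono ?_ (C.listMap_mem (S := ↑σ) r l fun x hx =>
        hrσ σ hσ x (((hθ σ hσ).1 hl).1 x hx))
      exact fun ρ hρ => Finset.coe_subset.mp hρ)
    (fun σ hσ => by
      simp only [LinearMap.sub_apply, LinearMap.id_apply, LinearMap.comp_apply, map_sub, neg_smul,
        one_smul, neg_neg]
      rw [← hDθ σ hσ, ← C.D_chainMap]
      rfl)
    0 (zero_mem _) (by
      rw [map_zero, LinearMap.sub_apply, LinearMap.comp_apply, hθ0, C.chainMap_single]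
      exact (sub_self _).symm)
  intro z hz hz0
  have hz1 : bd K (g z) = z - C.chainMap r (θ z) := by
    have h1 := eqOn_supp (f := bd K ∘ₗ g)
      (g := LinearMap.id - C.chainMap r ∘ₗ θ - g ∘ₗ bd K) (fun σ hσ => by
        rw [LinearMap.comp_apply, (hg σ hσ).2, neg_smul, one_smul, ← sub_eq_add_neg]; rfl) hz
    rw [LinearMap.comp_apply, LinearMap.sub_apply, LinearMap.comp_apply g, hz0, map_zero,
      sub_zero] at h1
    exact h1
  have hgz : g z ∈ supp K Q.faces := map_mem_of_supp (fun σ hσ =>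
    supp_mono (fun ρ (hρ : ρ ⊆ σ) => hlow hρ hσ) (hg σ hσ).1) hz
  have hθz : θ z ∈ smallLists K Q.realization δ := map_mem_of_supp (fun σ hσ =>
    smallLists_mono K (fun x hx => mem_realization_iff.mpr ⟨σ, hσ, hx⟩) δ (hθ σ hσ).1) hz
  have hθz0 : listBd K (θ z) = 0 := by
    have h1 := eqOn_supp (f := listBd K ∘ₗ θ) (g := θ ∘ₗ bd K) hDθ hz
    rw [LinearMap.comp_apply, LinearMap.comp_apply, hz0, map_zero] at h1
    exact h1
  have hW : ∀ x ∈ Q.realization, C.W {v | x v ≠ 0} ≤ supp K Q.faces := fun x hx =>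
    supp_mono fun ρ hρ => mem_faces_of_mem_realization hx fun v hv => hρ hv
  obtain ⟨y, hy, hyz⟩ := C.exists_D_eq_chainMap (E := supp K Q.faces) (fun i => r ∘ F i) N (r c)
    (fun x => by rw [Function.comp_apply, hFN])
    (le_trans (supp_mono fun ρ hρ => hρ.trans (Set.singleton_subset_iff.mpr
      (hcard.trans_le (hr c hc)).ne')) (hW c hc)) hθz0 fun l hl i hi => by
    obtain ⟨x₁, hx₁, hx₁l⟩ : ∃ x₁ ∈ Q.realization, ∀ x ∈ l, x ∈ Q.realization ∧ dist x₁ x < δ := by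
      rcases l with _ | ⟨x₁, l⟩
      · exact ⟨c, hc, by simp⟩
      · exact ⟨x₁, (hθz hl).1 x₁ (by simp), fun x hx => ⟨(hθz hl).1 x hx,
          (hθz hl).2 x₁ (by simp) x hx⟩⟩
    refine ⟨_, fun x hx => ?_, hW _ (hFR i x₁ hx₁)⟩
    have key : ∀ y ∈ Q.realization, dist (F i x₁) y < (Fintype.card V : ℝ)⁻¹ →
        F i x₁ (r y) ≠ 0 := fun y hy hd h0 => by
      have h1 := (dist_le_pi_dist (F i x₁) y (r y)).trans_lt hd
      rw [h0, Real.dist_eq, zero_sub, abs_neg] at h1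
      exact ((le_abs_self _).trans_lt h1).not_ge (hr y hy)
    have h1 := hF i hi x₁ hx₁ x (hx₁l x hx).1 (hx₁l x hx).2
    exact ⟨key _ (hFR i x (hx₁l x hx).1) h1.1, key _ (hFR (i + 1) x (hx₁l x hx).1) h1.2⟩
  refine ⟨g z + y, add_mem hgz hy, ?_⟩
  have hf0 : r ∘ F 0 = r := by ext x; rw [Function.comp_apply, hF0]
  rw [hf0] at hyz
  have hyz' : bd K y = C.chainMap r (θ z) := hyz
  rw [map_add, hz1, hyz', sub_add_cancel]

end Acyclic

section Spheres

lemma contractibleSpace_of_leftInverse {X Y : Type*} [TopologicalSpace X] [TopologicalSpace Y]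
    [ContractibleSpace X] (i : C(Y, X)) (r : C(X, Y)) (h : ∀ y, r (i y) = y) :
    ContractibleSpace Y := by
  rw [contractible_iff_id_nullhomotopic]
  have h1 : ContinuousMap.id Y = (r.comp (ContinuousMap.id X)).comp i := by
    ext y; exact (h y).symm
  rw [h1]
  exact ((id_nullhomotopic X).comp_right r).comp_left i

variable {E : Type*} [NormedAddCommGroup E] [InnerProductSpace ℝ E]

lemma contractibleSpace_sphere_compl_singleton (v : Metric.sphere (0 : E) 1) :
    ContractibleSpace ({v}ᶜ : Set (Metric.sphere (0 : E) 1)) := by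
  have hv : ‖(v : E)‖ = 1 := by simp
  let e := stereographic hv
  have h1 : e.source = {v}ᶜ := stereographic_source hv
  have h2 : e.target = Set.univ := stereographic_target hv
  rw [← h1]
  exact (e.toHomeomorphSourceTarget.trans
    ((Homeomorph.setCongr h2).trans (Homeomorph.Set.univ _))).contractibleSpace

lemma nullhomotopic_of_forall_ne {X : Type*} [TopologicalSpace X]
    (g : C(X, Metric.sphere (0 : E) 1)) (v : Metric.sphere (0 : E) 1) (hv : ∀ x, g x ≠ v) :
    g.Nullhomotopic := by
  have := contractibleSpace_sphere_compl_singleton v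
  let g' : C(X, ({v}ᶜ : Set (Metric.sphere (0 : E) 1))) := ⟨fun x => ⟨g x, hv x⟩, by fun_prop⟩
  have h1 : g = (ContinuousMap.comp ⟨Subtype.val, continuous_subtype_val⟩
    (ContinuousMap.id _)).comp g' := rfl
  rw [h1]
  exact ((id_nullhomotopic _).comp_right _).comp_left _

/-- A map from a closed subset of a Euclidean space is close to the restriction of a smooth map. -/
lemma exists_contDiff_dist_lt {E F : Type*} [NormedAddCommGroup E] [NormedSpace ℝ E]
    [FiniteDimensional ℝ E] [NormedAddCommGroup F] [NormedSpace ℝ F] [FiniteDimensional ℝ F]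
    {A : Set E} (hA : IsClosed A) (g : C(A, F)) {δ : ℝ} (hδ : 0 < δ) :
    ∃ p : E → F, ContDiff ℝ 1 p ∧ ∀ x : A, dist (p x) (g x) < δ := by
  have : TietzeExtension F := TietzeExtension.of_tvs ℝ
  obtain ⟨G, hG⟩ := g.exists_restrict_eq hA
  obtain ⟨p, hp, hpG, -⟩ := G.continuous.exists_contDiff_approx 1 (ε := fun _ => δ)
    continuous_const fun _ => hδ
  refine ⟨p, hp, fun x => ?_⟩
  rw [← hG]
  exact hpG x

variable {F : Type*} [NormedAddCommGroup F] [NormedSpace ℝ F] [FiniteDimensional ℝ F]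
  [FiniteDimensional ℝ E]

/-- Maps into a sphere from a closed set of smaller Hausdorff dimension are nullhomotopic. -/
lemma nullhomotopic_of_dimH_lt {A : Set F} (hA : IsClosed A)
    (hdim : dimH A < dimH (Metric.sphere (0 : E) 1)) (g : C(A, Metric.sphere (0 : E) 1)) :
    g.Nullhomotopic := by
  obtain ⟨p, hp, hpg⟩ := exists_contDiff_dist_lt hA
    (ContinuousMap.comp ⟨Subtype.val, continuous_subtype_val⟩ g) (zero_lt_one)
  simp only [ContinuousMap.comp_apply, ContinuousMap.coe_mk] at hpg
  have hne : ∀ (t : unitInterval) (x : A), (g x : E) + (t : ℝ) • (p x - g x) ≠ 0 := fun t x h0 => by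
    have h1 : ‖(g x : E)‖ = 1 := by simp
    have h2 : (g x : E) = -((t : ℝ) • (p x - g x)) := eq_neg_of_add_eq_zero_left h0
    rw [h2, norm_neg, norm_smul, Real.norm_of_nonneg t.2.1] at h1
    have h3 := hpg x
    rw [dist_eq_norm] at h3
    have h4 := mul_le_of_le_one_left (norm_nonneg (p x - g x)) t.2.2
    linarith
  have hpc := hp.continuous
  let H : unitInterval × A → Metric.sphere (0 : E) 1 := fun q =>
    ⟨‖(g q.2 : E) + (q.1 : ℝ) • (p q.2 - g q.2)‖⁻¹ •
      ((g q.2 : E) + (q.1 : ℝ) • (p q.2 - g q.2)), by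
      rw [mem_sphere_zero_iff_norm, norm_smul, norm_inv, norm_norm,
        inv_mul_cancel₀ (norm_ne_zero_iff.mpr (hne q.1 q.2))]⟩
  have hH : Continuous H := by
    refine Continuous.subtype_mk (Continuous.smul (Continuous.inv₀ (by fun_prop) fun q => ?_)
      (by fun_prop)) _
    exact norm_ne_zero_iff.mpr (hne q.1 q.2)
  let g' : C(A, Metric.sphere (0 : E) 1) := ⟨fun x => H (1, x), by fun_prop⟩
  have hgg' : g.Homotopic g' := ⟨⟨⟨H, hH⟩, fun x => by ext; simp [H], fun x => rfl⟩⟩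
  obtain ⟨v, hv, hv'⟩ : ∃ v ∈ Metric.sphere (0 : E) 1, v ∉ (fun x => ‖p x‖⁻¹ • p x) '' A := by
    by_contra! hc
    refine hdim.not_ge ((dimH_mono hc).trans ?_)
    refine dimH_image_le_of_locally_lipschitzOn fun x hx => ?_
    have hpx : p x ≠ 0 := by simpa using hne 1 ⟨x, hx⟩
    have hcd : ContDiffAt ℝ 1 (fun x => ‖p x‖⁻¹ • p x) x :=
      ((hp.contDiffAt.norm ℝ hpx).inv (norm_ne_zero_iff.mpr hpx)).smul hp.contDiffAt
    obtain ⟨C, t, ht, hC⟩ := hcd.exists_lipschitzOnWith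
    exact ⟨C, t, mem_nhdsWithin_of_mem_nhds ht, hC⟩
  obtain ⟨c, hc⟩ := nullhomotopic_of_forall_ne g' ⟨v, hv⟩ fun x h => hv' ⟨x, x.2, by
    simpa [g', H, ← smul_add] using congrArg Subtype.val h⟩
  exact ⟨c, hgg'.trans hc⟩

lemma dimH_sphere_le {n : ℕ} (hn : Module.finrank ℝ E = n + 1) :
    dimH (Metric.sphere (0 : E) 1) ≤ n := by
  have : Nontrivial E := Module.nontrivial_of_finrank_eq_succ hn
  have : Fact (Module.finrank ℝ E = n + 1) := ⟨hn⟩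
  obtain ⟨v, hv⟩ := exists_norm_eq E (zero_le_one (α := ℝ))
  have hsub : Metric.sphere (0 : E) 1 ⊆
      {v} ∪ Set.range fun w : (Submodule.span ℝ {v})ᗮ => stereoInvFunAux v (w : E) := by
    intro x hx
    by_cases hxv : x = v
    · exact Or.inl hxv
    · refine Or.inr ⟨stereoToFun v x, ?_⟩
      exact congrArg Subtype.val (stereo_left_inv hv (x := ⟨x, hx⟩) hxv)
  refine (dimH_mono hsub).trans ?_
  rw [dimH_union, dimH_singleton, max_eq_right zero_le]
  have hfr : Module.finrank ℝ (Submodule.span ℝ {v})ᗮ = n :=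
    Submodule.finrank_orthogonal_span_singleton (norm_ne_zero_iff.mp (hv ▸ one_ne_zero))
  rw [← hfr]
  have hcd : ContDiff ℝ 1 fun w : (Submodule.span ℝ {v})ᗮ => stereoInvFunAux v (w : E) :=
    contDiff_stereoInvFunAux.comp (Submodule.subtypeL (Submodule.span ℝ {v})ᗮ).contDiff
  exact hcd.dimH_range_le

lemma le_dimH_sphere (n : ℕ) :
    n ≤ dimH (Metric.sphere (0 : EuclideanSpace ℝ (Fin (n + 1))) 1) := by
  let q : EuclideanSpace ℝ (Fin (n + 1)) → (Fin n → ℝ) := fun x i => x i.succ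
  have hq : ContDiff ℝ 1 q := contDiff_pi.mpr fun i => by fun_prop
  have hU : IsOpen {y : Fin n → ℝ | ∑ i, y i ^ 2 < 1} :=
    isOpen_lt (by fun_prop) continuous_const
  have hsub : {y : Fin n → ℝ | ∑ i, y i ^ 2 < 1} ⊆ q '' Metric.sphere 0 1 := by
    intro y hy
    rw [Set.mem_ofPred_eq] at hy
    refine ⟨WithLp.toLp 2 (Fin.cons (√(1 - ∑ i, y i ^ 2)) y), ?_, ?_⟩
    · rw [mem_sphere_zero_iff_norm, EuclideanSpace.norm_eq, Fin.sum_univ_succ]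
      simp [Real.sq_sqrt (sub_nonneg.mpr hy.le)]
    · ext i; simp [q]
  calc (n : ENNReal) = dimH {y : Fin n → ℝ | ∑ i, y i ^ 2 < 1} := by
        rw [Real.dimH_of_nonempty_interior, Module.finrank_fin_fun]
        rw [hU.interior_eq]
        exact ⟨0, by simp⟩
    _ ≤ dimH (q '' Metric.sphere 0 1) := dimH_mono hsub
    _ ≤ _ := hq.contDiffOn.dimH_image_le convex_univ (Set.subset_univ _)

end Spheres

variable {V : Type} [Fintype V]

section Dimension

lemma dimH_simplexFace_le (σ : Finset V) (n : ℕ) (hσ : #σ ≤ n + 1) :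
    dimH (simplexFace σ) ≤ n := by
  classical
  rcases (simplexFace σ).eq_empty_or_nonempty with h | h
  · simp [h]
  obtain ⟨x₀, hx₀⟩ := h
  obtain ⟨v₀, hv₀⟩ : σ.Nonempty := by
    rw [nonempty_iff_ne_empty]
    rintro rfl
    have h1 := hx₀.2.1
    simp [hx₀.2.2] at h1
  let q : ({v // v ∈ σ.erase v₀} → ℝ) → (V → ℝ) := fun y v =>
    if h : v ∈ σ.erase v₀ then y ⟨v, h⟩ else if v = v₀ then 1 - ∑ w, y w else 0
  have hq : ContDiff ℝ 1 q := contDiff_pi.mpr fun v => by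
    by_cases h : v ∈ σ.erase v₀
    · simp only [q, dif_pos h]; fun_prop
    · simp only [q, dif_neg h]
      split_ifs <;> fun_prop
  have hsub : simplexFace σ ⊆ Set.range q := by
    intro x hx
    refine ⟨fun w => x w, ?_⟩
    ext v
    simp only [q]
    split_ifs with h1 h2
    · rfl
    · subst h2
      rw [sub_eq_iff_eq_add, ← hx.2.1, ← sum_subset (subset_univ σ) fun w _ hw => hx.2.2 w hw,
        ← add_sum_erase σ x hv₀, sum_coe_sort (σ.erase v) x]
    · refine (hx.2.2 v fun h => h1 (mem_erase.mpr ⟨h2, h⟩)).symm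
  refine (dimH_mono hsub).trans (hq.dimH_range_le.trans ?_)
  rw [Module.finrank_fintype_fun_eq_card, Fintype.card_coe, card_erase_of_mem hv₀]
  exact_mod_cast (by omega)

lemma le_dimH_simplexFace (σ : Finset V) (n : ℕ) (hσ : #σ = n + 1) :
    n ≤ dimH (simplexFace σ) := by
  classical
  obtain ⟨v₀, hv₀⟩ : σ.Nonempty := card_pos.mp (by omega)
  let q : (V → ℝ) → ({v // v ∈ σ.erase v₀} → ℝ) := fun x v => x v
  have hq : ContDiff ℝ 1 q := contDiff_pi.mpr fun i => by fun_prop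
  have hU : IsOpen {y : {v // v ∈ σ.erase v₀} → ℝ | (∀ v, 0 < y v) ∧ ∑ v, y v < 1} := by
    have h1 : Continuous fun y : {v // v ∈ σ.erase v₀} → ℝ => ∑ v, y v := by fun_prop
    refine IsOpen.and ?_ (isOpen_lt h1 continuous_const)
    rw [Set.ofPred_forall]
    exact isOpen_iInter_of_finite fun v => isOpen_lt continuous_const (continuous_apply v)
  have hsub : {y : {v // v ∈ σ.erase v₀} → ℝ | (∀ v, 0 < y v) ∧ ∑ v, y v < 1} ⊆
      q '' simplexFace σ := by
    rintro y ⟨hy0, hy1⟩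
    let x : V → ℝ := fun v => if h : v ∈ σ.erase v₀ then y ⟨v, h⟩ else
      if v = v₀ then 1 - ∑ w, y w else 0
    have hxy : ∀ w : {v // v ∈ σ.erase v₀}, x w = y w := fun w => by simp only [x, dif_pos w.2]
    have hxσ : ∀ v, v ∉ σ → x v = 0 := fun v hv => by
      simp only [x]
      rw [dif_neg fun h => hv (mem_of_mem_erase h), if_neg (by rintro rfl; exact hv hv₀)]
    refine ⟨x, ⟨fun v => ?_, ?_, hxσ⟩, ?_⟩
    · simp only [x]
      split_ifs
      · exact (hy0 _).le
      · linarith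
      · exact le_rfl
    · rw [← sum_subset (subset_univ σ) fun w _ hw => hxσ w hw, ← add_sum_erase σ x hv₀,
        ← sum_coe_sort (σ.erase v₀) x, sum_congr rfl fun w _ => hxy w]
      simp [x]
    · ext w; exact hxy w
  have hcard : Fintype.card {v // v ∈ σ.erase v₀} = n := by
    rw [Fintype.card_coe, card_erase_of_mem hv₀]; omega
  calc (n : ENNReal) = dimH {y : {v // v ∈ σ.erase v₀} → ℝ | (∀ v, 0 < y v) ∧ ∑ v, y v < 1} := by
        rw [Real.dimH_of_nonempty_interior, Module.finrank_fintype_fun_eq_card, hcard]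
        rw [hU.interior_eq]
        refine ⟨fun _ => 1 / (n + 1), fun _ => by positivity, ?_⟩
        rw [sum_const, card_univ, hcard, nsmul_eq_mul, mul_one_div, div_lt_one (by positivity)]
        linarith
    _ ≤ dimH (q '' simplexFace σ) := dimH_mono hsub
    _ ≤ _ := hq.contDiffOn.dimH_image_le convex_univ (Set.subset_univ _)

lemma dimH_realization_le (P : ASC V) (n : ℕ) (h : ∀ σ ∈ P.faces, #σ ≤ n + 1) :
    dimH P.realization ≤ n := by
  rw [realization_eq_biUnion, dimH_bUnion (Set.to_countable _)]
  exact iSup₂_le fun σ hσ => dimH_simplexFace_le σ n (h σ hσ)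

variable {F : Type*} [NormedAddCommGroup F] [NormedSpace ℝ F] [FiniteDimensional ℝ F]

/-- Maps into the realization of a complex from a closed set of smaller Hausdorff dimension than
some face are homotopic to nonsurjective maps. -/
lemma exists_homotopic_forall_ne (P : ASC V) {σ : Finset V} (hσ : σ ∈ P.faces) {A : Set F}
    (hA : IsClosed A) (hdim : dimH A < dimH (simplexFace σ)) (g : C(A, P.realization)) :
    ∃ g' : C(A, P.realization), g.Homotopic g' ∧ ∃ b, ∀ x, g' x ≠ b := by
  have hne : (simplexFace σ).Nonempty := by
    rw [Set.nonempty_iff_ne_empty]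
    intro h
    simp [h] at hdim
  obtain ⟨x₀, hx₀⟩ := hne
  obtain ⟨v₀, -⟩ := exists_card_inv_le hx₀.2.1
  have hV : Nonempty V := ⟨v₀⟩
  have hcard : (0 : ℝ) < (Fintype.card V : ℝ)⁻¹ := by
    have := Fintype.card_pos (α := V)
    positivity
  set δ : ℝ := (Fintype.card V : ℝ)⁻¹ / 3 with hδ
  have hδ0 : 0 < δ := by positivity
  obtain ⟨p, hp, hpg⟩ := exists_contDiff_dist_lt hA
    (ContinuousMap.comp ⟨Subtype.val, continuous_subtype_val⟩ g) hδ0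
  simp only [ContinuousMap.comp_apply, ContinuousMap.coe_mk] at hpg
  have hpg' : ∀ (x : A) v, |p x v - (g x : V → ℝ) v| < δ := fun x v =>
    (dist_le_pi_dist (p x) (g x) v).trans_lt (hpg x)
  let c : (V → ℝ) → (V → ℝ) := fun y v => max (y v - δ) 0
  have hc : LipschitzWith 1 c := by
    refine LipschitzWith.of_dist_le_mul fun y z => ?_
    rw [NNReal.coe_one, one_mul, dist_pi_le_iff dist_nonneg]
    intro v
    refine le_trans ?_ (dist_le_pi_dist y z v)
    rw [Real.dist_eq, Real.dist_eq]
    refine (abs_max_sub_max_le_abs _ _ _).trans (le_of_eq ?_)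
    ring_nf
  have hcc : Continuous c := hc.continuous
  have hc0 : ∀ y v, 0 ≤ c y v := fun y v => le_max_right _ _
  have hs : ∀ x : A, 0 < ∑ v, c (p x) v := fun x => by
    obtain ⟨v, hv⟩ := exists_card_inv_le (g x).2.2.1
    refine sum_pos' (fun v _ => hc0 _ v) ⟨v, mem_univ v, lt_max_of_lt_left ?_⟩
    have h1 := (abs_lt.mp (hpg' x v)).1
    have h2 : (Fintype.card V : ℝ)⁻¹ = 3 * δ := by rw [hδ]; ring
    linarith
  let N : (V → ℝ) → (V → ℝ) := fun y => (∑ v, y v)⁻¹ • y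
  have hN : ContDiffOn ℝ 1 N {y | 0 < ∑ v, y v} := by
    have h1 : ContDiff ℝ 1 fun y : V → ℝ => ∑ v, y v := by fun_prop
    exact (h1.contDiffOn.inv fun y hy => ne_of_gt hy).smul contDiff_id.contDiffOn
  have hNconv : Convex ℝ {y : V → ℝ | 0 < ∑ v, y v} := by
    intro x hx y hy a b ha hb hab
    simp only [Set.mem_ofPred_eq, Pi.add_apply, Pi.smul_apply, smul_eq_mul, sum_add_distrib,
      ← mul_sum] at hx hy ⊢
    rcases ha.eq_or_lt with rfl | ha
    · rw [zero_add] at hab; subst hab; simpa using hy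
    · have := mul_nonneg hb hy.le
      have := mul_pos ha hx
      linarith
  have hface : ∀ x : A, ∃ τ ∈ P.faces, (g x : V → ℝ) ∈ simplexFace τ ∧
      N (c (p x)) ∈ simplexFace τ := fun x => by
    obtain ⟨τ, hτ, hgτ⟩ := mem_realization_iff.mp (g x).2
    refine ⟨τ, hτ, hgτ, fun v => mul_nonneg (inv_nonneg.mpr (hs x).le) (hc0 _ v), ?_,
      fun v hv => ?_⟩
    · simp only [N, Pi.smul_apply, smul_eq_mul, ← mul_sum]
      exact inv_mul_cancel₀ (hs x).ne'
    · have h1 := (abs_lt.mp (hpg' x v)).2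
      rw [hgτ.2.2 v hv, sub_zero] at h1
      have h2 : c (p x) v = 0 := max_eq_right (by linarith)
      simp only [N, Pi.smul_apply, h2, smul_zero]
  have hpc := hp.continuous
  have hNc : Continuous fun x : A => N (c (p x)) := by
    refine Continuous.smul (Continuous.inv₀ (by fun_prop) fun x => (hs x).ne') (by fun_prop)
  let H : unitInterval × A → P.realization := fun q =>
    ⟨(g q.2 : V → ℝ) + (q.1 : ℝ) • (N (c (p q.2)) - g q.2), by
      obtain ⟨τ, hτ, h1, h2⟩ := hface q.2
      exact mem_realization_iff.mpr ⟨τ, hτ, (convex_simplexFace τ).add_smul_sub_mem h1 h2 q.1.2⟩⟩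
  have hH : Continuous H := by
    refine Continuous.subtype_mk ?_ _
    have h1 := hNc.comp (continuous_snd (X := unitInterval))
    have h2 : Continuous fun q : unitInterval × A => (g q.2 : V → ℝ) := by fun_prop
    have h3 : Continuous fun q : unitInterval × A => (q.1 : ℝ) := by fun_prop
    exact h2.add (h3.smul (h1.sub h2))
  let g' : C(A, P.realization) := ⟨fun x => H (1, x), by fun_prop⟩
  refine ⟨g', ⟨⟨⟨H, hH⟩, fun x => by ext; simp [H], fun x => rfl⟩⟩, ?_⟩
  obtain ⟨b, hb, hb'⟩ : ∃ b ∈ simplexFace σ, b ∉ (fun x => N (c (p x))) '' A := by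
    by_contra! hcon
    refine hdim.not_ge ((dimH_mono hcon).trans ?_)
    have h1 : (fun x => N (c (p x))) '' A = N '' (c '' (p '' A)) := by
      rw [Set.image_image, Set.image_image]
    rw [h1]
    refine (hN.dimH_image_le hNconv ?_).trans ((hc.dimH_image_le _).trans
      (hp.contDiffOn.dimH_image_le convex_univ (Set.subset_univ _)))
    rintro _ ⟨_, ⟨x, hx, rfl⟩, rfl⟩
    exact hs ⟨x, hx⟩
  refine ⟨⟨b, mem_realization_iff.mpr ⟨σ, hσ, hb⟩⟩, fun x h => hb' ⟨x, x.2, ?_⟩⟩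
  simpa [g', H] using congrArg Subtype.val h

/-- The dimension of a noncontractible complex whose realization is a sphere. -/
lemma card_eq_of_homeomorph_sphere (P : ASC V) {d : ℕ}
    (f : P.realization ≃ₜ Metric.sphere (0 : EuclideanSpace ℝ (Fin d)) 1)
    (hnc : ¬ ContractibleSpace P.realization) {σ : Finset V} (hσ : σ ∈ P.faces)
    (hmax : ∀ τ ∈ P.faces, #τ ≤ #σ) : #σ = d := by
  classical
  rcases d with _ | d
  · by_contra h
    obtain ⟨v, hv⟩ : σ.Nonempty := card_pos.mp (by omega)
    have h1 := (f ⟨_, mem_realization_iff.mpr ⟨σ, hσ, single_mem_simplexFace hv⟩⟩).2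
    rw [mem_sphere_zero_iff_norm, Subsingleton.elim (Subtype.val _) 0, norm_zero] at h1
    exact zero_ne_one h1
  obtain ⟨n, hn⟩ : ∃ n, #σ = n + 1 := by
    obtain ⟨y, hy⟩ : ∃ y : EuclideanSpace ℝ (Fin (d + 1)), ‖y‖ = 1 :=
      exists_norm_eq _ zero_le_one
    obtain ⟨x, hx⟩ := f.symm ⟨y, by simpa using hy⟩
    obtain ⟨τ, hτ, h1⟩ := mem_realization_iff.mp hx
    refine ⟨#σ - 1, (Nat.sub_add_cancel ((card_pos.mpr ?_).trans_le (hmax τ hτ))).symm⟩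
    rw [nonempty_iff_ne_empty]
    rintro rfl
    have h2 := h1.2.1
    simp [h1.2.2] at h2
  have hfinrank : Module.finrank ℝ (EuclideanSpace ℝ (Fin (d + 1))) = d + 1 := by simp
  rw [hn, Nat.add_right_cancel_iff]
  let f₁ : C(P.realization, Metric.sphere (0 : EuclideanSpace ℝ (Fin (d + 1))) 1) := f
  let f₂ : C(Metric.sphere (0 : EuclideanSpace ℝ (Fin (d + 1))) 1, P.realization) := f.symm
  rcases lt_trichotomy n d with h | h | h
  · refine absurd ?_ hnc
    have h1 : f₁.Nullhomotopic := nullhomotopic_of_dimH_lt (isCompact_realization P).isClosed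
      ((dimH_realization_le P n fun τ hτ => (hmax τ hτ).trans hn.le).trans_lt
        (lt_of_lt_of_le (by exact_mod_cast h) (le_dimH_sphere d))) f₁
    rw [contractible_iff_id_nullhomotopic]
    have h2 : ContinuousMap.id P.realization = f₂.comp f₁ := by
      ext x; simp [f₁, f₂]
    rw [h2]
    exact h1.comp_right f₂
  · exact h
  · refine absurd ?_ hnc
    obtain ⟨g', hg', b, hb⟩ := exists_homotopic_forall_ne P hσ Metric.isClosed_sphere
      ((dimH_sphere_le hfinrank).trans_lt (lt_of_lt_of_le (by exact_mod_cast h)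
        (le_dimH_simplexFace σ n hn))) f₂
    obtain ⟨y, hy⟩ := nullhomotopic_of_forall_ne (f₁.comp g') (f b) fun x hx =>
      hb x (f.injective hx)
    have h2 : ContinuousMap.id _ = f₁.comp f₂ := by
      ext x : 1; simp [f₁, f₂]
    have h3 : ContractibleSpace (Metric.sphere (0 : EuclideanSpace ℝ (Fin (d + 1))) 1) := by
      rw [contractible_iff_id_nullhomotopic, h2]
      exact ⟨y, (ContinuousMap.Homotopic.comp (ContinuousMap.Homotopic.refl f₁) hg').trans hy⟩
    exact f.contractibleSpace

end Dimension

section Deletion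

/-- The deletion of a face. -/
def deletion (P : ASC V) (σ : Finset V) : ASC V where
  faces := {τ | τ ∈ P.faces ∧ ¬ σ ⊆ τ}
  down_closed _ _ h hsub := ⟨P.down_closed h.1 hsub, fun h' => h.2 (h'.trans hsub)⟩

/-- The realization of the deletion of a face is a retract of the complement of the barycenter. -/
lemma contractibleSpace_deletion (P : ASC V) {σ : Finset V} (hσ : σ ∈ P.faces) (hne : σ.Nonempty)
    (h : ∀ b : P.realization, ContractibleSpace ({b}ᶜ : Set P.realization)) :
    ContractibleSpace (deletion P σ).realization := by
  classical
  have hσ0 : (0 : ℝ) < #σ := by exact_mod_cast hne.card_pos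
  let b : V → ℝ := fun v => if v ∈ σ then (#σ : ℝ)⁻¹ else 0
  have hbσ : b ∈ simplexFace σ := by
    refine ⟨fun v => ?_, ?_, fun v hv => if_neg hv⟩
    · simp only [b]; split_ifs <;> positivity
    · simp only [b]
      rw [sum_ite_mem, univ_inter, sum_const, nsmul_eq_mul, mul_inv_cancel₀ hσ0.ne']
  let b' : P.realization := ⟨b, mem_realization_iff.mpr ⟨σ, hσ, hbσ⟩⟩
  have hb := h b'
  let μ : (V → ℝ) → ℝ := fun x => σ.inf' hne x
  have hμc : Continuous μ := Continuous.finset_inf'_apply hne fun v _ => continuous_apply v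
  have hμle : ∀ x, ∀ v ∈ σ, μ x ≤ x v := fun x v hv => inf'_le x hv
  have hμ0 : ∀ x ∈ P.realization, 0 ≤ μ x := fun x hx => le_inf' hne x fun v _ => hx.1 v
  have hσsum : ∀ x ∈ P.realization, ∑ v ∈ σ, x v ≤ 1 := fun x hx =>
    (sum_le_univ_sum_of_nonneg hx.1).trans hx.2.1.le
  have hμσ : ∀ x, #σ * μ x ≤ ∑ v ∈ σ, x v := fun x => by
    rw [← nsmul_eq_mul]
    exact card_nsmul_le_sum σ x _ (hμle x)
  have hden : ∀ x ∈ P.realization, x ≠ b → 0 < 1 - #σ * μ x := fun x hx hxb => by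
    rcases ((hμσ x).trans (hσsum x hx)).lt_or_eq with h1 | h1
    · linarith
    refine absurd ?_ hxb
    have h2 : ∑ v ∈ σ, x v = 1 := le_antisymm (hσsum x hx) (h1 ▸ hμσ x)
    have h3 : μ x = (#σ : ℝ)⁻¹ := eq_inv_of_mul_eq_one_right h1
    ext v
    simp only [b]
    split_ifs with hv
    · have h4 : ∑ v ∈ σ, (x v - μ x) = 0 := by
        rw [sum_sub_distrib, h2, sum_const, nsmul_eq_mul, h1, sub_self]
      rw [sum_eq_zero_iff_of_nonneg fun v hv => sub_nonneg.mpr (hμle x v hv)] at h4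
      rw [← h3]
      exact sub_eq_zero.mp (h4 v hv)
    · have h4 : ∑ v ∈ σᶜ, x v = 0 := by
        have := sum_add_sum_compl σ x
        rw [hx.2.1, h2] at this
        linarith
      rw [sum_eq_zero_iff_of_nonneg fun v _ => hx.1 v] at h4
      exact h4 v (mem_compl.mpr hv)
  let ρ : (V → ℝ) → (V → ℝ) := fun x v => (1 - #σ * μ x)⁻¹ * (x v - if v ∈ σ then μ x else 0)
  have hρ : ∀ x ∈ P.realization, x ≠ b → ρ x ∈ (deletion P σ).realization := fun x hx hxb => by
    obtain ⟨v, hv, hxv⟩ := exists_mem_eq_inf' hne x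
    obtain ⟨τ, hτ, hxτ⟩ := mem_realization_iff.mp hx
    have hd := hden x hx hxb
    refine mem_realization_iff.mpr ⟨τ.filter fun w => ρ x w ≠ 0,
      ⟨P.down_closed hτ (filter_subset _ _), fun hsub => ?_⟩, fun w => ?_, ?_, fun w hw => ?_⟩
    · have h1 := (mem_filter.mp (hsub hv)).2
      refine h1 ?_
      simp only [ρ, if_pos hv]
      rw [show x v = μ x from hxv.symm, sub_self, mul_zero]
    · refine mul_nonneg (inv_nonneg.mpr hd.le) (sub_nonneg.mpr ?_)
      split_ifs with hw
      · exact hμle x w hw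
      · exact hx.1 w
    · simp only [ρ]
      rw [← mul_sum, sum_sub_distrib, hx.2.1, sum_ite_mem, univ_inter, sum_const, nsmul_eq_mul,
        inv_mul_cancel₀ hd.ne']
    · by_contra h0
      refine hw (mem_filter.mpr ⟨?_, h0⟩)
      by_contra hwτ
      refine h0 ?_
      have h1 := hxτ.2.2 w hwτ
      simp only [ρ]
      rw [h1]
      split_ifs with hwσ
      · have h2 : μ x = 0 := le_antisymm (h1 ▸ hμle x w hwσ) (hμ0 x hx)
        rw [h2, sub_self, mul_zero]
      · rw [sub_self, mul_zero]
  have hsub : (deletion P σ).realization ⊆ P.realization := fun x hx => by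
    obtain ⟨τ, hτ, hxτ⟩ := mem_realization_iff.mp hx
    exact mem_realization_iff.mpr ⟨τ, hτ.1, hxτ⟩
  have hμdel : ∀ x ∈ (deletion P σ).realization, μ x = 0 := fun x hx => by
    obtain ⟨τ, hτ, hxτ⟩ := mem_realization_iff.mp hx
    obtain ⟨v, hv, hvτ⟩ := not_subset.mp hτ.2
    exact le_antisymm (hxτ.2.2 v hvτ ▸ hμle x v hv) (hμ0 x (hsub hx))
  have hbdel : ∀ x ∈ (deletion P σ).realization, x ≠ b := fun x hx hxb => by
    have h1 := hμdel x hx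
    obtain ⟨v, hv, hxv⟩ := exists_mem_eq_inf' hne x
    have h2 : x v = 0 := by rw [← h1]; exact hxv.symm
    rw [hxb] at h2
    simp only [b, if_pos hv] at h2
    exact hσ0.ne' (inv_eq_zero.mp h2)
  let i : C((deletion P σ).realization, ({b'}ᶜ : Set P.realization)) :=
    ⟨fun x => ⟨⟨x, hsub x.2⟩, fun h1 => hbdel x x.2 (congrArg Subtype.val h1)⟩, by fun_prop⟩
  let r : C(({b'}ᶜ : Set P.realization), (deletion P σ).realization) :=
    ⟨fun x => ⟨ρ x, hρ x x.1.2 fun h1 => x.2 (Subtype.ext h1)⟩, by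
      refine Continuous.subtype_mk (continuous_pi fun v => ?_) _
      have h1 : Continuous fun x : ({b'}ᶜ : Set P.realization) => μ (x : V → ℝ) := by fun_prop
      have h2 : Continuous fun x : ({b'}ᶜ : Set P.realization) => (x : V → ℝ) v :=
        (continuous_apply v).comp (continuous_subtype_val.comp continuous_subtype_val)
      refine Continuous.mul (Continuous.inv₀ (by fun_prop) fun x =>
        (hden x x.1.2 fun h1 => x.2 (Subtype.ext h1)).ne') (h2.sub ?_)
      split_ifs
      · exact h1
      · exact continuous_const⟩
  refine contractibleSpace_of_leftInverse i r fun x => ?_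
  ext v
  have h1 := hμdel x x.2
  simp [i, r, ρ, h1]

end Deletion

variable [LinearOrder V] (K : Type) [Field K]

/-- A proper deletion of a face of a triangulated sphere is acyclic. -/
lemma acyclic_deletion (P : ASC V) {E : Type*} [NormedAddCommGroup E] [InnerProductSpace ℝ E]
    (f : P.realization ≃ₜ Metric.sphere (0 : E) 1) (σ : Finset V) (hσ : σ ∈ P.faces) :
    Acyclic (bd K) (deletion P σ).faces := by
  rcases σ.eq_empty_or_nonempty with rfl | hne
  · have h : (deletion P ∅).faces = ∅ :=
      Set.eq_empty_of_forall_notMem fun τ hτ => hτ.2 (empty_subset τ)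
    rw [h]
    exact acyclic_empty _
  · refine acyclic_of_contractibleSpace K _ (contractibleSpace_deletion P hσ hne fun b => ?_)
    have h := contractibleSpace_sphere_compl_singleton (f b)
    have himg : f '' {b}ᶜ = {f b}ᶜ := by
      rw [Set.image_compl_eq f.bijective, Set.image_singleton]
    exact ((f.image {b}ᶜ).trans (Homeomorph.setCongr himg)).contractibleSpace

lemma not_acyclic_of_maximal {P : Set (Finset V)} (hP : IsLowerSet P) {σ : Finset V} (hσ : σ ∈ P)
    (hmax : ∀ τ ∈ P, σ ⊆ τ → τ = σ) (hdel : Acyclic (bd K) {τ | τ ∈ P ∧ ¬ σ ⊆ τ}) :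
    ¬ Acyclic (bd K) P := by
  intro hac
  obtain ⟨w, hw, hw'⟩ := hdel (bd K (Pi.single σ 1)) (by
    rw [bd_single]
    refine sum_mem fun v hv => single_mem_supp (Γ := {τ | τ ∈ P ∧ ¬ σ ⊆ τ})
      ⟨hP (erase_subset v σ) hσ, fun h => ?_⟩ _
    exact notMem_erase v σ (h hv)) (bd_bd K _)
  obtain ⟨y, hy, hy'⟩ := hac (Pi.single σ 1 - w)
    (sub_mem (single_mem_supp hσ 1) (supp_mono (fun τ hτ => hτ.1) hw)) (by
      rw [map_sub, hw', sub_self])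
  have h1 := congrFun hy' σ
  rw [Pi.sub_apply, Pi.single_eq_same, hw σ fun h => h.2 subset_rfl, sub_zero, bd_apply,
    sum_eq_zero fun v hv => ?_] at h1
  · exact zero_ne_one h1
  · rw [hy _ fun h => ?_, mul_zero]
    have h2 := hmax _ h (subset_insert v σ)
    exact (mem_compl.mp hv) (h2 ▸ mem_insert_self v σ)

lemma subsingleton_hom_empty {Γ : Set (Finset V)} (hΓ : Γ = ∅) (j : ℤ) :
    Subsingleton (Hom K Γ j) := by
  have : Subsingleton ↥(cyc (bd K) Γ ⊓ homog K cardDeg j) := ⟨fun x y => by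
    have h0 : ∀ z : ↥(cyc (bd K) Γ ⊓ homog K cardDeg j), z.1 = 0 := fun z =>
      funext fun a => z.2.1.1 a (by rw [hΓ]; exact Set.notMem_empty a)
    exact Subtype.ext ((h0 x).trans (h0 y).symm)⟩
  exact (Submodule.mkQ_surjective _).subsingleton

end FinsetChain

/-- Theorem 1.1(c): let `P` be a simplicial complex with `‖P‖ ≅ S^{d-1}`, let `I ⊆ V` be a union
of minimal non-faces of `P`, let `J 1, …, J m` be all the minimal non-faces of `P` contained in
`I`, and let `Λ_I` be the simplicial complex on `{1, …, m}` whose faces are the subsets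
`L ⊆ {1, …, m}` with `⋃_{k ∈ L} J k ≠ I`.  Then for every integer `i ≥ 1`,
`H̃_{d-1-i}(P_{≤Î}; K) ≅ H̃_{|I|-i-2}(Λ_I; K)`. -/
theorem remnant_cohomology {V : Type} [Fintype V] [LinearOrder V]
    (K : Type) [Field K] (d : ℕ) (P : ASC V)
    (hP : Nonempty (↥(ASC.realization P) ≃ₜ
      ↥(Metric.sphere (0 : EuclideanSpace ℝ (Fin d)) 1)))
    (I : Finset V) (hI : P.memUSR I)
    (m : ℕ) (J : Fin m → Finset V)
    (hJ : ∀ t, (∃ k, J k = t) ↔ (P.IsMinimalNonFace t ∧ t ⊆ I))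
    (Λ : ASC (Fin m)) (hΛ : Λ.faces = {L : Finset (Fin m) | L.sup J ≠ I})
    (i : ℤ) (hi : 1 ≤ i) :
    Nonempty (ASC.reducedHomology K (P.restrict Iᶜ) ((d : ℤ) - 1 - i) ≃ₗ[K]
      ASC.reducedHomology K Λ ((I.card : ℤ) - i - 2)) := by
  obtain ⟨f⟩ := hP
  obtain ⟨e₁⟩ := FinsetChain.nonempty_reducedHomology_equiv K (P.restrict Iᶜ)
    ((d : ℤ) - 1 - i) (d - i) (by ring)
  obtain ⟨e₂⟩ := FinsetChain.nonempty_reducedHomology_equiv K Λ ((I.card : ℤ) - i - 2)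
    (I.card - i - 1) (by ring)
  obtain ⟨S, hSne, hS, hIS⟩ := hI
  suffices h : Nonempty (FinsetChain.Hom K (P.restrict Iᶜ).faces (d - i) ≃ₗ[K]
      FinsetChain.Hom K Λ.faces (I.card - i - 1)) by
    obtain ⟨e⟩ := h
    exact ⟨e₁.trans (e.trans e₂.symm)⟩
  have hlow : IsLowerSet P.faces := fun σ τ h1 h2 => P.down_closed h2 h1
  by_cases hvoid : P.faces = ∅
  · have hS' : ∀ t ∈ S, t = ∅ := fun t ht => by
      by_contra hne
      have h1 := (hS t ht).2 ∅ (empty_ssubset.mpr (nonempty_iff_ne_empty.mpr hne))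
      rw [hvoid] at h1
      exact h1
    have hI0 : I = ∅ := by
      rw [hIS, ← bot_eq_empty, Finset.sup_eq_bot_iff]
      exact hS'
    have h1 : (P.restrict Iᶜ).faces = ∅ := Set.eq_empty_of_forall_notMem fun τ hτ => by
      have := hτ.1
      rw [hvoid] at this
      exact this
    have h2 : Λ.faces = ∅ := Set.eq_empty_of_forall_notMem fun L hL => by
      rw [hΛ] at hL
      refine hL ?_
      rw [hI0, ← bot_eq_empty, Finset.sup_eq_bot_iff]
      exact fun k _ => subset_empty.mp (hI0 ▸ ((hJ (J k)).mp ⟨k, rfl⟩).2)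
    have := FinsetChain.subsingleton_hom_empty K h1 (d - i)
    have := FinsetChain.subsingleton_hom_empty K h2 (I.card - i - 1)
    exact ⟨LinearEquiv.ofSubsingleton _ _⟩
  · obtain ⟨σ, hσ, hmax⟩ := (Set.toFinite P.faces).exists_maximalFor Finset.card _
      (Set.nonempty_iff_ne_empty.mpr hvoid)
    have hmax' : ∀ τ ∈ P.faces, #τ ≤ #σ := fun τ hτ => (le_total #σ #τ).elim (hmax hτ) id
    have hfacet : ∀ τ ∈ P.faces, σ ⊆ τ → τ = σ := fun τ hτ h =>
      (eq_of_subset_of_card_le h (hmax' τ hτ)).symm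
    have hdel := FinsetChain.acyclic_deletion K P f
    have hcard : #σ = d := FinsetChain.card_eq_of_homeomorph_sphere P f (fun hc =>
      FinsetChain.not_acyclic_of_maximal K hlow hσ hfacet (hdel σ hσ)
        (FinsetChain.acyclic_of_contractibleSpace K P hc)) hσ hmax'
    have hIP : I ∉ P.faces := fun h => by
      obtain ⟨t, ht⟩ := hSne
      exact (hS t ht).1 (P.down_closed h (hIS ▸ Finset.le_sup (f := id) ht))
    have h1 : (P.restrict Iᶜ).faces = {τ | τ ∈ P.faces ∧ Disjoint τ I} := by
      ext τ
      exact and_congr_right fun _ => subset_compl_iff_disjoint_right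
    rw [h1, hΛ]
    exact FinsetChain.nonempty_hom_equiv hlow hσ hfacet hdel hJ hIP _ _
      (by rw [hcard]; ring)
end

section
/- Let Γ be a nonempty abstract simplicial complex on a finite vertex set, let τ_1, …, τ_m be its maximal faces, and let K be a field. Let N be the nerve of the family {τ_1, …, τ_m}, i.e., the abstract simplicial complex on the vertex set {1, …, m} given by N = {L ⊆ {1,…,m} : ∩_{k∈L} τ_k ≠ ∅}. Then for every integer j there is an isomorphism of K-vector spaces H̃_j(Γ; K) ≅ H̃_j(N; K). -/
open Finset

namespace ASC

section SimplexChains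

variable (K : Type) [Field K] {W : Type} [LinearOrder W]

/-- The sign with which the vertex `v` enters the boundary of a simplex whose remaining
vertices are those of `ρ`. -/
def vertexSign (v : W) (ρ : Finset W) : K :=
  (-1) ^ (ρ.filter (fun w => w < v)).card

variable {K}

theorem vertexSign_mul_self (v : W) (ρ : Finset W) :
    vertexSign K v ρ * vertexSign K v ρ = 1 := by
  rw [vertexSign, ← pow_add, ← two_mul, pow_mul]
  simp

theorem vertexSign_insert_self (v : W) (ρ : Finset W) :
    vertexSign K v (insert v ρ) = vertexSign K v ρ := by
  simp [vertexSign, Finset.filter_insert]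

theorem vertexSign_erase_self (v : W) (ρ : Finset W) :
    vertexSign K v (ρ.erase v) = vertexSign K v ρ := by
  rw [← vertexSign_insert_self v (ρ.erase v), ← vertexSign_insert_self v ρ]
  congr 1
  ext w
  by_cases h : w = v <;> simp [h]

theorem vertexSign_insert_of_lt {u v : W} {ρ : Finset W} (hu : u ∉ ρ) (h : u < v) :
    vertexSign K v (insert u ρ) = -vertexSign K v ρ := by
  simp [vertexSign, Finset.filter_insert, h, hu, pow_succ]

theorem vertexSign_insert_of_gt {u v : W} {ρ : Finset W} (h : v < u) :
    vertexSign K v (insert u ρ) = vertexSign K v ρ := by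
  simp [vertexSign, Finset.filter_insert, h.not_gt]

variable [Fintype W]

variable (K W) in
/-- The boundary map of the full simplex on `W`, in all degrees at once, with chains written as
functions on the set of faces. -/
def simplexBoundary : (Finset W → K) →ₗ[K] (Finset W → K) where
  toFun f ρ := ∑ v ∈ ρᶜ, vertexSign K v ρ * f (insert v ρ)
  map_add' f g := by
    ext ρ
    simp [mul_add, Finset.sum_add_distrib]
  map_smul' c f := by
    ext ρ
    simp [Finset.mul_sum, mul_left_comm]

theorem simplexBoundary_apply (f : Finset W → K) (ρ : Finset W) :
    simplexBoundary K W f ρ = ∑ v ∈ ρᶜ, vertexSign K v ρ * f (insert v ρ) := rfl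

theorem simplexBoundary_simplexBoundary (f : Finset W → K) :
    simplexBoundary K W (simplexBoundary K W f) = 0 := by
  ext ρ
  simp only [simplexBoundary_apply, Finset.mul_sum, Pi.zero_apply]
  rw [Finset.sum_sigma']
  refine Finset.sum_involution (fun p _ => ⟨p.2, p.1⟩) ?_ ?_ ?_ ?_
  · rintro ⟨v, u⟩ h
    simp only [Finset.mem_sigma, Finset.mem_compl, Finset.mem_insert, not_or] at h
    obtain ⟨hv, huv, hu⟩ := h
    rw [Finset.insert_comm v u]
    rcases lt_or_gt_of_ne huv with h | h
    · rw [vertexSign_insert_of_lt hu h, vertexSign_insert_of_gt h]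
      ring
    · rw [vertexSign_insert_of_lt hv h, vertexSign_insert_of_gt h]
      ring
  · rintro ⟨v, u⟩ h _ heq
    simp only [Finset.mem_sigma, Finset.mem_compl, Finset.mem_insert, not_or] at h
    simp only [Sigma.mk.injEq] at heq
    exact h.2.1 heq.1
  · rintro ⟨v, u⟩ h
    simp only [Finset.mem_sigma, Finset.mem_compl, Finset.mem_insert, not_or] at h ⊢
    exact ⟨h.2.2, Ne.symm h.2.1, h.1⟩
  · rintro ⟨v, u⟩ _
    rfl

omit [Fintype W] in
/-- The operator of coning off a chain of the full simplex with apex `a`. -/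
def coneOp (a : W) (f : Finset W → K) (ρ : Finset W) : K :=
  if a ∈ ρ then vertexSign K a ρ * f (ρ.erase a) else 0

theorem simplexBoundary_coneOp_add (a : W) (f : Finset W → K) (ρ : Finset W) :
    simplexBoundary K W (coneOp a f) ρ + coneOp a (simplexBoundary K W f) ρ = f ρ := by
  by_cases ha : a ∈ ρ
  · obtain ⟨π, haπ, rfl⟩ : ∃ π, a ∉ π ∧ insert a π = ρ :=
      ⟨ρ.erase a, Finset.notMem_erase a ρ, Finset.insert_erase ha⟩
    have hc : πᶜ = insert a (insert a π)ᶜ := by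
      ext w
      by_cases h : w = a <;> simp [h, haπ]
    simp only [coneOp, simplexBoundary_apply, ha, if_true, Finset.erase_insert haπ]
    rw [hc, Finset.sum_insert (by simp), mul_add, ← mul_assoc, vertexSign_insert_self,
      vertexSign_mul_self, one_mul, add_left_comm, add_eq_left, Finset.mul_sum,
      ← Finset.sum_add_distrib]
    refine Finset.sum_eq_zero fun v hv => ?_
    simp only [Finset.mem_compl, Finset.mem_insert, not_or] at hv
    obtain ⟨hva, hv⟩ := hv
    rw [if_pos (by simp), Finset.insert_comm v a, vertexSign_insert_self,
      Finset.erase_insert (by simp [haπ, Ne.symm hva])]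
    rcases lt_or_gt_of_ne hva with h | h
    · rw [vertexSign_insert_of_lt hv h, vertexSign_insert_of_gt h]
      ring
    · rw [vertexSign_insert_of_lt haπ h, vertexSign_insert_of_gt h]
      ring
  · rw [coneOp, if_neg ha, add_zero, simplexBoundary_apply,
      Finset.sum_eq_single_of_mem a (by simpa using ha)]
    · rw [coneOp, if_pos (by simp), vertexSign_insert_self, ← mul_assoc, vertexSign_mul_self,
        one_mul, Finset.erase_insert ha]
    · intro v _ hva
      rw [coneOp, if_neg (by simp [ha, Ne.symm hva]), mul_zero]

variable (K) in
omit [Fintype W] [LinearOrder W] in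
/-- The `j`-chains of `X`, as functions on all subsets of the vertex set. -/
def supportedChains (X : ASC W) (j : ℤ) : Submodule K (Finset W → K) where
  carrier := {f | ∀ ρ, f ρ ≠ 0 → ρ ∈ X.faces ∧ (ρ.card : ℤ) = j + 1}
  zero_mem' ρ h := absurd rfl h
  add_mem' := by
    intro f g hf hg ρ h
    by_cases hfρ : f ρ = 0
    · exact hg ρ fun hgρ => h (by simp [hfρ, hgρ])
    · exact hf ρ hfρ
  smul_mem' := by
    intro c f hf ρ h
    exact hf ρ fun hfρ => h (by simp [hfρ])

theorem simplexBoundary_mem {X : ASC W} {j k : ℤ} (hk : k + 1 = j) {f : Finset W → K}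
    (hf : f ∈ supportedChains K X j) : simplexBoundary K W f ∈ supportedChains K X k := by
  intro ρ h
  obtain ⟨v, hv, hne⟩ := Finset.exists_ne_zero_of_sum_ne_zero h
  obtain ⟨h1, h2⟩ := hf _ (right_ne_zero_of_mul hne)
  rw [Finset.card_insert_of_notMem (by simpa using hv)] at h2
  exact ⟨X.down_closed h1 (Finset.subset_insert _ _), by push_cast at h2; omega⟩

/-- If coning off with an apex outside `B`, depending only on the part in `B`, preserves the
faces of `X` that meet `B`, then the chains of `X` modulo those avoiding `B` are acyclic. -/
theorem exists_sub_simplexBoundary_avoiding {X : ASC W} {B : Finset W} {a : Finset W → W}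
    (haB : ∀ S, a S ∉ B)
    (ha : ∀ ρ ∈ X.faces, (ρ ∩ B).Nonempty → insert (a (ρ ∩ B)) ρ ∈ X.faces) (j : ℤ) (n : ℕ)
    {f : Finset W → K} (hf : f ∈ supportedChains K X j)
    (hn : ∀ ρ, f ρ ≠ 0 → (ρ ∩ B).card ≤ n)
    (hd : ∀ ρ, (ρ ∩ B).Nonempty → simplexBoundary K W f ρ = 0) :
    ∃ b ∈ supportedChains K X (j + 1),
      ∀ ρ, (ρ ∩ B).Nonempty → (f - simplexBoundary K W b) ρ = 0 := by
  induction n generalizing f with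
  | zero =>
    refine ⟨0, zero_mem _, fun ρ hρ => ?_⟩
    by_contra h
    simp only [map_zero, sub_zero] at h
    exact absurd (hn ρ h) (by simpa using hρ.card_pos.ne')
  | succ n ih =>
    set c : Finset W → K := fun ρ => if (ρ ∩ B).Nonempty then coneOp (a (ρ ∩ B)) f ρ else 0
      with hc
    have herase : ∀ (ρ S : Finset W), ρ.erase (a S) ∩ B = ρ ∩ B := by
      intro ρ S
      rw [Finset.erase_inter, Finset.erase_eq_of_notMem]
      exact fun h => haB S (Finset.mem_inter.mp h).2
    have hcX : c ∈ supportedChains K X (j + 1) := by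
      intro ρ h
      simp only [hc, coneOp, ne_eq, ite_eq_right_iff, Classical.not_imp] at h
      obtain ⟨hne, hmem, h⟩ := h
      obtain ⟨h1, h2⟩ := hf _ (right_ne_zero_of_mul h)
      have h3 := ha _ h1 (by rwa [herase])
      rw [herase, Finset.insert_erase hmem] at h3
      have h4 := Finset.card_erase_add_one hmem
      exact ⟨h3, by omega⟩
    have hdc : ∀ ρ, (ρ ∩ B).card = n + 1 → simplexBoundary K W c ρ = f ρ := by
      intro ρ hρ
      have hρ' : (ρ ∩ B).Nonempty := Finset.card_pos.mp (by omega)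
      have h0 : coneOp (a (ρ ∩ B)) (simplexBoundary K W f) ρ = 0 := by
        rw [coneOp, hd _ (by rwa [herase]), mul_zero, ite_self]
      rw [← simplexBoundary_coneOp_add (a (ρ ∩ B)) f ρ, h0, add_zero, simplexBoundary_apply,
        simplexBoundary_apply]
      refine Finset.sum_congr rfl fun v hv => ?_
      rw [Finset.mem_compl] at hv
      by_cases hvB : v ∈ B
      · have hz : ∀ S, coneOp (a S) f (insert v ρ) = 0 := by
          intro S
          have : f ((insert v ρ).erase (a S)) = 0 := by
            by_contra h
            have h1 := hn _ h
            rw [herase, Finset.insert_inter_of_mem hvB,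
              Finset.card_insert_of_notMem (by simp [hv])] at h1
            omega
          rw [coneOp, this, mul_zero, ite_self]
        simp only [hc, hz, ite_self]
      · simp only [hc, Finset.insert_inter_of_notMem hvB, if_pos hρ']
    obtain ⟨b, hb, hfb⟩ := ih (f := f - simplexBoundary K W c)
      (sub_mem hf (simplexBoundary_mem rfl hcX))
      (by
        intro ρ h
        by_contra! hlt
        have hfρ : (ρ ∩ B).card ≠ n + 1 := fun h1 => h (by simp [hdc ρ h1])
        have hbig : n + 1 < (ρ ∩ B).card := by omega
        refine h ?_
        have h1 : f ρ = 0 := by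
          by_contra h1
          exact absurd (hn ρ h1) (by omega)
        have h2 : simplexBoundary K W c ρ = 0 := by
          rw [simplexBoundary_apply]
          refine Finset.sum_eq_zero fun v _ => ?_
          have : f ((insert v ρ).erase (a (insert v ρ ∩ B))) = 0 := by
            by_contra h3
            have h4 := hn _ h3
            rw [herase] at h4
            have h5 : (ρ ∩ B).card ≤ (insert v ρ ∩ B).card :=
              Finset.card_le_card (Finset.inter_subset_inter_right (Finset.subset_insert _ _))
            omega
          simp [hc, coneOp, this]
        rw [Pi.sub_apply, h1, h2, sub_zero])
      (by
        intro ρ hρ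
        rw [map_sub, simplexBoundary_simplexBoundary, sub_zero]
        exact hd ρ hρ)
    refine ⟨c + b, add_mem hcX hb, fun ρ hρ => ?_⟩
    rw [map_add, ← sub_sub]
    exact hfb ρ hρ

variable (K) in
/-- Reduced homology computed with chains written as functions on all subsets of the vertex
set. -/
abbrev supportedHomology (X : ASC W) (j : ℤ) : Type :=
  ↥(supportedChains K X j ⊓ LinearMap.ker (simplexBoundary K W)) ⧸
    Submodule.comap (supportedChains K X j ⊓ LinearMap.ker (simplexBoundary K W)).subtype
      ((supportedChains K X (j + 1)).map (simplexBoundary K W))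

end SimplexChains

section Embedding

variable {V W : Type} [LinearOrder V] [LinearOrder W] {K : Type} [Field K]

variable (K) in
/-- The map sending a chain of `Γ` to its image under an embedding of the vertex set, as a function
on all subsets of the larger vertex set. -/
noncomputable def chainsMap (Γ : ASC V) (e : V ↪o W) (j : ℤ) :
    Chains K Γ j →ₗ[K] (Finset W → K) :=
  Finsupp.lsum K fun σ : Cells Γ j =>
    LinearMap.toSpanSingleton K (Finset W → K) (Pi.single (σ.1.map e.toEmbedding) 1)

theorem chainsMap_single (Γ : ASC V) (e : V ↪o W) (j : ℤ) (σ : Cells Γ j) (r : K) :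
    chainsMap K Γ e j (Finsupp.single σ r : Cells Γ j →₀ K) =
      r • Pi.single (σ.1.map e.toEmbedding) 1 := by
  unfold chainsMap
  erw [Finsupp.lsum_single]
  simp

theorem chainsMap_apply_map (Γ : ASC V) (e : V ↪o W) (j : ℤ) (c : Cells Γ j →₀ K)
    (σ : Cells Γ j) : chainsMap K Γ e j c (σ.1.map e.toEmbedding) = c σ := by
  induction c using Finsupp.induction_linear with
  | zero =>
    erw [map_zero]
    rfl
  | add c c' h h' =>
    erw [map_add]
    rw [Pi.add_apply, Finsupp.add_apply, h, h']
  | single σ' r =>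
    rw [chainsMap_single]
    by_cases h : σ' = σ
    · simp [h]
    · have h' : σ.1.map e.toEmbedding ≠ σ'.1.map e.toEmbedding := fun h' =>
        h (Subtype.ext (Finset.map_injective _ h').symm)
      simp [h, h']

theorem chainsMap_injective (Γ : ASC V) (e : V ↪o W) (j : ℤ) :
    Function.Injective (chainsMap K Γ e j) := by
  intro c c' h
  refine Finsupp.ext (f := c) (g := c') fun σ => ?_
  rw [← chainsMap_apply_map Γ e j c, ← chainsMap_apply_map Γ e j c', h]

theorem chainsMap_mem {Γ : ASC V} {X : ASC W} {e : V ↪o W}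
    (hX : ∀ σ, σ ∈ Γ.faces → σ.map e.toEmbedding ∈ X.faces) {j : ℤ}
    (c : Cells Γ j →₀ K) : chainsMap K Γ e j c ∈ supportedChains K X j := by
  induction c using Finsupp.induction_linear with
  | zero =>
    erw [map_zero]
    exact zero_mem _
  | add c c' h h' =>
    erw [map_add]
    exact add_mem h h'
  | single σ r =>
    rw [chainsMap_single]
    refine Submodule.smul_mem _ _ fun ρ hρ => ?_
    obtain rfl : ρ = σ.1.map e.toEmbedding := by
      by_contra h
      exact hρ (by simp [h])
    exact ⟨hX _ σ.2.1, by simpa using σ.2.2⟩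

variable [Fintype V] [Fintype W]

theorem exists_chainsMap_eq {Γ : ASC V} {X : ASC W} {e : V ↪o W}
    (hX : ∀ σ, σ.map e.toEmbedding ∈ X.faces → σ ∈ Γ.faces) {j : ℤ} {f : Finset W → K}
    (hf : f ∈ supportedChains K X j)
    (hfe : ∀ ρ, (ρ ∩ (univ.map e.toEmbedding)ᶜ).Nonempty → f ρ = 0) :
    ∃ c, chainsMap K Γ e j c = f := by
  have : Finite (Cells Γ j) := inferInstanceAs (Finite {σ : Finset V // _})
  refine ⟨Finsupp.equivFunOnFinite.symm fun σ : Cells Γ j => f (σ.1.map e.toEmbedding), ?_⟩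
  set c : Cells Γ j →₀ K :=
    Finsupp.equivFunOnFinite.symm fun σ : Cells Γ j => f (σ.1.map e.toEmbedding)
  have hc := chainsMap_mem (X := ⟨{ρ | ∃ σ ∈ Γ.faces, σ.map e.toEmbedding = ρ}, by
    rintro _ ρ ⟨σ, hσ, rfl⟩ hρ
    obtain ⟨σ', hσ', rfl⟩ := Finset.subset_map_iff.mp hρ
    exact ⟨σ', Γ.down_closed hσ hσ', rfl⟩⟩) (e := e) (fun σ hσ => ⟨σ, hσ, rfl⟩) c
  ext ρ
  by_cases h : f ρ = 0
  · by_contra hne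
    obtain ⟨⟨σ, hσ, rfl⟩, hcard⟩ := hc ρ fun h' => hne (h'.trans h.symm)
    rw [Finset.card_map] at hcard
    exact hne (chainsMap_apply_map Γ e j c ⟨σ, hσ, hcard⟩)
  · obtain ⟨h1, h2⟩ := hf ρ h
    have hsub : ρ ⊆ univ.map e.toEmbedding := by
      rw [← Finset.sdiff_eq_empty_iff_subset, Finset.sdiff_eq_inter_compl]
      exact Finset.not_nonempty_iff_eq_empty.mp fun h' => h (hfe ρ h')
    obtain ⟨σ, -, rfl⟩ := Finset.subset_map_iff.mp hsub
    rw [Finset.card_map] at h2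
    exact chainsMap_apply_map Γ e j c ⟨σ, hX σ h1, h2⟩

omit [Fintype V] [Fintype W] in
theorem vertexSign_map (e : V ↪o W) (v : V) (σ : Finset V) :
    vertexSign K (e v) (σ.map e.toEmbedding) = vertexSign K v σ := by
  rw [vertexSign, vertexSign, Finset.filter_map, Finset.card_map]
  simp

omit [Fintype V] in
theorem simplexBoundary_single (σ : Finset W) :
    simplexBoundary K W (Pi.single σ 1) =
      ∑ v ∈ σ, vertexSign K v σ • Pi.single (σ.erase v) (1 : K) := by
  ext ρ
  rw [simplexBoundary_apply, Finset.sum_apply]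
  simp only [Pi.smul_apply, smul_eq_mul, Pi.single_apply, mul_ite, mul_one, mul_zero]
  rw [← Finset.sum_filter, ← Finset.sum_filter]
  refine Finset.sum_congr ?_ ?_
  · ext v
    simp only [Finset.mem_filter, Finset.mem_compl]
    constructor
    · rintro ⟨h, rfl⟩
      exact ⟨by simp, (Finset.erase_insert h).symm⟩
    · rintro ⟨h, rfl⟩
      exact ⟨by simp, Finset.insert_erase h⟩
  · intro v hv
    rw [(Finset.mem_filter.mp hv).2, vertexSign_erase_self]

omit [Fintype V] in
theorem chainsMap_boundary (Γ : ASC V) (e : V ↪o W) (j k : ℤ) (hk : k = j - 1)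
    (c : Cells Γ j →₀ K) :
    chainsMap K Γ e k (boundary K Γ j k hk c) = simplexBoundary K W (chainsMap K Γ e j c) := by
  induction c using Finsupp.induction_linear with
  | zero =>
    erw [map_zero, map_zero]
  | add c c' h h' =>
    erw [map_add, map_add, map_add, map_add]
    exact congrArg₂ _ h h'
  | single σ r =>
    rw [chainsMap_single, map_smul, simplexBoundary_single]
    unfold boundary
    erw [Finsupp.lsum_single]
    rw [LinearMap.toSpanSingleton_apply, map_smul]
    congr 1
    rw [Finset.sum_map, ← Finset.sum_attach]
    erw [map_sum]
    refine Finset.sum_congr rfl fun v _ => ?_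
    refine (chainsMap_single Γ e k _ _).trans ?_
    rw [Finset.map_erase, RelEmbedding.coe_toEmbedding, vertexSign_map]
    rfl

/-- If `Γ` is the part of `X` on the vertices in the image of `e`, and the faces of `X` with any
given nonempty part outside this image are closed under adding some vertex of the image, then `Γ`
and `X` have the same homology. -/
theorem reducedHomology_equiv_supportedHomology {Γ : ASC V} {X : ASC W} (e : V ↪o W)
    (hX : ∀ σ, σ.map e.toEmbedding ∈ X.faces ↔ σ ∈ Γ.faces)
    (hcone : ∀ S : Finset W, S.Nonempty → ∃ v : V, ∀ ρ ∈ X.faces,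
      ρ ∩ (univ.map e.toEmbedding)ᶜ = S → insert (e v) ρ ∈ X.faces)
    [Nonempty V] (j : ℤ) :
    Nonempty (reducedHomology K Γ j ≃ₗ[K] supportedHomology K X j) := by
  have hcone' : ∀ S : Finset W, ∃ v : V, S.Nonempty → ∀ ρ ∈ X.faces,
      ρ ∩ (univ.map e.toEmbedding)ᶜ = S → insert (e v) ρ ∈ X.faces := by
    intro S
    by_cases hS : S.Nonempty
    · obtain ⟨v, hv⟩ := hcone S hS
      exact ⟨v, fun _ => hv⟩
    · exact ⟨Classical.arbitrary V, fun h => absurd h hS⟩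
  choose a ha using hcone'
  have hacyc := fun (j : ℤ) (f : Finset W → K) (hf : f ∈ supportedChains K X j) =>
    exists_sub_simplexBoundary_avoiding (B := (univ.map e.toEmbedding)ᶜ)
      (a := fun S => e (a S)) (by simp) (fun ρ hρ hne => ha _ hne ρ hρ rfl) j (Fintype.card W) hf
      (fun ρ _ => Finset.card_le_univ _)
  have havoid : ∀ (j : ℤ) (c : Chains K Γ j) (ρ : Finset W),
      (ρ ∩ (univ.map e.toEmbedding)ᶜ).Nonempty → chainsMap K Γ e j c ρ = 0 := by
    rintro j c ρ ⟨w, hw⟩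
    by_contra h
    have hmem := chainsMap_mem (X := ⟨{ρ | ρ ⊆ univ.map e.toEmbedding},
      fun _ _ h h' => h'.trans h⟩) (Γ := Γ) (e := e)
      (fun σ _ => Finset.map_subset_map.mpr (Finset.subset_univ σ)) c
    have hsub := (hmem ρ h).1
    rw [Finset.mem_inter, Finset.mem_compl] at hw
    exact hw.2 (hsub hw.1)
  have hmem : ∀ (j : ℤ) (c : Chains K Γ j), chainsMap K Γ e j c ∈ supportedChains K X j :=
    fun j c => chainsMap_mem (fun σ => (hX σ).mpr) c
  set Z := supportedChains K X j ⊓ LinearMap.ker (simplexBoundary K W)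
  let φ : ↥(LinearMap.ker (boundary K Γ j (j - 1) rfl)) →ₗ[K] ↥Z :=
    ((chainsMap K Γ e j).comp (Submodule.subtype _)).codRestrict Z (by
      rintro ⟨c, hc⟩
      refine ⟨hmem j c, ?_⟩
      rw [LinearMap.mem_ker] at hc
      refine LinearMap.mem_ker.mpr ?_
      erw [← chainsMap_boundary Γ e j (j - 1) rfl c]
      exact (congrArg _ hc).trans (map_zero _))
  let ψ := (Submodule.mkQ (Submodule.comap Z.subtype
    ((supportedChains K X (j + 1)).map (simplexBoundary K W)))).comp φ
  have hker : LinearMap.ker ψ = Submodule.comap (LinearMap.ker (boundary K Γ j (j - 1) rfl)).subtype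
      (LinearMap.range (boundary K Γ (j + 1) j (by omega))) := by
    ext ⟨c, hc⟩
    rw [LinearMap.mem_ker, LinearMap.comp_apply, Submodule.mkQ_apply, Submodule.Quotient.mk_eq_zero]
    change (∃ g ∈ supportedChains K X (j + 1), simplexBoundary K W g = chainsMap K Γ e j c) ↔
      ∃ c', boundary K Γ (j + 1) j _ c' = c
    constructor
    · rintro ⟨g, hg, hgc⟩
      obtain ⟨b, hb, hgb⟩ := hacyc (j + 1) g hg (by rw [hgc]; exact havoid j c)
      obtain ⟨c', hc'⟩ := exists_chainsMap_eq (fun σ => (hX σ).mp)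
        (sub_mem hg (simplexBoundary_mem rfl hb)) hgb
      refine ⟨c', chainsMap_injective Γ e j ?_⟩
      erw [chainsMap_boundary Γ e (j + 1) j (by omega) c']
      rw [hc', map_sub, simplexBoundary_simplexBoundary, sub_zero, hgc]
    · rintro ⟨c', rfl⟩
      exact ⟨_, hmem _ c', (chainsMap_boundary Γ e (j + 1) j (by omega) c').symm⟩
  have hsurj : Function.Surjective ψ := by
    intro q
    obtain ⟨⟨f, hf, hdf⟩, rfl⟩ := Submodule.mkQ_surjective _ q
    replace hdf : simplexBoundary K W f = 0 := hdf
    obtain ⟨b, hb, hfb⟩ := hacyc j f hf (by simp [hdf])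
    obtain ⟨c, hc⟩ := exists_chainsMap_eq (fun σ => (hX σ).mp)
      (sub_mem hf (simplexBoundary_mem rfl hb)) hfb
    have hcz : c ∈ LinearMap.ker (boundary K Γ j (j - 1) rfl) := by
      rw [LinearMap.mem_ker]
      refine chainsMap_injective Γ e (j - 1) ?_
      erw [chainsMap_boundary Γ e j (j - 1) rfl c]
      rw [hc, map_sub, simplexBoundary_simplexBoundary, hdf, sub_zero, map_zero]
    refine ⟨⟨c, hcz⟩, ?_⟩
    rw [LinearMap.comp_apply, Submodule.mkQ_apply, Submodule.mkQ_apply, eq_comm,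
      Submodule.Quotient.eq]
    refine ⟨b, hb, ?_⟩
    change simplexBoundary K W b = f - chainsMap K Γ e j c
    rw [hc, sub_sub_cancel]
  exact ⟨(Submodule.quotEquivOfEq _ _ hker.symm).trans (ψ.quotKerEquivOfSurjective hsurj)⟩

end Embedding

section Dowker

variable {V U : Type}

/-- The complex of a relation on the disjoint union of its two sides: a face consists of
a part on each side that is related to a common element of the other side, such that
the two parts are related elementwise. -/
def relationJoin (R : V → U → Prop) : ASC (V ⊕ₗ U) where
  faces := {ρ | (∃ u, ∀ v, Sum.inlₗ v ∈ ρ → R v u) ∧ (∃ v, ∀ u, Sum.inrₗ u ∈ ρ → R v u) ∧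
    ∀ v u, Sum.inlₗ v ∈ ρ → Sum.inrₗ u ∈ ρ → R v u}
  down_closed := by
    rintro ρ ρ' ⟨⟨u, hu⟩, ⟨v, hv⟩, h⟩ hsub
    exact ⟨⟨u, fun v' h' => hu v' (hsub h')⟩, ⟨v, fun u' h' => hv u' (hsub h')⟩,
      fun v' u' h1 h2 => h v' u' (hsub h1) (hsub h2)⟩

/-- **Dowker duality**: the two complexes of a relation have the same homology. -/
theorem dowker_duality [Fintype V] [LinearOrder V] [Nonempty V] [Fintype U] [LinearOrder U]
    [Nonempty U] (K : Type) [Field K] (R : V → U → Prop) (Γ : ASC V) (N : ASC U)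
    (hΓ : ∀ σ, σ ∈ Γ.faces ↔ ∃ u, ∀ v ∈ σ, R v u)
    (hN : ∀ L, L ∈ N.faces ↔ ∃ v, ∀ u ∈ L, R v u) (j : ℤ) :
    Nonempty (reducedHomology K Γ j ≃ₗ[K] reducedHomology K N j) := by
  let eV : V ↪o V ⊕ₗ U := OrderEmbedding.ofMapLEIff Sum.inlₗ fun _ _ => Sum.Lex.inl_le_inl_iff
  let eU : U ↪o V ⊕ₗ U := OrderEmbedding.ofMapLEIff Sum.inrₗ fun _ _ => Sum.Lex.inr_le_inr_iff
  have hVU : ∀ v u, (Sum.inlₗ v : V ⊕ₗ U) ≠ Sum.inrₗ u := fun v u h => Sum.inl_ne_inr h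
  have hVV : ∀ v v', (Sum.inlₗ v : V ⊕ₗ U) = Sum.inlₗ v' ↔ v = v' :=
    fun v v' => eV.injective.eq_iff
  have hUU : ∀ u u', (Sum.inrₗ u : V ⊕ₗ U) = Sum.inrₗ u' ↔ u = u' :=
    fun u u' => eU.injective.eq_iff
  have heV : ∀ v, eV.toEmbedding v = Sum.inlₗ v := fun _ => rfl
  have heU : ∀ u, eU.toEmbedding u = Sum.inrₗ u := fun _ => rfl
  obtain ⟨f⟩ := reducedHomology_equiv_supportedHomology (K := K) (Γ := Γ) (X := relationJoin R) eV
    (by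
      intro σ
      simp [relationJoin, hΓ, heV, hVV, hVU])
    (by
      intro S hS
      by_cases hv : ∃ v, ∀ u, Sum.inrₗ u ∈ S → R v u
      · obtain ⟨v, hv⟩ := hv
        refine ⟨v, ?_⟩
        rintro ρ ⟨-, -, h3⟩ rfl
        obtain ⟨w, hw⟩ := hS
        have hv' : ∀ u, Sum.inrₗ u ∈ ρ → R v u := fun u hu =>
          hv u (by simp [hu, heV, hVU])
        have hu : ∃ u, Sum.inrₗ u ∈ ρ := by
          rw [Finset.mem_inter, Finset.mem_compl] at hw
          rcases w with v' | u'
          · exact absurd (Finset.mem_map_of_mem eV.toEmbedding (Finset.mem_univ v')) hw.2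
          · exact ⟨u', hw.1⟩
        obtain ⟨u, hu⟩ := hu
        change insert (Sum.inlₗ v) ρ ∈ _
        simp only [relationJoin, Set.mem_ofPred_eq, Finset.mem_insert, hVV, (hVU _ _).symm,
          false_or]
        refine ⟨⟨u, ?_⟩, ⟨v, hv'⟩, ?_⟩
        · rintro v' (rfl | h)
          exacts [hv' u hu, h3 v' u h hu]
        · rintro v' u' (rfl | h) hu'
          exacts [hv' u' hu', h3 v' u' h hu']
      · refine ⟨Classical.arbitrary V, ?_⟩
        rintro ρ ⟨-, ⟨v, h2⟩, -⟩ rfl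
        exact absurd ⟨v, fun u hu => h2 u (Finset.mem_inter.mp hu).1⟩ hv) j
  obtain ⟨g⟩ := reducedHomology_equiv_supportedHomology (K := K) (Γ := N) (X := relationJoin R) eU
    (by
      intro σ
      simp [relationJoin, hN, heU, hUU, (hVU _ _).symm])
    (by
      intro S hS
      by_cases hu : ∃ u, ∀ v, Sum.inlₗ v ∈ S → R v u
      · obtain ⟨u, hu⟩ := hu
        refine ⟨u, ?_⟩
        rintro ρ ⟨-, -, h3⟩ rfl
        obtain ⟨w, hw⟩ := hS
        have hu' : ∀ v, Sum.inlₗ v ∈ ρ → R v u := fun v hv =>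
          hu v (by simp [hv, heU, (hVU _ _).symm])
        have hv : ∃ v, Sum.inlₗ v ∈ ρ := by
          rw [Finset.mem_inter, Finset.mem_compl] at hw
          rcases w with v' | u'
          · exact ⟨v', hw.1⟩
          · exact absurd (Finset.mem_map_of_mem eU.toEmbedding (Finset.mem_univ u')) hw.2
        obtain ⟨v, hv⟩ := hv
        change insert (Sum.inrₗ u) ρ ∈ _
        simp only [relationJoin, Set.mem_ofPred_eq, Finset.mem_insert, hUU, hVU, false_or]
        refine ⟨⟨u, hu'⟩, ⟨v, ?_⟩, ?_⟩
        · rintro u' (rfl | h)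
          exacts [hu' v hv, h3 v u' hv h]
        · rintro v' u' hv' (rfl | h)
          exacts [hu' v' hv', h3 v' u' hv' h]
      · refine ⟨Classical.arbitrary U, ?_⟩
        rintro ρ ⟨⟨u, h1⟩, -, -⟩ rfl
        exact absurd ⟨u, fun v hv => h1 v (Finset.mem_inter.mp hv).1⟩ hu) j
  exact ⟨f.trans g.symm⟩

end Dowker

theorem exists_isMaximalFace_superset {V : Type} [Finite V] {Γ : ASC V} {σ : Finset V}
    (hσ : σ ∈ Γ.faces) : ∃ t, Γ.IsMaximalFace t ∧ σ ⊆ t := by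
  obtain ⟨t, hσt, ht⟩ := (Set.toFinite Γ.faces).exists_le_maximal hσ
  exact ⟨t, ⟨ht.prop, fun t' ht' h => (ht.eq_of_le ht' h).symm⟩, hσt⟩

end ASC

/-- The nerve theorem for the cover by maximal faces: if `Γ` is a nonempty simplicial complex
with (nonempty) maximal faces `τ 1, …, τ m`, and `N` is the nerve of the family
`{τ 1, …, τ m}` (faces: the sets `L ⊆ {1, …, m}` with `⋂_{k ∈ L} τ k ≠ ∅`), then
`H̃_j(Γ; K) ≅ H̃_j(N; K)` for every integer `j`. -/
theorem homology_nerve_of_facets {V : Type} [Fintype V] [LinearOrder V]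
    (K : Type) [Field K] (Γ : ASC V) (hΓ : Γ.faces.Nonempty)
    (m : ℕ) (τ : Fin m → Finset V)
    (hτ : ∀ t, (∃ k, τ k = t) ↔ Γ.IsMaximalFace t)
    (hτne : ∀ k, (τ k).Nonempty)
    (N : ASC (Fin m)) (hN : N.faces = {L : Finset (Fin m) | (L.inf τ).Nonempty})
    (j : ℤ) :
    Nonempty (ASC.reducedHomology K Γ j ≃ₗ[K] ASC.reducedHomology K N j) := by
  have hcover : ∀ σ ∈ Γ.faces, ∃ k, σ ⊆ τ k := by
    intro σ hσ
    obtain ⟨t, ht, hσt⟩ := ASC.exists_isMaximalFace_superset hσ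
    obtain ⟨k, rfl⟩ := (hτ t).mpr ht
    exact ⟨k, hσt⟩
  obtain ⟨σ, hσ⟩ := hΓ
  obtain ⟨k, -⟩ := hcover σ hσ
  obtain ⟨v, -⟩ := hτne k
  have : Nonempty (Fin m) := ⟨k⟩
  have : Nonempty V := ⟨v⟩
  refine ASC.dowker_duality K (fun v k => v ∈ τ k) Γ N ?_ ?_ j
  · exact fun σ => ⟨hcover σ, fun ⟨k, hk⟩ => Γ.down_closed ((hτ _).mp ⟨k, rfl⟩).1 hk⟩
  · intro L
    simp [hN, Finset.Nonempty, Finset.mem_inf]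
end
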